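/- There exists an absolute constant C > 0 such that for every prime p and every set A ⊆ F_p² with |A| ≤ p^{4/3}, the number of non-degenerate isosceles triangles satisfies T*(A) − |A|³/p ≤ C · min( p^{2/3}|A|^{5/3} + p^{1/4}|A|² , |A|^{7/3} ). -/

import Mathlib

namespace Stmt4

/-- The (algebraic) squared distance in the plane `F²`. -/
def dist2 {F : Type*} [CommRing F] (x y : F × F) : F :=
  (x.1 - y.1) ^ 2 + (x.2 - y.2) ^ 2

/-- The dot product on `F²`. -/
def dot {F : Type*} [CommRing F] (x y : F × F) : F :=
  x.1 * y.1 + x.2 * y.2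

/-- `T*(A)`: the number of non-degenerate isosceles triangles
`(a,b,c) ∈ A³` with `d(a,b) = d(a,c)` and `(b-c)·(b-c) ≠ 0`. -/
noncomputable def Tstar {F : Type*} [CommRing F] (A : Finset (F × F)) : ℕ :=
  Set.ncard {t : (F × F) × (F × F) × (F × F) |
    t.1 ∈ A ∧ t.2.1 ∈ A ∧ t.2.2 ∈ A ∧
    dist2 t.1 t.2.1 = dist2 t.1 t.2.2 ∧
    dot (t.2.1 - t.2.2) (t.2.1 - t.2.2) ≠ 0}

open Polynomial in
/-- Restriction of a trivariate polynomial to the line `x ↦ (x, z + w x, s + w² x)`. -/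
noncomputable def ev {k : Type*} [Field k] (w z s : k) :
    MvPolynomial (Fin 3) k →ₐ[k] k[X] :=
  MvPolynomial.aeval ![X, C z + C w * X, C s + C (w ^ 2) * X]

section Restriction

variable {k : Type*} [Field k]

lemma eval_ev (w z s x : k) (g : MvPolynomial (Fin 3) k) :
    (ev w z s g).eval x = MvPolynomial.eval ![x, z + w * x, s + w ^ 2 * x] g := by
  have : (Polynomial.evalRingHom x).comp (ev w z s : MvPolynomial (Fin 3) k →+* Polynomial k) =
      MvPolynomial.eval ![x, z + w * x, s + w ^ 2 * x] := by
    ext i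
    · simp [ev]
    · fin_cases i <;> simp [ev]
  exact congrArg (fun φ => φ g) this

lemma derivative_ev (w z s : k) (g : MvPolynomial (Fin 3) k) :
    Polynomial.derivative (ev w z s g) = ev w z s (MvPolynomial.pderiv 0 g) +
      Polynomial.C w * ev w z s (MvPolynomial.pderiv 1 g) +
      Polynomial.C (w ^ 2) * ev w z s (MvPolynomial.pderiv 2 g) := by
  induction g using MvPolynomial.induction_on with
  | C a => simp [ev]
  | add p q hp hq => simp only [map_add, hp, hq]; ring
  | mul_X p i hp =>
    simp only [map_mul, Polynomial.derivative_mul, hp, Derivation.leibniz, smul_eq_mul, map_add]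
    fin_cases i <;> simp [ev, MvPolynomial.pderiv_X, -map_pow] <;> ring

lemma natDegree_ev_le (w z s : k) (g : MvPolynomial (Fin 3) k) :
    (ev w z s g).natDegree ≤ g.totalDegree := by
  have := MvPolynomial.aeval_natDegree_le (F := g) (m := g.totalDegree) le_rfl
    (![Polynomial.X, Polynomial.C z + Polynomial.C w * Polynomial.X,
      Polynomial.C s + Polynomial.C (w ^ 2) * Polynomial.X] : Fin 3 → Polynomial k) (n := 1) (by
      intro i
      fin_cases i
      · simp
      · simp only [Fin.mk_one, Matrix.cons_val_one, Matrix.cons_val_zero]; compute_degree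
      · simp only [Fin.reduceFinMk, Matrix.cons_val]; compute_degree)
  simpa [ev] using this

lemma pderiv_comm {σ : Type*} (i j : σ) (g : MvPolynomial σ k) :
    MvPolynomial.pderiv i (MvPolynomial.pderiv j g) =
      MvPolynomial.pderiv j (MvPolynomial.pderiv i g) := by
  classical
  have : ⁅(MvPolynomial.pderiv i : Derivation k (MvPolynomial σ k) (MvPolynomial σ k)),
      MvPolynomial.pderiv (R := k) j⁆ = 0 := by
    apply MvPolynomial.derivation_ext
    intro l
    rw [Derivation.commutator_apply]
    simp [MvPolynomial.pderiv_X, Pi.single_apply, apply_ite]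
  have h := congrArg (fun D => D g) this
  simp only [Derivation.commutator_apply] at h
  exact sub_eq_zero.1 h

lemma totalDegree_pderiv_le {σ : Type*} (i : σ) (g : MvPolynomial σ k) :
    (MvPolynomial.pderiv i g).totalDegree ≤ g.totalDegree - 1 := by
  classical
  apply Finset.sup_le
  intro m hm
  rw [MvPolynomial.mem_support_iff, MvPolynomial.coeff_pderiv] at hm
  have h1 : MvPolynomial.coeff (m + Finsupp.single i 1) g ≠ 0 := fun h => hm (by simp [h])
  have h2 := MvPolynomial.le_totalDegree (MvPolynomial.mem_support_iff.2 h1)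
  rw [Finsupp.sum_add_index' (by simp) (by simp)] at h2
  simp at h2
  simp only [Finsupp.sum] at *
  omega

lemma totalDegree_eq_zero_of_pderiv {σ : Type*} (p : ℕ) [CharP k p] (g : MvPolynomial σ k)
    (hp : g.totalDegree < p) (h : ∀ i, MvPolynomial.pderiv i g = 0) : g.totalDegree = 0 := by
  classical
  rw [MvPolynomial.totalDegree_eq_zero_iff]
  intro m hm i
  by_contra h0
  have h1 := congrArg (MvPolynomial.coeff (m - Finsupp.single i 1)) (h i)
  rw [MvPolynomial.coeff_pderiv, tsub_add_cancel_of_le (by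
    simpa [Finsupp.single_le_iff] using Nat.one_le_iff_ne_zero.2 h0)] at h1
  simp only [MvPolynomial.coeff_zero, mul_eq_zero] at h1
  rcases h1 with h1 | h1
  · exact (MvPolynomial.mem_support_iff.1 hm) h1
  · have h2 : ((m i : ℕ) : k) = 0 := by
      rw [← h1]
      have : m i = ((m - Finsupp.single i 1 : σ →₀ ℕ) i) + 1 := by simp; omega
      rw [this]; push_cast; rfl
    rw [CharP.cast_eq_zero_iff k p] at h2
    have h3 := Nat.le_of_dvd (Nat.pos_of_ne_zero h0) h2
    have h4 := MvPolynomial.le_totalDegree hm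
    have h5 : m i ≤ m.sum fun _ e => e :=
      Finset.single_le_sum (f := fun i => m i) (fun _ _ => Nat.zero_le _) (by simpa using h0)
    omega

end Restriction

section Scalar
variable {k : Type*} [Field k]

/-- Flecnode-type expression in the second partials of `f`. -/
def qForm {R : Type*} [CommRing R] (n t f00 f01 f02 f11 f12 f22 : R) : R :=
  t ^ 4 * f00 + 2 * t ^ 3 * n * f01 + t ^ 2 * n ^ 2 * (f11 + 2 * f02) + 2 * t * n ^ 3 * f12 +
    n ^ 4 * f22

lemma qForm_eq_zero {v w f0 f1 f2 f00 f01 f02 f11 f12 f22 : k} (hvw : v ≠ w)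
    (hv : f0 + v * f1 + v ^ 2 * f2 = 0) (hw : f0 + w * f1 + w ^ 2 * f2 = 0)
    (hvv : f00 + v * f01 + v ^ 2 * f02 + v * (f01 + v * f11 + v ^ 2 * f12) +
      v ^ 2 * (f02 + v * f12 + v ^ 2 * f22) = 0) :
    qForm (-(f1 + w * f2)) f2 f00 f01 f02 f11 f12 f22 = 0 := by
  have h1 : f1 + (v + w) * f2 = 0 := by
    apply mul_left_cancel₀ (sub_ne_zero.2 hvw); linear_combination hv - hw
  have h2 : -(f1 + w * f2) = v * f2 := by linear_combination -h1
  rw [h2, qForm]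
  linear_combination f2 ^ 4 * hvv

lemma eForm_eq_zero {v w f0 f1 f2 f00 f01 f02 f11 f12 f22 f000 f001 f002 f011 f012 f022 f111 f112
    f122 f222 : k} (hvw : v ≠ w)
    (hv : f0 + v * f1 + v ^ 2 * f2 = 0) (hw : f0 + w * f1 + w ^ 2 * f2 = 0)
    (hvv : f00 + v * f01 + v ^ 2 * f02 + v * (f01 + v * f11 + v ^ 2 * f12) +
      v ^ 2 * (f02 + v * f12 + v ^ 2 * f22) = 0)
    (hww : f00 + w * f01 + w ^ 2 * f02 + w * (f01 + w * f11 + w ^ 2 * f12) +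
      w ^ 2 * (f02 + w * f12 + w ^ 2 * f22) = 0)
    {p0 p1 p2 q0 q1 q2 : k}
    (hvvv : f000 + v * f001 + v ^ 2 * f002 + v * (f001 + v * f011 + v ^ 2 * f012) +
        v ^ 2 * (f002 + v * f012 + v ^ 2 * f022) +
      v * (f001 + v * f011 + v ^ 2 * f012 + v * (f011 + v * f111 + v ^ 2 * f112) +
        v ^ 2 * (f012 + v * f112 + v ^ 2 * f122)) +
      v ^ 2 * (f002 + v * f012 + v ^ 2 * f022 + v * (f012 + v * f112 + v ^ 2 * f122) +
        v ^ 2 * (f022 + v * f122 + v ^ 2 * f222)) = 0)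
    {n n' t' e00 e01 e02 e11 e12 e22 a a' a'' b' b'' : k}
    (hn : n = -(f1 + w * f2)) (ht' : t' = f02 + w * f12 + w ^ 2 * f22)
    (hn' : n' = -(f01 + w * f11 + w ^ 2 * f12 + w * (f02 + w * f12 + w ^ 2 * f22)))
    (he00 : e00 = f000 + w * f001 + w ^ 2 * f002) (he01 : e01 = f001 + w * f011 + w ^ 2 * f012)
    (he02 : e02 = f002 + w * f012 + w ^ 2 * f022) (he11 : e11 = f011 + w * f111 + w ^ 2 * f112)
    (he12 : e12 = f012 + w * f112 + w ^ 2 * f122) (he22 : e22 = f022 + w * f122 + w ^ 2 * f222)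
    (hQ : 4 * f2 ^ 3 * t' * f00 + f2 ^ 4 * e00 + 6 * f2 ^ 2 * t' * n * f01 +
      2 * f2 ^ 3 * n' * f01 + 2 * f2 ^ 3 * n * e01 + 2 * f2 * t' * n ^ 2 * (f11 + 2 * f02) +
      2 * f2 ^ 2 * n * n' * (f11 + 2 * f02) + f2 ^ 2 * n ^ 2 * (e11 + 2 * e02) +
      2 * t' * n ^ 3 * f12 + 6 * f2 * n ^ 2 * n' * f12 + 2 * f2 * n ^ 3 * e12 +
      4 * n ^ 3 * n' * f22 + n ^ 4 * e22 = 0)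
    (ha : a = f1 + 2 * v * f2)
    (ha' : a' = f01 + v * f11 + v ^ 2 * f12 + 2 * v * (f02 + v * f12 + v ^ 2 * f22))
    (hb' : b' = f02 + v * f12 + v ^ 2 * f22)
    (hp0 : p0 = f001 + v * f011 + v ^ 2 * f012) (hp1 : p1 = f011 + v * f111 + v ^ 2 * f112)
    (hp2 : p2 = f012 + v * f112 + v ^ 2 * f122)
    (hq0 : q0 = f002 + v * f012 + v ^ 2 * f022) (hq1 : q1 = f012 + v * f112 + v ^ 2 * f122)
    (hq2 : q2 = f022 + v * f122 + v ^ 2 * f222)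
    (ha'' : a'' = p0 + v * p1 + v ^ 2 * p2 + 2 * v * (q0 + v * q1 + v ^ 2 * q2))
    (hb'' : b'' = q0 + v * q1 + v ^ 2 * q2) :
    2 * a' * (f2 * a' - a * b') - a * (f2 * a'' - a * b'') = 0 := by
  have h1 : f1 + (v + w) * f2 = 0 := by
    apply mul_left_cancel₀ (sub_ne_zero.2 hvw); linear_combination hv - hw
  by_cases h2 : f2 = 0
  · have h3 : f1 = 0 := by simpa [h2] using h1
    simp [ha, h2, h3]
  have hn2 : n = v * f2 := by rw [hn]; linear_combination -h1
  have ha2 : a = -(w - v) * f2 := by rw [ha]; linear_combination h1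
  have hx : n' - v * t' = a' + (w - v) * b' := by
    apply mul_left_cancel₀ (sub_ne_zero.2 (Ne.symm hvw))
    rw [hn', ht', ha', hb']
    linear_combination -hww + hvv
  have hH : e00 + 2 * v * e01 + v ^ 2 * (e11 + 2 * e02) + 2 * v ^ 3 * e12 + v ^ 4 * e22 =
      (w - v) * a'' + (w - v) ^ 2 * b'' := by
    rw [he00, he01, he11, he12, he22, he02, ha'', hb'', hp0, hp1, hp2, hq0, hq1, hq2]
    linear_combination hvvv
  have hK : 2 * a' * (n' - v * t') + f2 * (e00 + 2 * v * e01 + v ^ 2 * (e11 + 2 * e02) +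
      2 * v ^ 3 * e12 + v ^ 4 * e22) = 0 := by
    apply mul_left_cancel₀ (pow_ne_zero 3 h2)
    rw [hn2] at hQ
    rw [ha']
    linear_combination hQ - 4 * f2 ^ 3 * t' * hvv
  rw [hx, hH] at hK
  rw [ha2]
  linear_combination f2 * hK

end Scalar

section Core
variable {k : Type*} [Field k]

lemma exists_vanishing {ι : Type*} (V : Finset ι) (w z s : ι → k) (e : ℕ)
    (he : V.card * (3 * e + 1) < (e + 1) ^ 3) :
    ∃ f : MvPolynomial (Fin 3) k, f ≠ 0 ∧ f.totalDegree ≤ 3 * e ∧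
      ∀ i ∈ V, ev (w i) (z i) (s i) f = 0 := by
  classical
  let τ : (Fin 3 → Fin (e + 1)) → (Fin 3 →₀ ℕ) :=
    fun t => Finsupp.equivFunOnFinite.symm fun i => (t i : ℕ)
  have hτ : Function.Injective τ := by
    intro t t' h
    ext i
    exact DFunLike.congr_fun h i
  let P : ((Fin 3 → Fin (e + 1)) → k) →ₗ[k] MvPolynomial (Fin 3) k :=
    ∑ t, (MvPolynomial.monomial (τ t)).comp (LinearMap.proj t)
  have hP : ∀ c t, MvPolynomial.coeff (τ t) (P c) = c t := by
    intro c t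
    simp only [P, LinearMap.sum_apply, LinearMap.comp_apply, LinearMap.proj_apply,
      MvPolynomial.coeff_sum, MvPolynomial.coeff_monomial]
    rw [Finset.sum_eq_single t]
    · simp
    · intro b _ hb; rw [if_neg (fun h => hb (hτ h))]
    · simp
  have hdeg : ∀ c, (P c).totalDegree ≤ 3 * e := by
    intro c
    simp only [P, LinearMap.sum_apply, LinearMap.comp_apply, LinearMap.proj_apply]
    refine MvPolynomial.totalDegree_finsetSum_le fun t _ => ?_
    refine (MvPolynomial.totalDegree_monomial_le _ _).trans ?_
    rw [Finsupp.sum_fintype _ _ (by simp), Fin.sum_univ_three]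
    have := (t 0).2; have := (t 1).2; have := (t 2).2
    simp only [τ, Finsupp.equivFunOnFinite_symm_apply_apply, id]
    omega
  let M : ((Fin 3 → Fin (e + 1)) → k) →ₗ[k] (V × Fin (3 * e + 1) → k) :=
    LinearMap.pi fun q => (Polynomial.lcoeff k (q.2 : ℕ)).comp
      ((ev (w q.1) (z q.1) (s q.1)).toLinearMap.comp P)
  obtain ⟨c, hc, hc0⟩ := Submodule.exists_mem_ne_zero_of_ne_bot
    (LinearMap.ker_ne_bot_of_finrank_lt (f := M) (by simpa using he))
  refine ⟨P c, fun h => hc0 ?_, hdeg c, fun i hi => ?_⟩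
  · ext t
    rw [← hP c t, h]; simp
  · ext j
    by_cases hj : j < 3 * e + 1
    · have := congrFun (LinearMap.mem_ker.1 hc) (⟨i, hi⟩, ⟨j, hj⟩)
      simpa [M] using this
    · rw [Polynomial.coeff_eq_zero_of_natDegree_lt]
      · simp
      · have := natDegree_ev_le (w i) (z i) (s i) (P c)
        have := hdeg c
        omega

lemma exists_min_vanishing {ι : Type*} (p : ℕ) [CharP k p] (V : Finset ι) (hV : V.Nonempty)
    (w z s : ι → k) (m : ℕ) (hm : V.card * (m + 1) * 27 < (m + 3) ^ 3) (h3 : 3 ∣ m) (hp : m < p) :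
    ∃ f : MvPolynomial (Fin 3) k, f.totalDegree ≤ m ∧
      (∀ i ∈ V, ev (w i) (z i) (s i) f = 0) ∧
      ∃ j, ∃ i ∈ V, ev (w i) (z i) (s i) (MvPolynomial.pderiv j f) ≠ 0 := by
  classical
  obtain ⟨e, rfl⟩ := h3
  obtain ⟨f0, hf0, hd0, hv0⟩ := exists_vanishing V w z s e (by
    have : (3 * e + 3) ^ 3 = 27 * (e + 1) ^ 3 := by ring
    rw [this] at hm; omega)
  have hex : ∃ d, ∃ f : MvPolynomial (Fin 3) k, f ≠ 0 ∧ f.totalDegree = d ∧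
      ∀ i ∈ V, ev (w i) (z i) (s i) f = 0 := ⟨_, f0, hf0, rfl, hv0⟩
  obtain ⟨f, hf, hd, hv⟩ := Nat.find_spec hex
  have hmin : ∀ g : MvPolynomial (Fin 3) k, g ≠ 0 → (∀ i ∈ V, ev (w i) (z i) (s i) g = 0) →
      f.totalDegree ≤ g.totalDegree := fun g hg hgv => by
    rw [hd]; exact Nat.find_min' hex ⟨g, hg, rfl, hgv⟩
  have hfm := (hmin f0 hf0 hv0).trans hd0
  refine ⟨f, hfm, hv, ?_⟩
  by_contra! hcon
  have hpos : f.totalDegree ≠ 0 := by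
    intro h0
    rw [MvPolynomial.totalDegree_eq_zero_iff_eq_C] at h0
    obtain ⟨i, hi⟩ := hV
    have := hv i hi
    rw [h0] at this
    simp only [ev, MvPolynomial.aeval_C] at this
    apply hf
    rw [h0]
    have h2 : (MvPolynomial.coeff 0 f) = 0 := by simpa using this
    rw [h2, map_zero]
  apply hpos
  apply totalDegree_eq_zero_of_pderiv p f (by omega)
  intro j
  by_contra hj
  have h1 := hmin _ hj (hcon j)
  have h2 := totalDegree_pderiv_le j f
  omega

/-- A polynomial with more roots on an indexed family of distinct points than its degree is zero. -/
lemma eq_zero_of_many_roots {ι : Type*} (g : Polynomial k) (S : Finset ι) (x : ι → k)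
    (hx : Set.InjOn x S) (h : ∀ i ∈ S, g.eval (x i) = 0) (hd : g.natDegree < S.card) : g = 0 := by
  classical
  apply Polynomial.eq_zero_of_natDegree_lt_card_of_eval_eq_zero' g (S.image x)
  · simpa using h
  · rwa [Finset.card_image_of_injOn hx]

lemma card_roots_le {ι : Type*} [DecidableEq k] (g : Polynomial k) (S : Finset ι) (x : ι → k)
    (hx : Set.InjOn x S) (hg : g ≠ 0) :
    S.card ≤ (S.filter fun i => g.eval (x i) ≠ 0).card + g.natDegree := by
  classical
  have := Finset.card_filter_add_card_filter_not (s := S) (fun i => g.eval (x i) ≠ 0)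
  have h2 : (S.filter fun i => ¬ g.eval (x i) ≠ 0).card ≤ g.natDegree := by
    by_contra! h
    exact hg (eq_zero_of_many_roots g _ x (hx.mono (Finset.coe_subset.2 (Finset.filter_subset _ _)))
      (by simp) h)
  omega

/-- Proportionality from a Wronskian identity, in degree below the characteristic. -/
lemma exists_C_mul_of_wronskian (p : ℕ) [CharP k p] (g h : Polynomial k) (hh : h ≠ 0)
    (hw : Polynomial.derivative g * h = g * Polynomial.derivative h)
    (hg : g.natDegree < p) (hhp : h.natDegree < p) : ∃ c, g = Polynomial.C c * h := by
  classical
  by_contra! hcon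
  -- subtract a multiple to get distinct degrees
  have key : ∀ g : Polynomial k, g ≠ 0 → g.natDegree < p →
      Polynomial.derivative g * h = g * Polynomial.derivative h → g.natDegree = h.natDegree := by
    intro g hg0 hgp hw
    by_contra hne
    have hlead : (g.leadingCoeff * h.leadingCoeff) * ((g.natDegree : k) - h.natDegree) = 0 := by
      have e1 : ∀ a b : Polynomial k, a ≠ 0 →
          (Polynomial.X * (Polynomial.derivative a * b)).coeff (a.natDegree + b.natDegree) =
          (a.natDegree : k) * (a.leadingCoeff * b.leadingCoeff) := by
        intro a b ha
        rw [← mul_assoc, Polynomial.coeff_mul_add_eq_of_natDegree_le ?_ le_rfl]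
        · rcases Nat.eq_zero_or_pos a.natDegree with h0 | h0
          · rw [h0]; simp
          · obtain ⟨d, hd⟩ := Nat.exists_eq_succ_of_ne_zero h0.ne'
            rw [Polynomial.leadingCoeff, hd, Nat.succ_eq_add_one, Polynomial.coeff_X_mul,
              Polynomial.coeff_derivative]
            rw [Polynomial.coeff_natDegree]; push_cast; ring
        · rcases Nat.eq_zero_or_pos a.natDegree with h0 | h0
          · rw [Polynomial.natDegree_eq_zero.1 h0 |>.choose_spec.symm]; simp
          · refine Polynomial.natDegree_mul_le.trans ?_
            have := Polynomial.natDegree_derivative_lt h0.ne'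
            have := Polynomial.natDegree_X_le (R := k)
            omega
      have a1 := e1 g h hg0
      have a2 := e1 h g hh
      rw [hw] at a1
      rw [add_comm, mul_comm (Polynomial.derivative h) g] at a2
      rw [a1] at a2
      linear_combination a2
    rw [mul_eq_zero, mul_eq_zero] at hlead
    rcases hlead with (h0 | h0) | h0
    · exact hg0 (Polynomial.leadingCoeff_eq_zero.1 h0)
    · exact hh (Polynomial.leadingCoeff_eq_zero.1 h0)
    · exact hne (CharP.natCast_injOn_Iio k p hgp hhp (sub_eq_zero.1 h0))
  have hg0 : g ≠ 0 := fun h0 => hcon 0 (by simp [h0])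
  have hdeg := key g hg0 hg hw
  let c := g.leadingCoeff / h.leadingCoeff
  have hlt : (g - Polynomial.C c * h).natDegree ≤ g.natDegree :=
    (Polynomial.natDegree_sub_le _ _).trans (max_le le_rfl
      ((Polynomial.natDegree_C_mul_le _ _).trans hdeg.ge))
  have hr0 : g - Polynomial.C c * h ≠ 0 := fun h0 => hcon c (sub_eq_zero.1 h0)
  have hd2 := key (g - Polynomial.C c * h) hr0 (hlt.trans_lt hg) (by
    simp only [map_sub, Polynomial.derivative_C_mul]
    linear_combination hw)
  have hz : (g - Polynomial.C c * h).leadingCoeff = 0 := by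
    rw [Polynomial.leadingCoeff, hd2, Polynomial.coeff_sub, Polynomial.coeff_C_mul, ← hdeg]
    have : h.leadingCoeff ≠ 0 := Polynomial.leadingCoeff_ne_zero.2 hh
    simp only [c, Polynomial.leadingCoeff] at *
    rw [hdeg] at *
    field_simp; simp
  exact hr0 (Polynomial.leadingCoeff_eq_zero.1 hz)

end Core

section Core
variable {k : Type*} [Field k]

lemma natDegree_qForm_le {m : ℕ} {n t f00 f01 f02 f11 f12 f22 : Polynomial k}
    (hn : n.natDegree ≤ m) (ht : t.natDegree ≤ m) (h00 : f00.natDegree ≤ m)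
    (h01 : f01.natDegree ≤ m) (h02 : f02.natDegree ≤ m) (h11 : f11.natDegree ≤ m)
    (h12 : f12.natDegree ≤ m) (h22 : f22.natDegree ≤ m) :
    (qForm n t f00 f01 f02 f11 f12 f22).natDegree ≤ 5 * m := by
  have h2 : (2 : Polynomial k).natDegree ≤ 0 := by
    rw [show (2 : Polynomial k) = Polynomial.C 2 from rfl, Polynomial.natDegree_C]
  have mul {P Q : Polynomial k} {a b : ℕ} (hP : P.natDegree ≤ a) (hQ : Q.natDegree ≤ b) :=
    Polynomial.natDegree_mul_le_of_le hP hQ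
  have pow {P : Polynomial k} {a : ℕ} (j : ℕ) (hP : P.natDegree ≤ a) :=
    Polynomial.natDegree_pow_le_of_le j hP
  have add {P Q : Polynomial k} {a : ℕ} (hP : P.natDegree ≤ a) (hQ : Q.natDegree ≤ a) :
    (P + Q).natDegree ≤ a := Polynomial.natDegree_add_le_of_degree_le hP hQ
  refine add (add (add (add ?_ ?_) ?_) ?_) ?_
  · exact (mul (pow 4 ht) h00).trans (by omega)
  · exact (mul (mul (mul h2 (pow 3 ht)) hn) h01).trans (by omega)
  · exact (mul (mul (pow 2 ht) (pow 2 hn)) (add h11 ((mul h2 h02).trans (by omega)))).trans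
      (by omega)
  · exact (mul (mul (mul h2 ht) (pow 3 hn)) h12).trans (by omega)
  · exact (mul (pow 4 hn) h22).trans (by omega)

lemma derivative_qForm (n t f00 f01 f02 f11 f12 f22 : Polynomial k) (n' t' e00 e01 e02 e11 e12 e22 :
      Polynomial k)
    (hn : Polynomial.derivative n = n') (ht : Polynomial.derivative t = t')
    (h00 : Polynomial.derivative f00 = e00) (h01 : Polynomial.derivative f01 = e01)
    (h02 : Polynomial.derivative f02 = e02) (h11 : Polynomial.derivative f11 = e11)
    (h12 : Polynomial.derivative f12 = e12) (h22 : Polynomial.derivative f22 = e22) :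
    Polynomial.derivative (qForm n t f00 f01 f02 f11 f12 f22) =
      4 * t ^ 3 * t' * f00 + t ^ 4 * e00 + 6 * t ^ 2 * t' * n * f01 +
      2 * t ^ 3 * n' * f01 + 2 * t ^ 3 * n * e01 + 2 * t * t' * n ^ 2 * (f11 + 2 * f02) +
      2 * t ^ 2 * n * n' * (f11 + 2 * f02) + t ^ 2 * n ^ 2 * (e11 + 2 * e02) +
      2 * t' * n ^ 3 * f12 + 6 * t * n ^ 2 * n' * f12 + 2 * t * n ^ 3 * e12 +
      4 * n ^ 3 * n' * f22 + n ^ 4 * e22 := by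
  have h2 : Polynomial.derivative (2 : Polynomial k) = 0 := by simp
  have c3 : (Polynomial.C (3 : k)) = 3 := rfl
  have c2 : (Polynomial.C (2 : k)) = 2 := rfl
  have c4 : (Polynomial.C (4 : k)) = 4 := rfl
  simp only [qForm, map_add, Polynomial.derivative_mul, Polynomial.derivative_pow, h2, hn, ht, h00,
    h01, h02, h11, h12, h22, Nat.cast_ofNat, Nat.reduceSub, c3, c4, c2]
  ring

/-- The crossing parameter of the lines `i` and `j`. -/
lemma eval_ev_cross {w z s w' z' s' : k} (hw : w ≠ w') (hs : s - s' = (w + w') * (z - z'))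
    (g : MvPolynomial (Fin 3) k) :
    (ev w z s g).eval (-(z - z') / (w - w')) = (ev w' z' s' g).eval (-(z - z') / (w - w')) := by
  have h := sub_ne_zero.2 hw
  rw [eval_ev, eval_ev]
  congr 2
  have h1 : z + w * (-(z - z') / (w - w')) = z' + w' * (-(z - z') / (w - w')) := by
    field_simp; ring
  have h2 : s + w ^ 2 * (-(z - z') / (w - w')) = s' + w' ^ 2 * (-(z - z') / (w - w')) := by
    rw [show s = s' + (w + w') * (z - z') by linear_combination hs]
    field_simp; ring
  rw [h1, h2]

open MvPolynomial in
/-- The derivation along the direction `(1, w, w²)`. -/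
noncomputable def dirD (w : k) (f : MvPolynomial (Fin 3) k) : MvPolynomial (Fin 3) k :=
  pderiv 0 f + C w * pderiv 1 f + C (w ^ 2) * pderiv 2 f

lemma derivative_ev' (w z s : k) (g : MvPolynomial (Fin 3) k) :
    Polynomial.derivative (ev w z s g) = ev w z s (dirD w g) := by
  rw [derivative_ev, dirD]
  simp [ev]

lemma ev_dirD_eq_zero {w z s : k} {f : MvPolynomial (Fin 3) k} (h : ev w z s f = 0) :
    ev w z s (dirD w f) = 0 := by
  rw [← derivative_ev', h]; simp

lemma eval_ev_dirD (w z s x v : k) (g : MvPolynomial (Fin 3) k) :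
    (ev w z s (dirD v g)).eval x = (ev w z s (MvPolynomial.pderiv 0 g)).eval x +
      v * (ev w z s (MvPolynomial.pderiv 1 g)).eval x +
      v ^ 2 * (ev w z s (MvPolynomial.pderiv 2 g)).eval x := by
  simp [dirD, ev]

lemma pderiv_dirD (i : Fin 3) (v : k) (g : MvPolynomial (Fin 3) k) :
    MvPolynomial.pderiv i (dirD v g) = dirD v (MvPolynomial.pderiv i g) := by
  simp only [dirD, map_add, MvPolynomial.pderiv_C_mul, pderiv_comm i]

end Core

section Core
variable {k : Type*} [Field k]
open MvPolynomial in
/-- The flecnode-type polynomial of `f` along a line of direction `w`. -/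
noncomputable def qPoly (w z s : k) (f : MvPolynomial (Fin 3) k) : Polynomial k :=
  qForm (-ev w z s (pderiv 1 f + C w * pderiv 2 f)) (ev w z s (pderiv 2 f))
    (ev w z s (pderiv 0 (pderiv 0 f))) (ev w z s (pderiv 0 (pderiv 1 f)))
    (ev w z s (pderiv 0 (pderiv 2 f))) (ev w z s (pderiv 1 (pderiv 1 f)))
    (ev w z s (pderiv 1 (pderiv 2 f))) (ev w z s (pderiv 2 (pderiv 2 f)))

open MvPolynomial in
/-- Restriction of the transversal derivative along a line of direction `v`. -/
noncomputable def aPoly (v z s : k) (f : MvPolynomial (Fin 3) k) : Polynomial k :=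
  ev v z s (pderiv 1 f + C (2 * v) * pderiv 2 f)

open MvPolynomial in
/-- Restriction of the last partial derivative along a line of direction `v`. -/
noncomputable def bPoly (v z s : k) (f : MvPolynomial (Fin 3) k) : Polynomial k :=
  ev v z s (pderiv 2 f)

open Polynomial in
/-- A second order differential expression in `aPoly` and `bPoly`. -/
noncomputable def ePoly (a b : k[X]) : k[X] :=
  2 * derivative a * (b * derivative a - a * derivative b) -
    a * (b * derivative (derivative a) - a * derivative (derivative b))

lemma totalDegree_pderiv_le' {m : ℕ} {f : MvPolynomial (Fin 3) k} (hf : f.totalDegree ≤ m)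
    (i : Fin 3) : (MvPolynomial.pderiv i f).totalDegree ≤ m :=
  (totalDegree_pderiv_le i f).trans (by omega)

lemma totalDegree_add_C_mul {m : ℕ} {f g : MvPolynomial (Fin 3) k} (hf : f.totalDegree ≤ m)
    (hg : g.totalDegree ≤ m) (c : k) : (f + MvPolynomial.C c * g).totalDegree ≤ m := by
  refine (MvPolynomial.totalDegree_add _ _).trans (max_le hf ?_)
  refine (MvPolynomial.totalDegree_mul _ _).trans ?_
  simpa using hg

lemma natDegree_qPoly_le {m : ℕ} {f : MvPolynomial (Fin 3) k} (hf : f.totalDegree ≤ m)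
    (w z s : k) : (qPoly w z s f).natDegree ≤ 5 * m := by
  have h (g : MvPolynomial (Fin 3) k) (hg : g.totalDegree ≤ m) : (ev w z s g).natDegree ≤ m :=
    (natDegree_ev_le w z s g).trans hg
  have d := @totalDegree_pderiv_le' k _ m
  refine natDegree_qForm_le ?_ (h _ (d hf _)) (h _ (d (d hf _) _)) (h _ (d (d hf _) _))
    (h _ (d (d hf _) _)) (h _ (d (d hf _) _)) (h _ (d (d hf _) _)) (h _ (d (d hf _) _))
  rw [Polynomial.natDegree_neg]
  exact h _ (totalDegree_add_C_mul (d hf _) (d hf _) _)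

lemma natDegree_aPoly_le {m : ℕ} {f : MvPolynomial (Fin 3) k} (hf : f.totalDegree ≤ m)
    (w z s : k) : (aPoly w z s f).natDegree ≤ m :=
  (natDegree_ev_le w z s _).trans
    (totalDegree_add_C_mul (totalDegree_pderiv_le' hf _) (totalDegree_pderiv_le' hf _) _)

lemma natDegree_bPoly_le {m : ℕ} {f : MvPolynomial (Fin 3) k} (hf : f.totalDegree ≤ m)
    (w z s : k) : (bPoly w z s f).natDegree ≤ m :=
  (natDegree_ev_le w z s _).trans (totalDegree_pderiv_le' hf _)

lemma natDegree_derivative_le' {m : ℕ} {a : Polynomial k} (ha : a.natDegree ≤ m) :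
    (Polynomial.derivative a).natDegree ≤ m :=
  (Polynomial.natDegree_derivative_le a).trans (by omega)

lemma natDegree_wronskian_le {m : ℕ} {a b c d : Polynomial k} (ha : a.natDegree ≤ m)
    (hb : b.natDegree ≤ m) (hc : c.natDegree ≤ m) (hd : d.natDegree ≤ m) :
    (a * b - c * d).natDegree ≤ 2 * m := by
  refine (Polynomial.natDegree_sub_le _ _).trans (max_le ?_ ?_)
  · exact (Polynomial.natDegree_mul_le_of_le ha hb).trans (by omega)
  · exact (Polynomial.natDegree_mul_le_of_le hc hd).trans (by omega)

lemma natDegree_ePoly_le {m : ℕ} {a b : Polynomial k} (ha : a.natDegree ≤ m)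
    (hb : b.natDegree ≤ m) : (ePoly a b).natDegree ≤ 5 * m := by
  have d := @natDegree_derivative_le' k _ m
  have h2 : (2 : Polynomial k).natDegree ≤ 0 := by
    rw [show (2 : Polynomial k) = Polynomial.C 2 from rfl, Polynomial.natDegree_C]
  refine (Polynomial.natDegree_sub_le _ _).trans (max_le ?_ ?_)
  · exact (Polynomial.natDegree_mul_le_of_le (Polynomial.natDegree_mul_le_of_le h2 (d ha))
      (natDegree_wronskian_le hb (d ha) ha (d hb))).trans (by omega)
  · exact (Polynomial.natDegree_mul_le_of_le ha
      (natDegree_wronskian_le hb (d (d ha)) ha (d (d hb)))).trans (by omega)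

section Cross
variable {w z s v z' s' : k} {f : MvPolynomial (Fin 3) k}

lemma pderiv_normal (g : MvPolynomial (Fin 3) k) :
    MvPolynomial.pderiv 1 (MvPolynomial.pderiv 0 g) = MvPolynomial.pderiv 0 (MvPolynomial.pderiv 1 g)
    ∧ MvPolynomial.pderiv 2 (MvPolynomial.pderiv 0 g) =
      MvPolynomial.pderiv 0 (MvPolynomial.pderiv 2 g)
    ∧ MvPolynomial.pderiv 2 (MvPolynomial.pderiv 1 g) =
      MvPolynomial.pderiv 1 (MvPolynomial.pderiv 2 g) :=
  ⟨pderiv_comm _ _ _, pderiv_comm _ _ _, pderiv_comm _ _ _⟩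

lemma eval_qPoly_cross (hw : w ≠ v) (hs : s - s' = (w + v) * (z - z'))
    (h : ev w z s f = 0) (h' : ev v z' s' f = 0) :
    (qPoly w z s f).eval (-(z - z') / (w - v)) = 0 := by
  set x := -(z - z') / (w - v) with hx
  have hcr := eval_ev_cross hw hs
  rw [← hx] at hcr
  have e1 := congrArg (Polynomial.eval x) (ev_dirD_eq_zero h)
  have e2 := congrArg (Polynomial.eval x) (ev_dirD_eq_zero h')
  have e3 := congrArg (Polynomial.eval x) (ev_dirD_eq_zero (ev_dirD_eq_zero h'))
  rw [← hcr] at e2 e3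
  simp only [eval_ev_dirD, Polynomial.eval_zero, pderiv_dirD, (pderiv_normal _).1,
    (pderiv_normal _).2.1, (pderiv_normal _).2.2] at e1 e2 e3
  have := qForm_eq_zero hw.symm e2 e1 e3
  rw [← this, qPoly]
  simp [qForm, ev]

lemma eval_ePoly_cross (hw : w ≠ v) (hs : s - s' = (w + v) * (z - z'))
    (h : ev w z s f = 0) (h' : ev v z' s' f = 0) (hQ : qPoly w z s f = 0) :
    (ePoly (aPoly v z' s' f) (bPoly v z' s' f)).eval (-(z - z') / (w - v)) = 0 := by
  set x := -(z - z') / (w - v) with hx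
  have hcr := eval_ev_cross hw hs
  rw [← hx] at hcr
  have e1 := congrArg (Polynomial.eval x) (ev_dirD_eq_zero h)
  have e2 := congrArg (Polynomial.eval x) (ev_dirD_eq_zero h')
  have e3 := congrArg (Polynomial.eval x) (ev_dirD_eq_zero (ev_dirD_eq_zero h'))
  have e4 := congrArg (Polynomial.eval x) (ev_dirD_eq_zero (ev_dirD_eq_zero h))
  have e5 := congrArg (Polynomial.eval x)
    (ev_dirD_eq_zero (ev_dirD_eq_zero (ev_dirD_eq_zero h')))
  rw [← hcr] at e2 e3 e5
  have hQ' := congrArg (fun q => (Polynomial.derivative q).eval x) hQ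
  simp only [qPoly] at hQ'
  rw [derivative_qForm _ _ _ _ _ _ _ _ _ _ _ _ _ _ _ _ rfl rfl rfl rfl rfl rfl rfl rfl] at hQ'
  simp only [Polynomial.derivative_neg, derivative_ev'] at hQ'
  simp only [ePoly, aPoly, bPoly, derivative_ev']
  simp only [Polynomial.eval_sub, Polynomial.eval_mul, Polynomial.eval_ofNat, ← hcr,
    Polynomial.eval_add, Polynomial.eval_pow, Polynomial.derivative_zero, Polynomial.eval_neg]
      at hQ' ⊢
  have hadd (u c : k) (g1 g2 : MvPolynomial (Fin 3) k) :
      dirD u (g1 + MvPolynomial.C c * g2) = dirD u g1 + MvPolynomial.C c * dirD u g2 := by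
    simp only [dirD, map_add, MvPolynomial.pderiv_C_mul]; ring
  have hev (c : k) (g1 g2 : MvPolynomial (Fin 3) k) :
      (ev w z s (g1 + MvPolynomial.C c * g2)).eval x =
        (ev w z s g1).eval x + c * (ev w z s g2).eval x := by simp [ev]
  simp only [hadd, hev] at hQ' ⊢
  simp only [eval_ev_dirD, Polynomial.eval_zero, pderiv_dirD, (pderiv_normal _).1,
    (pderiv_normal _).2.1, (pderiv_normal _).2.2] at e1 e2 e3 e4 e5 hQ' ⊢
  exact eForm_eq_zero hw.symm e2 e1 e3 e4 e5 rfl rfl rfl rfl rfl rfl rfl rfl rfl hQ' rfl rfl rfl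
    rfl rfl rfl rfl rfl rfl rfl rfl

lemma eval_aPoly_cross (hw : w ≠ v) (hs : s - s' = (w + v) * (z - z'))
    (h : ev w z s f = 0) (h' : ev v z' s' f = 0) :
    (aPoly v z' s' f).eval (-(z - z') / (w - v)) =
      -(w - v) * (bPoly v z' s' f).eval (-(z - z') / (w - v)) := by
  set x := -(z - z') / (w - v) with hx
  have hcr := eval_ev_cross hw hs
  rw [← hx] at hcr
  have e1 := congrArg (Polynomial.eval x) (ev_dirD_eq_zero h)
  have e2 := congrArg (Polynomial.eval x) (ev_dirD_eq_zero h')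
  rw [hcr] at e1
  simp only [eval_ev_dirD, Polynomial.eval_zero] at e1 e2
  have : (aPoly v z' s' f).eval x = (ev v z' s' (MvPolynomial.pderiv 1 f)).eval x +
      2 * v * (ev v z' s' (MvPolynomial.pderiv 2 f)).eval x := by simp [aPoly, ev]
  rw [this, bPoly]
  apply mul_left_cancel₀ (sub_ne_zero.2 hw)
  linear_combination e1 - e2

end Cross

/-- A solution of `ePoly a b = 0` with `a ≠ 0` in small degree is `b = (c x + e) a`. -/
lemma exists_linear_of_ePoly (p : ℕ) [CharP k p] {m : ℕ} (hm : 2 * m + 2 < p)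
    {a b : Polynomial k} (ha : a.natDegree ≤ m) (hb : b.natDegree ≤ m) (ha0 : a ≠ 0)
    (hE : ePoly a b = 0) :
    ∃ c e : k, b = (Polynomial.C c * Polynomial.X + Polynomial.C e) * a := by
  have d := @natDegree_derivative_le' k _ m
  obtain ⟨c, hc⟩ := exists_C_mul_of_wronskian p
    (a * Polynomial.derivative b - b * Polynomial.derivative a) (a ^ 2) (pow_ne_zero 2 ha0) (by
      apply mul_left_cancel₀ ha0
      simp only [map_sub, Polynomial.derivative_mul, Polynomial.derivative_pow,
        Nat.cast_ofNat, Nat.reduceSub, show Polynomial.C (2 : k) = 2 from rfl]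
      rw [ePoly] at hE
      linear_combination (a ^ 2) * hE)
    (lt_of_le_of_lt (natDegree_wronskian_le ha (d hb) hb (d ha)) (by omega))
    (lt_of_le_of_lt (Polynomial.natDegree_pow_le_of_le 2 ha) (by omega))
  have hcX : (Polynomial.C c * Polynomial.X).natDegree ≤ 1 := by
    compute_degree
  obtain ⟨e, he⟩ := exists_C_mul_of_wronskian p (b - Polynomial.C c * Polynomial.X * a) a ha0 (by
      simp only [map_sub, Polynomial.derivative_mul, Polynomial.derivative_C,
        Polynomial.derivative_X]
      linear_combination hc)
    (lt_of_le_of_lt (Polynomial.natDegree_sub_le_of_le (hb.trans (Nat.le_add_left m 1))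
      (Polynomial.natDegree_mul_le_of_le hcX ha)) (by omega)) (by omega)
  exact ⟨c, e, by linear_combination he⟩

end Core

section Core
variable {k : Type*} [Field k]

/-- Lines in a parabolic family with many crossings: two crossing lines both have more than `K`
neighbours in a plane-type position. -/
theorem exists_plane_rich_lines (p : ℕ) [CharP k p] {ι : Type*} [DecidableEq ι] [DecidableEq k]
    (V : Finset ι) (hV : V.Nonempty) (nb : ι → Finset ι) (w z s : ι → k)
    (hnb : ∀ i ∈ V, nb i ⊆ V) (hdir : ∀ i ∈ V, ∀ j ∈ nb i, w j ≠ w i)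
    (hmeet : ∀ i ∈ V, ∀ j ∈ nb i, s j - s i = (w j + w i) * (z j - z i))
    (hinj : ∀ i ∈ V, Set.InjOn (fun j => -(z j - z i) / (w j - w i)) (nb i))
    (m K : ℕ) (hm : V.card * (m + 1) * 27 < (m + 3) ^ 3) (h3 : 3 ∣ m) (hp : 2 * m + 2 < p)
    (hD : ∀ i ∈ V, 5 * m + K < (nb i).card) :
    ∃ i ∈ V, ∃ j ∈ nb i, ∀ l, l = i ∨ l = j → ∃ c e : k, (c ≠ 0 ∨ e ≠ 0) ∧
      K < ((nb l).filter fun j => e * (w j - w l) - c * (z j - z l) = -1).card := by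
  classical
  obtain ⟨f, hfd, hfV, hfne⟩ := exists_min_vanishing p V hV w z s m hm h3 (by omega)
  have hsym : ∀ i j, -(z i - z j) / (w i - w j) = -(z j - z i) / (w j - w i) := by
    intro i j
    rw [← neg_sub (w j) (w i), ← neg_sub (z j) (z i), div_neg, neg_div, neg_neg]
  have hmeet' : ∀ i ∈ V, ∀ j ∈ nb i, s i - s j = (w i + w j) * (z i - z j) := fun i hi j hj => by
    linear_combination -hmeet i hi j hj
  have hQ : ∀ i ∈ V, qPoly (w i) (z i) (s i) f = 0 := by
    intro i hi
    refine eq_zero_of_many_roots _ (nb i) _ (hinj i hi) (fun j hj => ?_)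
      (lt_of_le_of_lt (natDegree_qPoly_le hfd _ _ _) (by have := hD i hi; omega))
    rw [← hsym]
    exact eval_qPoly_cross (hdir i hi j hj).symm (hmeet' i hi j hj) (hfV i hi) (hfV j (hnb i hi hj))
  have hE : ∀ i ∈ V, ePoly (aPoly (w i) (z i) (s i) f) (bPoly (w i) (z i) (s i) f) = 0 := by
    intro i hi
    refine eq_zero_of_many_roots _ (nb i) _ (hinj i hi) (fun j hj => ?_)
      (lt_of_le_of_lt (natDegree_ePoly_le (natDegree_aPoly_le hfd _ _ _)
        (natDegree_bPoly_le hfd _ _ _)) (by have := hD i hi; omega))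
    exact eval_ePoly_cross (hdir i hi j hj) (hmeet i hi j hj) (hfV j (hnb i hi hj)) (hfV i hi)
      (hQ j (hnb i hi hj))
  have ha : ∀ i ∈ V, ∀ j ∈ nb i, (aPoly (w i) (z i) (s i) f).eval (-(z j - z i) / (w j - w i)) =
      -(w j - w i) * (bPoly (w i) (z i) (s i) f).eval (-(z j - z i) / (w j - w i)) :=
    fun i hi j hj => eval_aPoly_cross (hdir i hi j hj) (hmeet i hi j hj) (hfV j (hnb i hi hj))
      (hfV i hi)
  have hmany : ∀ i ∈ V, bPoly (w i) (z i) (s i) f ≠ 0 → K < ((nb i).filter fun j =>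
      (bPoly (w i) (z i) (s i) f).eval (-(z j - z i) / (w j - w i)) ≠ 0).card := by
    intro i hi hb
    have h1 := card_roots_le _ (nb i) _ (hinj i hi) hb
    have h2 := natDegree_bPoly_le hfd (w i) (z i) (s i)
    have := hD i hi
    omega
  have hP : ∀ i ∈ V, bPoly (w i) (z i) (s i) f ≠ 0 → ∃ c e : k, (c ≠ 0 ∨ e ≠ 0) ∧
      K < ((nb i).filter fun j => e * (w j - w i) - c * (z j - z i) = -1).card := by
    intro i hi hb
    have hcard := hmany i hi hb
    obtain ⟨j, hj⟩ := Finset.card_pos.1 (Nat.zero_lt_of_lt hcard)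
    rw [Finset.mem_filter] at hj
    have ha0 : aPoly (w i) (z i) (s i) f ≠ 0 := by
      intro h0
      have := ha i hi j hj.1
      rw [h0, Polynomial.eval_zero] at this
      exact mul_ne_zero (neg_ne_zero.2 (sub_ne_zero.2 (hdir i hi j hj.1))) hj.2 this.symm
    obtain ⟨c, e, hce⟩ := exists_linear_of_ePoly p hp (natDegree_aPoly_le hfd _ _ _)
      (natDegree_bPoly_le hfd _ _ _) ha0 (hE i hi)
    refine ⟨c, e, ?_, hcard.trans_le (Finset.card_le_card fun l hl => ?_)⟩
    · by_contra! h0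
      rw [h0.1, h0.2] at hce
      exact hb (by simpa using hce)
    · rw [Finset.mem_filter] at hl ⊢
      refine ⟨hl.1, ?_⟩
      have h1 := ha i hi l hl.1
      have h2 := congrArg (Polynomial.eval (-(z l - z i) / (w l - w i))) hce
      have h3 := sub_ne_zero.2 (hdir i hi l hl.1)
      simp only [Polynomial.eval_mul, Polynomial.eval_add, Polynomial.eval_C, Polynomial.eval_X,
        h1] at h2
      have h4 : (c * (-(z l - z i) / (w l - w i)) + e) * -(w l - w i) = 1 := by
        apply mul_right_cancel₀ hl.2
        linear_combination -h2
      have h5 : (-(z l - z i) / (w l - w i)) * (w l - w i) = -(z l - z i) :=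
        div_mul_cancel₀ _ h3
      linear_combination -h4 - c * h5
  obtain ⟨i, hi, hb⟩ : ∃ i ∈ V, bPoly (w i) (z i) (s i) f ≠ 0 := by
    by_contra! hcon
    obtain ⟨j, i, hi, hne⟩ := hfne
    have ha0 : aPoly (w i) (z i) (s i) f = 0 := by
      refine eq_zero_of_many_roots _ (nb i) _ (hinj i hi) (fun j hj => ?_)
        (lt_of_le_of_lt (natDegree_aPoly_le hfd _ _ _) (by have := hD i hi; omega))
      rw [ha i hi j hj, hcon i hi]; simp
    have hb0 := hcon i hi
    have hd := ev_dirD_eq_zero (hfV i hi)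
    rw [bPoly] at hb0
    have hC : ∀ c : k, ev (w i) (z i) (s i) (MvPolynomial.C c) = Polynomial.C c := fun c => by
      simp [ev]
    rw [aPoly, map_add, map_mul, hb0, mul_zero, add_zero] at ha0
    rw [dirD, map_add, map_add, map_mul, map_mul, hb0, ha0, mul_zero, mul_zero, add_zero,
      add_zero] at hd
    fin_cases j
    · exact hne hd
    · exact hne ha0
    · exact hne hb0
  obtain ⟨j, hj⟩ := Finset.card_pos.1 (Nat.zero_lt_of_lt (hmany i hi hb))
  rw [Finset.mem_filter] at hj
  refine ⟨i, hi, j, hj.1, ?_⟩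
  rintro l (rfl | rfl)
  · exact hP _ hi hb
  · refine hP _ (hnb i hi hj.1) fun h0 => hj.2 ?_
    rw [bPoly, ← eval_ev_cross (hdir i hi _ hj.1) (hmeet i hi _ hj.1)]
    rw [bPoly] at h0
    rw [h0]; simp

end Core

section Incidence

lemma exists_min_degree_subset {ι : Type*} [DecidableEq ι] (adj : ι → ι → Prop)
    [DecidableRel adj] (hsymm : ∀ i j, adj i j → adj j i) (D : ℕ) (V : Finset ι)
    (h : 2 * D * V.card < ((V ×ˢ V).filter fun q => adj q.1 q.2).card) :
    ∃ V' ⊆ V, V'.Nonempty ∧ ∀ i ∈ V', D < (V'.filter fun j => adj i j).card := by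
  induction V using Finset.strongInduction with
  | H V ih =>
    by_cases hall : ∀ i ∈ V, D < (V.filter fun j => adj i j).card
    · refine ⟨V, subset_rfl, ?_, hall⟩
      by_contra hne
      rw [Finset.not_nonempty_iff_eq_empty] at hne
      subst hne
      simp at h
    · push Not at hall
      obtain ⟨i, hi, hd⟩ := hall
      have hsub : (V ×ˢ V).filter (fun q => adj q.1 q.2) ⊆
          (((V.erase i) ×ˢ (V.erase i)).filter fun q => adj q.1 q.2) ∪
          (((V.filter fun j => adj i j).image fun j => (i, j)) ∪
            ((V.filter fun j => adj i j).image fun j => (j, i))) := by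
        rintro ⟨a, b⟩ hab
        simp only [Finset.mem_filter, Finset.mem_product, Finset.mem_union, Finset.mem_image,
          Finset.mem_erase, Prod.mk.injEq] at hab ⊢
        by_cases ha : a = i
        · subst ha; exact Or.inr (Or.inl ⟨b, ⟨hab.1.2, hab.2⟩, rfl, rfl⟩)
        · by_cases hb : b = i
          · subst hb; exact Or.inr (Or.inr ⟨a, ⟨hab.1.1, hsymm _ _ hab.2⟩, rfl, rfl⟩)
          · exact Or.inl ⟨⟨⟨ha, hab.1.1⟩, hb, hab.1.2⟩, hab.2⟩
      have h1 := Finset.card_le_card hsub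
      have h2 := (Finset.card_union_le (((V.erase i) ×ˢ (V.erase i)).filter fun q => adj q.1 q.2)
          (((V.filter fun j => adj i j).image fun j => (i, j)) ∪
            ((V.filter fun j => adj i j).image fun j => (j, i))))
      have h3 := Finset.card_union_le ((V.filter fun j => adj i j).image fun j => (i, j))
            ((V.filter fun j => adj i j).image fun j => (j, i))
      have h4 := Finset.card_image_le (s := V.filter fun j => adj i j) (f := fun j => (i, j))
      have h5 := Finset.card_image_le (s := V.filter fun j => adj i j) (f := fun j => (j, i))
      have h6 := Finset.card_erase_add_one hi
      have h7 : 2 * D * V.card = 2 * D * (V.erase i).card + 2 * D := by rw [← h6]; ring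
      obtain ⟨V', hV', hne, hdeg⟩ := ih (V.erase i) (Finset.erase_ssubset hi) (by omega)
      exact ⟨V', hV'.trans (Finset.erase_subset _ _), hne, hdeg⟩

variable {F : Type*} [Field F]

/-- The symplectic-type incidence form attached to line parameters `(U, w, z)`. -/
def inc (P Q : F × F × F) : F := P.1 - Q.1 + P.2.1 * Q.2.2 - Q.2.1 * P.2.2

/-- Generic red and blue re-parametrisations, making same-coloured lines disjoint. -/
def redMap (τ : F) (P : F × F × F) : F × F × F :=
  (τ * P.1 + τ ^ 2 * P.2.1 + τ ^ 3 * P.2.2, P.2.1, P.2.2)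

/-- See `redMap`. -/
def blueMap (τ : F) (P : F × F × F) : F × F × F :=
  (τ * P.1, τ * (P.2.1 + τ ^ 2), τ * (P.2.2 - τ))

lemma inc_red_blue (τ : F) (P Q : F × F × F) :
    inc (redMap τ P) (blueMap τ Q) = τ * inc P Q := by
  simp only [inc, redMap, blueMap]; ring

open Polynomial in
lemma exists_generic [Infinite F] [DecidableEq F] (R B : Finset (F × F × F)) : ∃ τ : F, τ ≠ 0 ∧
    (∀ P ∈ R, ∀ Q ∈ R, inc (redMap τ P) (redMap τ Q) = 0 → P = Q) ∧
    (∀ P ∈ B, ∀ Q ∈ B, inc (blueMap τ P) (blueMap τ Q) = 0 → P = Q) ∧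
    (∀ P ∈ R, ∀ Q ∈ B, P.2.1 ≠ τ * (Q.2.1 + τ ^ 2)) := by
  classical
  let rr : (F × F × F) × (F × F × F) → F[X] := fun q =>
    Cubic.toPoly ⟨q.1.2.2 - q.2.2.2, q.1.2.1 - q.2.2.1, q.1.1 - q.2.1,
      q.1.2.1 * q.2.2.2 - q.2.2.1 * q.1.2.2⟩
  let bb : (F × F × F) × (F × F × F) → F[X] := fun q =>
    Cubic.toPoly ⟨q.2.2.2 - q.1.2.2, q.2.2.1 - q.1.2.1, q.1.2.1 * q.2.2.2 - q.2.2.1 * q.1.2.2,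
      q.1.1 - q.2.1⟩
  let rb : (F × F × F) × (F × F × F) → F[X] := fun q =>
    Cubic.toPoly ⟨-1, 0, -q.2.2.1, q.1.2.1⟩
  have hrr : ∀ q, rr q = 0 → q.1 = q.2 := by
    intro q hq
    have ha := congrArg (fun r => coeff r 3) hq
    have hb := congrArg (fun r => coeff r 2) hq
    have hc := congrArg (fun r => coeff r 1) hq
    simp only [rr, Cubic.coeff_eq_a, Cubic.coeff_eq_b, Cubic.coeff_eq_c, coeff_zero,
      sub_eq_zero] at ha hb hc
    exact Prod.ext hc (Prod.ext hb ha)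
  have hbb : ∀ q, bb q = 0 → q.1 = q.2 := by
    intro q hq
    have ha := congrArg (fun r => coeff r 3) hq
    have hb := congrArg (fun r => coeff r 2) hq
    have hc := congrArg (fun r => coeff r 0) hq
    simp only [bb, Cubic.coeff_eq_a, Cubic.coeff_eq_b, Cubic.coeff_eq_d, coeff_zero,
      sub_eq_zero] at ha hb hc
    exact Prod.ext hc (Prod.ext hb.symm ha.symm)
  have hrb : ∀ q, rb q ≠ 0 := by
    intro q hq
    have ha := congrArg (fun r => coeff r 3) hq
    simp [rb, Cubic.coeff_eq_a] at ha
  obtain ⟨τ, hτ⟩ := Infinite.exists_notMem_finset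
    ({0} ∪ ((R ×ˢ R).biUnion fun q => (rr q).roots.toFinset) ∪
      ((B ×ˢ B).biUnion fun q => (bb q).roots.toFinset) ∪
      ((R ×ˢ B).biUnion fun q => (rb q).roots.toFinset))
  simp only [Finset.mem_union, Finset.mem_biUnion, not_or, not_exists, not_and,
    Finset.mem_singleton, Multiset.mem_toFinset, mem_roots', Finset.mem_product, IsRoot.def] at hτ
  obtain ⟨⟨⟨h0, h1⟩, h2⟩, h3⟩ := hτ
  refine ⟨τ, h0, fun P hP Q hQ h => ?_, fun P hP Q hQ h => ?_, fun P hP Q hQ h => ?_⟩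
  · by_contra hne
    refine h1 (P, Q) ⟨hP, hQ⟩ (fun h => hne (hrr _ h)) ?_
    simp only [inc, redMap] at h
    simp only [rr, Cubic.toPoly, eval_add, eval_mul, eval_C, eval_pow, eval_X]
    linear_combination h
  · by_contra hne
    refine h2 (P, Q) ⟨hP, hQ⟩ (fun h => hne (hbb _ h)) ?_
    simp only [inc, blueMap] at h
    simp only [bb, Cubic.toPoly, eval_add, eval_mul, eval_C, eval_pow, eval_X]
    apply mul_left_cancel₀ h0
    linear_combination h
  · refine h3 (P, Q) ⟨hP, hQ⟩ (hrb _) ?_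
    simp only [rb, Cubic.toPoly, eval_add, eval_mul, eval_C, eval_pow, eval_X]
    linear_combination h

/-- Incidence bound in the Heisenberg-type geometry, assuming bounded plane degeneracy. -/
theorem card_incidences_le [Infinite F] [DecidableEq F] (p : ℕ) [CharP F p]
    (R B : Finset (F × F × F)) (G : F × F × F → F × F × F → Prop) [DecidableRel G]
    (hG : ∀ P ∈ R, ∀ Q ∈ B, G P Q → inc P Q = 0) (K m : ℕ)
    (hH : ∀ Q ∈ B, ∀ c e κ : F, (c ≠ 0 ∨ e ≠ 0) →
      (R.filter fun P => G P Q ∧ e * P.2.1 - c * P.2.2 = κ).card ≤ K)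
    (hm : (R.card + B.card) * (m + 1) * 27 < (m + 3) ^ 3) (h3 : 3 ∣ m) (hp : 2 * m + 2 < p) :
    ((R ×ˢ B).filter fun q => G q.1 q.2).card ≤ (5 * m + K) * (R.card + B.card) := by
  classical
  by_contra! hcon
  obtain ⟨τ, hτ, hrr, hbb, hrb⟩ := exists_generic R B
  let adj : (F × F × F) ⊕ (F × F × F) → (F × F × F) ⊕ (F × F × F) → Prop := fun i j =>
    match i, j with
    | Sum.inl P, Sum.inr Q => G P Q
    | Sum.inr Q, Sum.inl P => G P Q
    | _, _ => False
  have hadj : ∀ i j, adj i j → adj j i := by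
    rintro (P | P) (Q | Q) h <;> exact h
  obtain ⟨V, hVs, hne, hdeg⟩ := exists_min_degree_subset adj hadj (5 * m + K) (R.disjSum B) (by
    rw [Finset.card_disjSum]
    have hsub : ((((R ×ˢ B).filter fun q => G q.1 q.2).image
          fun q => ((Sum.inl q.1, Sum.inr q.2) : (_ ⊕ _) × (_ ⊕ _))) ∪
        (((R ×ˢ B).filter fun q => G q.1 q.2).image
          fun q => ((Sum.inr q.2, Sum.inl q.1) : (_ ⊕ _) × (_ ⊕ _)))) ⊆
        ((R.disjSum B ×ˢ R.disjSum B).filter fun q => adj q.1 q.2) := by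
      intro q hq
      simp only [Finset.mem_union, Finset.mem_image, Finset.mem_filter, Finset.mem_product] at hq
      rcases hq with ⟨⟨a, b⟩, ⟨⟨ha, hb⟩, hab⟩, rfl⟩ | ⟨⟨a, b⟩, ⟨⟨ha, hb⟩, hab⟩, rfl⟩ <;>
        simp [ha, hb, adj] <;> exact hab
    refine lt_of_lt_of_le ?_ (Finset.card_le_card hsub)
    rw [Finset.card_union_of_disjoint, Finset.card_image_of_injective,
      Finset.card_image_of_injective]
    · nlinarith
    · rintro ⟨a, b⟩ ⟨c, d⟩ h; simpa [and_comm] using h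
    · rintro ⟨a, b⟩ ⟨c, d⟩ h; simpa using h
    · rw [Finset.disjoint_left]
      rintro x hx hy
      simp only [Finset.mem_image] at hx hy
      obtain ⟨_, _, rfl⟩ := hx
      obtain ⟨_, _, h⟩ := hy
      simp at h)
  let ℓ : (F × F × F) ⊕ (F × F × F) → F × F × F := Sum.elim (redMap τ) (blueMap τ)
  have hR : ∀ P, Sum.inl P ∈ V → P ∈ R := fun P h => by simpa using hVs h
  have hB : ∀ P, Sum.inr P ∈ V → P ∈ B := fun P h => by simpa using hVs h
  let w : (F × F × F) ⊕ (F × F × F) → F := fun i => (ℓ i).2.1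
  let z : (F × F × F) ⊕ (F × F × F) → F := fun i => (ℓ i).2.2
  let s : (F × F × F) ⊕ (F × F × F) → F := fun i => (ℓ i).1 + w i * z i
  have hinc0 : ∀ i ∈ V, ∀ j ∈ V, adj i j → inc (ℓ j) (ℓ i) = 0 := by
    rintro (P | P) hi (Q | Q) hj h
    · exact h.elim
    · have := inc_red_blue τ P Q
      rw [hG P (hR P hi) Q (hB Q hj) h, mul_zero] at this
      simp only [inc, ℓ, Sum.elim_inl, Sum.elim_inr] at this ⊢
      linear_combination -this
    · have := inc_red_blue τ Q P
      rw [hG Q (hR Q hj) P (hB P hi) h, mul_zero] at this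
      exact this
    · exact h.elim
  have hdir : ∀ i ∈ V, ∀ j ∈ V, adj i j → w j ≠ w i := by
    rintro (P | P) hi (Q | Q) hj h
    · exact h.elim
    · exact (hrb P (hR P hi) Q (hB Q hj)).symm
    · exact (hrb Q (hR Q hj) P (hB P hi))
    · exact h.elim
  have hsame : ∀ i ∈ V, ∀ j ∈ V, ∀ j' ∈ V, adj i j → adj i j' → inc (ℓ j) (ℓ j') = 0 →
      j = j' := by
    rintro (P | P) hi (Q | Q) hj (Q' | Q') hj' h h' h0
    all_goals first | exact h.elim | exact h'.elim | skip
    · rw [hbb Q (hB Q hj) Q' (hB Q' hj') h0]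
    · rw [hrr Q (hR Q hj) Q' (hR Q' hj') h0]
  have hmeet : ∀ i ∈ V, ∀ j ∈ V, adj i j → s j - s i = (w j + w i) * (z j - z i) := by
    intro i hi j hj h
    have := hinc0 i hi j hj h
    simp only [inc] at this
    simp only [s, w, z]
    linear_combination this
  obtain ⟨i, hi, j, hj, hl⟩ := exists_plane_rich_lines p V hne (fun i => V.filter fun j => adj i j)
    w z s (fun i _ => Finset.filter_subset _ _)
    (fun i hi j hj => hdir i hi j (Finset.mem_filter.1 hj).1 (Finset.mem_filter.1 hj).2)
    (fun i hi j hj => hmeet i hi j (Finset.mem_filter.1 hj).1 (Finset.mem_filter.1 hj).2)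
    (by
      intro i hi j hj j' hj' hx
      rw [Finset.coe_filter] at hj hj'
      refine hsame i hi j hj.1 j' hj'.1 hj.2 hj'.2 ?_
      have d1 := sub_ne_zero.2 (hdir i hi j hj.1 hj.2)
      have d2 := sub_ne_zero.2 (hdir i hi j' hj'.1 hj'.2)
      have m1 := hmeet i hi j hj.1 hj.2
      have m2 := hmeet i hi j' hj'.1 hj'.2
      simp only at hx
      obtain ⟨x, hx1⟩ : ∃ x, x = -(z j - z i) / (w j - w i) := ⟨_, rfl⟩
      have e1 : x * (w j - w i) = -(z j - z i) := by rw [hx1]; exact div_mul_cancel₀ _ d1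
      have e2 : x * (w j' - w i) = -(z j' - z i) := by
        rw [hx1, hx]; exact div_mul_cancel₀ _ d2
      have hk : s j - s j' - (w j + w j') * (z j - z j') = 0 := by
        linear_combination m1 - m2 + (w j + w i) * e1 - (w j' + w i) * e2 -
          (w j + w j') * e1 + (w j + w j') * e2
      simp only [inc]
      simp only [s, w, z] at hk
      linear_combination hk)
    m K (by
      have := Finset.card_le_card hVs
      rw [Finset.card_disjSum] at this
      refine lt_of_le_of_lt ?_ hm
      gcongr) h3 hp hdeg
  have hadj2 := (Finset.mem_filter.1 hj).2
  have hjV := (Finset.mem_filter.1 hj).1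
  -- one of the two lines is blue
  have hblue : ∃ Q, Sum.inr Q ∈ V ∧ ∃ c e : F, (c ≠ 0 ∨ e ≠ 0) ∧
      K < ((V.filter fun j => adj (Sum.inr Q) j).filter fun j =>
        e * (w j - w (Sum.inr Q)) - c * (z j - z (Sum.inr Q)) = -1).card := by
    rcases i with P | P <;> rcases j with Q | Q
    · exact hadj2.elim
    · exact ⟨Q, hjV, hl _ (Or.inr rfl)⟩
    · exact ⟨P, hi, hl _ (Or.inl rfl)⟩
    · exact hadj2.elim
  obtain ⟨Q, hQ, c, e, hce, hcard⟩ := hblue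
  refine absurd (hH Q (hB Q hQ) c e (-1 + e * w (Sum.inr Q) - c * z (Sum.inr Q)) hce)
    (not_le.2 (hcard.trans_le ?_))
  rw [← Finset.card_image_of_injective _ (Sum.inl_injective (α := F × F × F) (β := F × F × F))]
  apply Finset.card_le_card
  rintro (P | P) hP <;> simp only [Finset.mem_filter] at hP
  · rw [Finset.mem_image]
    refine ⟨P, Finset.mem_filter.2 ⟨hR P hP.1.1, hP.1.2, ?_⟩, rfl⟩
    have := hP.2
    simp only [w, z, ℓ, Sum.elim_inl, redMap] at this ⊢
    linear_combination this
  · exact hP.1.2.elim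

end Incidence

section Incidence

lemma exists_bounded_coloring {α : Type*} [DecidableEq α] (M L : ℕ) (S : Finset α)
    (hS : S.card ≤ M * L) : ∃ c : α → ℕ, (∀ x ∈ S, c x ∈ Finset.range M) ∧
      ∀ a, (S.filter fun x => c x = a).card ≤ L := by
  induction M generalizing S with
  | zero =>
    have : S = ∅ := by simpa using hS
    subst this
    exact ⟨fun _ => 0, by simp, by simp⟩
  | succ M ih =>
    obtain ⟨T, hTS, hT⟩ := Finset.exists_subset_card_eq (min_le_left S.card L)
    obtain ⟨c, hc, hcL⟩ := ih (S \ T) (by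
      rw [Finset.card_sdiff_of_subset hTS, hT]
      rw [add_mul] at hS
      have := Nat.zero_le (M * L)
      omega)
    refine ⟨fun x => if x ∈ T then M else c x, fun x hx => ?_, fun a => ?_⟩
    · by_cases hxT : x ∈ T
      · simp [hxT]
      · have := hc x (by simp [hx, hxT])
        simp only [hxT, if_false, Finset.mem_range] at this ⊢
        omega
    · by_cases ha : a = M
      · subst ha
        refine (Finset.card_le_card (t := T) fun x hx => ?_).trans (hT.le.trans (min_le_right _ _))
        rw [Finset.mem_filter] at hx
        by_contra hxT
        have h1 := hc x (by simp [hx.1, hxT])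
        have h2 := hx.2
        simp only [hxT, if_false, Finset.mem_range] at h1 h2
        omega
      · refine (Finset.card_le_card fun x hx => ?_).trans (hcL a)
        rw [Finset.mem_filter] at hx ⊢
        by_cases hxT : x ∈ T
        · exact absurd (by simpa [hxT] using hx.2.symm) ha
        · simpa [hxT] using hx

variable {F : Type*} [Field F]

/-- `card_incidences_le` for sets of size up to `2 p ^ 2`. -/
theorem card_incidences_le_real [Infinite F] [DecidableEq F] (p : ℕ) [CharP F p]
    (R B : Finset (F × F × F)) (G : F × F × F → F × F × F → Prop) [DecidableRel G]
    (hG : ∀ P ∈ R, ∀ Q ∈ B, G P Q → inc P Q = 0) (K n : ℕ)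
    (hH : ∀ Q ∈ B, ∀ c e κ : F, (c ≠ 0 ∨ e ≠ 0) →
      (R.filter fun P => G P Q ∧ e * P.2.1 - c * P.2.2 = κ).card ≤ K)
    (hR : R.card ≤ n) (hB : B.card ≤ n) (hn : n ≤ 2 * p ^ 2) :
    ((((R ×ˢ B).filter fun q => G q.1 q.2).card : ℕ) : ℝ) ≤ 10 ^ 9 * (√n + K) * n := by
  classical
  rcases Nat.eq_zero_or_pos n with h0 | hpos
  · subst h0
    have : R = ∅ := by simpa using hR
    subst this
    simp
  have hn0 : (0 : ℝ) ≤ n := Nat.cast_nonneg n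
  have hn1 : (1 : ℝ) ≤ n := by exact_mod_cast hpos
  have hK0 : (0 : ℝ) ≤ K := Nat.cast_nonneg K
  have hsq := Real.sq_sqrt hn0
  have hs0 := Real.sqrt_nonneg (n : ℝ)
  by_cases hp : p < 25
  · have h1 : ((R ×ˢ B).filter fun q => G q.1 q.2).card ≤ n * n :=
      (Finset.card_filter_le _ _).trans (by rw [Finset.card_product]; gcongr)
    have h2 : ((((R ×ˢ B).filter fun q => G q.1 q.2).card : ℕ) : ℝ) ≤ n * n := by exact_mod_cast h1
    have h3 : n ≤ 1250 := hn.trans (by nlinarith)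
    have h4 : √(n : ℝ) ≤ 1250 := by
      rw [Real.sqrt_le_left (by norm_num)]
      have : (n : ℝ) ≤ 1250 := by exact_mod_cast h3
      linarith
    refine h2.trans ?_
    have : (n : ℝ) ≤ 10 ^ 9 * (√n + K) := by nlinarith
    gcongr
  push Not at hp
  obtain ⟨L, hL⟩ : ∃ L, L = n / 1000 + 1 := ⟨_, rfl⟩
  have hML : n ≤ 1000 * L := by omega
  obtain ⟨c, hc, hcL⟩ := exists_bounded_coloring 1000 L R (hR.trans hML)
  obtain ⟨c', hc', hcL'⟩ := exists_bounded_coloring 1000 L B (hB.trans hML)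
  obtain ⟨e, he⟩ : ∃ e, e = Nat.sqrt (6 * L) := ⟨_, rfl⟩
  have he1 : e * e ≤ 6 * L := by rw [he]; exact Nat.sqrt_le _
  have he2 : 6 * L < (e + 1) * (e + 1) := by rw [he]; exact Nat.lt_succ_sqrt _
  have hblock : ∀ a b, (((R ×ˢ B).filter fun q => G q.1 q.2).filter
      fun q => (c q.1, c' q.2) = (a, b)).card ≤ (5 * (3 * e) + K) * (L + L) := by
    intro a b
    have hRa := hcL a
    have hBb := hcL' b
    refine le_trans ?_ ((card_incidences_le p (R.filter fun x => c x = a)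
      (B.filter fun x => c' x = b) G ?_ K (3 * e) ?_ ?_ ⟨e, rfl⟩ ?_).trans
        (Nat.mul_le_mul_left _ (add_le_add hRa hBb)))
    · refine Finset.card_le_card fun q hq => ?_
      simp only [Finset.mem_filter, Finset.mem_product, Prod.mk.injEq] at hq ⊢
      tauto
    · intro P hP Q hQ
      exact hG P (Finset.mem_filter.1 hP).1 Q (Finset.mem_filter.1 hQ).1
    · intro Q hQ c e κ hce
      refine (Finset.card_le_card ?_).trans (hH Q (Finset.mem_filter.1 hQ).1 c e κ hce)
      exact Finset.filter_subset_filter _ (Finset.filter_subset _ _)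
    · have : (R.filter fun x => c x = a).card + (B.filter fun x => c' x = b).card ≤ 2 * L := by
        omega
      calc _ ≤ (2 * L) * (3 * e + 1) * 27 := by gcongr
        _ < (3 * e + 3) ^ 3 := by nlinarith
    · have h5 : 1000 * L ≤ 2 * p ^ 2 + 1000 := by omega
      by_contra! h6
      nlinarith
  have htot : ((R ×ˢ B).filter fun q => G q.1 q.2).card ≤
      (1000 * 1000) * ((5 * (3 * e) + K) * (L + L)) := by
    rw [Finset.card_eq_sum_card_fiberwise (f := fun q => (c q.1, c' q.2))
      (t := Finset.range 1000 ×ˢ Finset.range 1000)]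
    · refine (Finset.sum_le_card_nsmul _ _ _ fun q _ => hblock q.1 q.2).trans ?_
      simp
    · intro q hq
      rw [Finset.mem_coe, Finset.mem_filter, Finset.mem_product] at hq
      simp only [Finset.coe_product, Set.mem_prod, Finset.mem_coe]
      exact ⟨hc _ hq.1.1, hc' _ hq.1.2⟩
  have hLr : (L : ℝ) ≤ 3 / 2 * n := by
    have : 2 * L ≤ 3 * n := by omega
    have : (2 * L : ℝ) ≤ 3 * n := by exact_mod_cast this
    linarith
  have her : (e : ℝ) ≤ 3 * √n := by
    have h1 : (e : ℝ) * e ≤ 6 * L := by exact_mod_cast he1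
    apply le_of_sq_le_sq _ (by positivity)
    nlinarith
  have htr : ((((R ×ˢ B).filter fun q => G q.1 q.2).card : ℕ) : ℝ) ≤
      (1000 * 1000) * ((5 * (3 * e) + K) * (L + L)) := by exact_mod_cast htot
  calc _ ≤ _ := htr
    _ ≤ (1000 * 1000) * ((5 * (3 * (3 * √n)) + K) * (3 / 2 * n + 3 / 2 * n)) := by gcongr
    _ ≤ _ := by nlinarith [mul_nonneg hs0 hn0, mul_nonneg hK0 hn0]

end Incidence

section Energy
variable {F : Type*} [Field F]

/-- Squared distance in isotropic coordinates. -/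
def isoD (a b : F × F) : F := (a.1 - b.1) * (a.2 - b.2)

/-- The graph of a (possibly degenerate) Möbius transformation. -/
def onCurve (e f g h : F) (x : F × F) : Prop := e * x.1 * x.2 + f * x.1 + g * x.2 + h = 0

/-- A pair with both coordinates distinct, no Möbius graph through which is `K`-rich in `A`. -/
def IsGood (A : Finset (F × F)) (K : ℕ) (b c : F × F) : Prop :=
  b.1 ≠ c.1 ∧ b.2 ≠ c.2 ∧ ∀ e f g h : F, f * g - e * h ≠ 0 → onCurve e f g h b →
    onCurve e f g h c → {x ∈ (A : Set (F × F)) | onCurve e f g h x}.ncard ≤ K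

/-- Two pairs are exchanged by a common reflection `(u, v) ↦ (α v + β, (u - β) / α)`. -/
def SameAxis (b c b' c' : F × F) : Prop :=
  ∃ α β : F, α ≠ 0 ∧ c.1 = α * b.2 + β ∧ b.1 = α * c.2 + β ∧ c'.1 = α * b'.2 + β ∧
    b'.1 = α * c'.2 + β

lemma card_le_of_curve {ι : Type*} {A : Finset (F × F)} {K : ℕ} (S : Finset ι) (φ : ι → F × F)
    (hφ : Set.InjOn φ S) (e f g h : F) (hdet : f * g - e * h ≠ 0)
    (hA : ∀ s ∈ S, φ s ∈ A) (hcurve : ∀ s ∈ S, onCurve e f g h (φ s))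
    (x : F × F) (hx : onCurve e f g h x) (hgood : ∀ s ∈ S, IsGood A K (φ s) x) : S.card ≤ K := by
  classical
  rcases S.eq_empty_or_nonempty with rfl | ⟨s, hs⟩
  · simp
  refine le_trans ?_ ((hgood s hs).2.2 e f g h hdet (hcurve s hs) hx)
  rw [← Finset.card_image_of_injOn hφ, ← Set.ncard_coe_finset]
  apply Set.ncard_le_ncard
  · intro y hy
    rw [Finset.mem_coe, Finset.mem_image] at hy
    obtain ⟨t, ht, rfl⟩ := hy
    exact ⟨hA t ht, hcurve t ht⟩
  · exact A.finite_toSet.subset (fun y hy => hy.1)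

lemma card_degenerate_le {A : Finset (F × F)} {K : ℕ} (c c' : F × F) (r : F) (hr : r ≠ 0)
    (hcc : isoD c c' = r) (S : Finset ((F × F) × (F × F))) (p q κ : F) (hpq : p ≠ 0 ∨ q ≠ 0)
    (hA : ∀ s ∈ S, s.1 ∈ A ∧ s.2 ∈ A) (hD : ∀ s ∈ S, isoD s.1 s.2 = r)
    (hrel : ∀ s ∈ S, r * (s.1.1 - c.1) + (s.2.1 - s.1.1) * (c'.1 - c.1) * (s.1.2 - c.2) = 0)
    (hg : ∀ s ∈ S, IsGood A K s.1 c) (hg' : ∀ s ∈ S, IsGood A K s.2 c')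
    (hne : ∀ s ∈ S, isoD s.1 c' ≠ 0)
    (hpl : ∀ s ∈ S, (s.2.1 - s.1.1) * (q + p * s.1.2) = κ) : S.card ≤ K := by
  classical
  rcases S.eq_empty_or_nonempty with rfl | ⟨s₀, hs₀⟩
  · simp
  have hw : ∀ s ∈ S, s.2.1 - s.1.1 ≠ 0 := fun s hs h => hr (by
    rw [← hD s hs, isoD]; linear_combination -(s.1.2 - s.2.2) * h)
  have hw' : c'.1 - c.1 ≠ 0 := fun h => hr (by
    rw [← hcc, isoD]; linear_combination -(c.2 - c'.2) * h)
  have hne1 : ∀ s ∈ S, c'.1 - s.1.1 ≠ 0 := fun s hs h => hne s hs (by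
    rw [isoD]; linear_combination -(s.1.2 - c'.2) * h)
  have hne2 : ∀ s ∈ S, c'.2 - s.1.2 ≠ 0 := fun s hs h => hne s hs (by
    rw [isoD]; linear_combination -(s.1.1 - c'.1) * h)
  simp only [isoD] at hD hcc
  by_cases hκ : κ = 0
  · -- the first endpoints have a common second coordinate
    have hv : ∀ s ∈ S, q + p * s.1.2 = 0 := fun s hs =>
      (mul_eq_zero.1 ((hpl s hs).trans hκ)).resolve_left (hw s hs)
    have hp : p ≠ 0 := by
      rintro rfl
      have := hv _ hs₀
      simp at this
      simp [this] at hpq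
    obtain ⟨v₀, hv₀⟩ : ∃ v₀, v₀ = s₀.1.2 := ⟨_, rfl⟩
    have hvv : ∀ s ∈ S, s.1.2 = v₀ := fun s hs => by
      apply mul_left_cancel₀ hp
      rw [hv₀]
      linear_combination hv s hs - hv _ hs₀
    refine card_le_of_curve S (fun s => s.2) ?_ 1 (-v₀) (-c.1)
      (c.1 * v₀ - (c'.1 - c.1) * (c'.2 - v₀)) ?_ (fun s hs => (hA s hs).2) ?_ c' ?_ hg'
    · intro s hs t ht hst
      simp only at hst
      have h1 := hD s hs
      have h2 := hD t ht
      rw [hvv s hs, hst] at h1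
      rw [hvv t ht] at h2
      have h3 : v₀ - t.2.2 ≠ 0 := fun h => hr (by rw [← h2, h, mul_zero])
      have h4 : s.1.1 = t.1.1 := by
        apply mul_right_cancel₀ h3
        linear_combination h1 - h2
      exact Prod.ext (Prod.ext h4 ((hvv s hs).trans (hvv t ht).symm)) hst
    · have : -v₀ * -c.1 - 1 * (c.1 * v₀ - (c'.1 - c.1) * (c'.2 - v₀)) =
          (c'.1 - c.1) * (c'.2 - v₀) := by ring
      rw [this, hv₀]
      exact mul_ne_zero hw' (hne2 _ hs₀)
    · intro s hs
      simp only [onCurve]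
      apply mul_left_cancel₀ (hw s hs)
      have h1 := hD s hs
      have h2 := hrel s hs
      rw [hvv s hs] at h1 h2
      rw [mul_zero]
      linear_combination (s.2.1 - c.1) * h1 + h2 - (s.2.1 - s.1.1) * hcc
    · simp only [onCurve]; ring
  · have hv : ∀ s ∈ S, q + p * s.1.2 ≠ 0 := fun s hs h => hκ (by rw [← hpl s hs, h, mul_zero])
    by_cases hc : q + p * c.2 = 0
    · have hp : p ≠ 0 := by
        rintro rfl
        simp at hc
        simp [hc] at hpq
      have hvc : ∀ s ∈ S, s.1.2 - c.2 ≠ 0 := fun s hs h => hv s hs (by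
        linear_combination hc + p * h)
      have hu : ∀ s ∈ S, r * p * (s.1.1 - c.1) + κ * (c'.1 - c.1) = 0 := fun s hs => by
        apply mul_left_cancel₀ (hw s hs)
        apply mul_left_cancel₀ (hvc s hs)
        linear_combination p * (s.1.2 - c.2) * (s.2.1 - s.1.1) * hrel s hs - (s.1.2 - c.2) *
          (s.2.1 - s.1.1) * (c'.1 - c.1) * hpl s hs + (s.1.2 - c.2) * (s.2.1 - s.1.1) *
          (c'.1 - c.1) * (s.2.1 - s.1.1) * hc
      obtain ⟨u₀, hu₀⟩ : ∃ u₀, u₀ = s₀.1.1 := ⟨_, rfl⟩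
      have huu : ∀ s ∈ S, s.1.1 = u₀ := fun s hs => by
        apply mul_left_cancel₀ (mul_ne_zero hr hp)
        rw [hu₀]
        linear_combination hu s hs - hu _ hs₀
      refine card_le_of_curve S (fun s => s.2) ?_ 1 (-c.2) (-u₀)
        (u₀ * c.2 - (c'.1 - u₀) * (c'.2 - c.2)) ?_ (fun s hs => (hA s hs).2) ?_ c' ?_ hg'
      · intro s hs t ht hst
        simp only at hst
        have h1 := hD s hs
        have h2 := hD t ht
        rw [huu s hs, hst] at h1
        rw [huu t ht] at h2
        have h3 : u₀ - t.2.1 ≠ 0 := fun h => hr (by rw [← h2, h, zero_mul])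
        have h4 : s.1.2 = t.1.2 := by
          apply mul_left_cancel₀ h3
          linear_combination h1 - h2
        exact Prod.ext (Prod.ext ((huu s hs).trans (huu t ht).symm) h4) hst
      · have : -c.2 * -u₀ - 1 * (u₀ * c.2 - (c'.1 - u₀) * (c'.2 - c.2)) =
            (c'.1 - u₀) * (c'.2 - c.2) := by ring
        rw [this, hu₀]
        refine mul_ne_zero (hne1 _ hs₀) fun h => hr ?_
        rw [← hcc]
        linear_combination -(c.1 - c'.1) * h
      · intro s hs
        simp only [onCurve]
        have h1 := hD s hs
        have h2 := hu s hs
        have h3 := hpl s hs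
        rw [huu s hs] at h1 h2 h3
        apply mul_left_cancel₀ hp
        apply mul_left_cancel₀ hw'
        rw [mul_zero]
        linear_combination (c'.1 - c.1) * p * h1 + (c'.1 - c.1) * h3 -
          (c'.1 - c.1) * (s.2.1 - u₀) * hc - p * (c'.1 - u₀) * hcc + h2
      · simp only [onCurve]; ring
    · refine card_le_of_curve S (fun s => s.1) ?_ (-r * p) (-r * q)
        (r * p * c.1 - κ * (c'.1 - c.1)) (r * q * c.1 + κ * (c'.1 - c.1) * c.2) ?_
        (fun s hs => (hA s hs).1) ?_ c ?_ hg
      · intro s hs t ht hst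
        simp only at hst
        have h1 := hpl s hs
        have h2 := hpl t ht
        rw [hst] at h1
        have h3 : s.2.1 = t.2.1 := by
          apply mul_right_cancel₀ (hv t ht)
          linear_combination h1 - h2
        have h4 := hD s hs
        have h5 := hD t ht
        rw [hst, h3] at h4
        have h6 : s.2.2 = t.2.2 := by
          apply mul_left_cancel₀ (hw t ht)
          linear_combination h4 - h5
        exact Prod.ext hst (Prod.ext h3 h6)
      · have : -r * q * (r * p * c.1 - κ * (c'.1 - c.1)) -
            -r * p * (r * q * c.1 + κ * (c'.1 - c.1) * c.2) =
            r * κ * (c'.1 - c.1) * (q + p * c.2) := by ring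
        rw [this]
        exact mul_ne_zero (mul_ne_zero (mul_ne_zero hr hκ) hw') hc
      · intro s hs
        simp only [onCurve]
        linear_combination -(q + p * s.1.2) * hrel s hs +
          (c'.1 - c.1) * (s.1.2 - c.2) * hpl s hs
      · simp only [onCurve]; ring

end Energy

section Counting
open Classical in
/-- Cauchy–Schwarz bound for an incidence structure with few common neighbours. -/
lemma card_incid_sq_le {α β : Type*} (X : Finset α) (Y : Finset β) (r : α → β → Prop) (k : ℕ)
    (h : ∀ x ∈ X, ∀ x' ∈ X, x ≠ x' → (Y.filter fun y => r x y ∧ r x' y).card ≤ k) :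
    ((X ×ˢ Y).filter fun q => r q.1 q.2).card ^ 2 ≤
      Y.card * (((X ×ˢ Y).filter fun q => r q.1 q.2).card + k * X.card ^ 2) := by
  have hI : ((X ×ˢ Y).filter fun q => r q.1 q.2).card =
      ∑ y ∈ Y, (X.filter fun x => r x y).card := by
    rw [Finset.card_filter, Finset.sum_product_right]
    exact Finset.sum_congr rfl fun y _ => (Finset.card_filter _ _).symm
  have hI' : ((X ×ˢ Y).filter fun q => r q.1 q.2).card =
      ∑ x ∈ X, (Y.filter fun y => r x y).card := by
    rw [Finset.card_filter, Finset.sum_product]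
    exact Finset.sum_congr rfl fun y _ => (Finset.card_filter _ _).symm
  have hsq : ∑ y ∈ Y, (X.filter fun x => r x y).card ^ 2 =
      ∑ x ∈ X, ∑ x' ∈ X, (Y.filter fun y => r x y ∧ r x' y).card := by
    have : ∀ y ∈ Y, (X.filter fun x => r x y).card ^ 2 =
        ∑ x ∈ X, ∑ x' ∈ X, if r x y ∧ r x' y then 1 else 0 := by
      intro y _
      rw [sq, Finset.card_filter, Finset.sum_mul_sum]
      refine Finset.sum_congr rfl fun x _ => Finset.sum_congr rfl fun x' _ => ?_
      by_cases h1 : r x y <;> by_cases h2 : r x' y <;> simp [h1, h2]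
    rw [Finset.sum_congr rfl this, Finset.sum_comm]
    refine Finset.sum_congr rfl fun x _ => ?_
    rw [Finset.sum_comm]
    exact Finset.sum_congr rfl fun x' _ => (Finset.card_filter _ _).symm
  have hb : ∑ y ∈ Y, (X.filter fun x => r x y).card ^ 2 ≤
      ((X ×ˢ Y).filter fun q => r q.1 q.2).card + k * X.card ^ 2 := by
    rw [hsq, hI']
    have : ∀ x ∈ X, ∑ x' ∈ X, (Y.filter fun y => r x y ∧ r x' y).card ≤
        (Y.filter fun y => r x y).card + k * X.card := by
      intro x hx
      rw [← Finset.add_sum_erase _ _ hx]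
      gcongr
      · simp
      · refine (Finset.sum_le_card_nsmul _ _ k fun x' hx' => ?_).trans ?_
        · rw [Finset.mem_erase] at hx'
          exact h x hx x' hx'.2 hx'.1.symm
        · rw [smul_eq_mul, mul_comm]
          exact Nat.mul_le_mul_left _ (Finset.card_erase_le)
    refine (Finset.sum_le_sum this).trans ?_
    rw [Finset.sum_add_distrib, Finset.sum_const, smul_eq_mul]
    apply le_of_eq; ring
  calc _ = (∑ y ∈ Y, (X.filter fun x => r x y).card) ^ 2 := by rw [hI]
    _ ≤ Y.card * ∑ y ∈ Y, (X.filter fun x => r x y).card ^ 2 := sq_sum_le_card_mul_sum_sq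
    _ ≤ _ := Nat.mul_le_mul_left _ hb

end Counting

section Energy
variable {F : Type*} [Field F]

lemma quadratic_eq_zero {a b c x y z : F} (hxy : x ≠ y) (hxz : x ≠ z) (hyz : y ≠ z)
    (hx : a * x ^ 2 + b * x + c = 0) (hy : a * y ^ 2 + b * y + c = 0)
    (hz : a * z ^ 2 + b * z + c = 0) : a = 0 ∧ b = 0 ∧ c = 0 := by
  have h1 : a * (x + y) + b = 0 := by
    apply mul_left_cancel₀ (sub_ne_zero.2 hxy); linear_combination hx - hy
  have h2 : a * (x + z) + b = 0 := by
    apply mul_left_cancel₀ (sub_ne_zero.2 hxz); linear_combination hx - hz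
  have ha : a = 0 := by
    apply mul_left_cancel₀ (sub_ne_zero.2 hyz); linear_combination h1 - h2
  subst ha
  have hb : b = 0 := by linear_combination h1
  subst hb
  exact ⟨rfl, rfl, by linear_combination hx⟩

section Mobius
variable {e f g h : F}

lemma onCurve.denom_ne_zero (hdet : f * g - e * h ≠ 0) {x : F × F} (hx : onCurve e f g h x) :
    e * x.1 + g ≠ 0 := fun h0 => hdet (by
  have h1 : f * x.1 + h = 0 := by
    rw [onCurve] at hx; linear_combination hx - x.2 * h0
  linear_combination f * h0 - e * h1)

lemma onCurve.fst_inj (hdet : f * g - e * h ≠ 0) {x y : F × F} (hx : onCurve e f g h x)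
    (hy : onCurve e f g h y) (hxy : x.1 = y.1) : x = y := by
  have h0 := hx.denom_ne_zero hdet
  refine Prod.ext hxy ?_
  rw [onCurve] at hx hy
  rw [← hxy] at hy
  apply mul_left_cancel₀ h0
  linear_combination hx - hy

/-- Two Möbius graphs with three common points have proportional coefficients. -/
lemma onCurve.coeffs_of_three (hdet : f * g - e * h ≠ 0) {e' f' g' h' : F} {x y z : F × F}
    (hxy : x ≠ y) (hxz : x ≠ z) (hyz : y ≠ z)
    (hx : onCurve e f g h x) (hy : onCurve e f g h y) (hz : onCurve e f g h z)
    (hx' : onCurve e' f' g' h' x) (hy' : onCurve e' f' g' h' y) (hz' : onCurve e' f' g' h' z) :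
    f' * e - e' * f = 0 ∧ f' * g + h' * e - e' * h - g' * f = 0 ∧ h' * g - g' * h = 0 := by
  have key : ∀ w, onCurve e f g h w → onCurve e' f' g' h' w →
      (f' * e - e' * f) * w.1 ^ 2 + (f' * g + h' * e - e' * h - g' * f) * w.1 +
        (h' * g - g' * h) = 0 := by
    intro w h1 h2
    rw [onCurve] at h1 h2
    linear_combination (e * w.1 + g) * h2 - (e' * w.1 + g') * h1
  exact quadratic_eq_zero (fun h1 => hxy (hx.fst_inj hdet hy h1))
    (fun h1 => hxz (hx.fst_inj hdet hz h1)) (fun h1 => hyz (hy.fst_inj hdet hz h1))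
    (key x hx hx') (key y hy hy') (key z hz hz')

lemma onCurve.subset_of_three (hdet : f * g - e * h ≠ 0) {e' f' g' h' : F} {x y z : F × F}
    (hxy : x ≠ y) (hxz : x ≠ z) (hyz : y ≠ z)
    (hx : onCurve e f g h x) (hy : onCurve e f g h y) (hz : onCurve e f g h z)
    (hx' : onCurve e' f' g' h' x) (hy' : onCurve e' f' g' h' y) (hz' : onCurve e' f' g' h' z)
    {w : F × F} (hw : onCurve e f g h w) : onCurve e' f' g' h' w := by
  obtain ⟨h1, h2, h3⟩ := onCurve.coeffs_of_three hdet hxy hxz hyz hx hy hz hx' hy' hz'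
  have h0 := hw.denom_ne_zero hdet
  rw [onCurve] at *
  apply mul_left_cancel₀ h0
  linear_combination (e' * w.1 + g') * hw + w.1 ^ 2 * h1 + w.1 * h2 + h3

end Mobius

lemma isoD_eq_iff_onCurve (a x : F × F) (r : F) :
    isoD a x = r ↔ onCurve 1 (-a.2) (-a.1) (a.1 * a.2 - r) x := by
  rw [isoD, onCurve]
  constructor <;> intro h <;> linear_combination h

open Classical in
lemma card_inter_circles_le (A : Finset (F × F)) {a a' : F × F} (haa : a ≠ a') {r : F}
    (hr : r ≠ 0) : (A.filter fun x => isoD a x = r ∧ isoD a' x = r).card ≤ 2 := by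
  by_contra! hcon
  obtain ⟨x, y, z, hx, hy, hz, hxy, hxz, hyz⟩ := Finset.two_lt_card_iff.1 hcon
  simp only [Finset.mem_filter, isoD_eq_iff_onCurve] at hx hy hz
  have hdet : -a.2 * -a.1 - 1 * (a.1 * a.2 - r) ≠ 0 := by
    intro h; apply hr; linear_combination h
  obtain ⟨h1, h2, h3⟩ := onCurve.coeffs_of_three hdet hxy hxz hyz hx.2.1 hy.2.1 hz.2.1
    hx.2.2 hy.2.2 hz.2.2
  apply haa
  have e2 : a.2 = a'.2 := by linear_combination h1
  refine Prod.ext ?_ e2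
  apply mul_left_cancel₀ hr
  rw [e2] at h3
  linear_combination h3

open Classical in
/-- Pairs of points of `A` at distance `r`. -/
noncomputable def seg (A : Finset (F × F)) (r : F) : Finset ((F × F) × (F × F)) :=
  (A ×ˢ A).filter fun q => isoD q.1 q.2 = r

lemma card_seg_sq_le (A : Finset (F × F)) {r : F} (hr : r ≠ 0) :
    (seg A r).card ^ 2 ≤ 4 * A.card ^ 3 := by
  classical
  have h := card_incid_sq_le A A (fun a b => isoD a b = r) 2
    (fun a _ a' _ haa => by convert card_inter_circles_le A haa hr)
  have h' : (seg A r).card ^ 2 ≤ A.card * ((seg A r).card + 2 * A.card ^ 2) := by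
    convert h <;> (unfold seg; congr)
  obtain ⟨I, hI⟩ : ∃ I, I = (seg A r).card := ⟨_, rfl⟩
  obtain ⟨N, hN⟩ : ∃ N, N = A.card := ⟨_, rfl⟩
  rw [← hI, ← hN] at h' ⊢
  by_contra! hcon
  have h1 : I ^ 2 < 2 * (N * I) := by nlinarith
  have h2 : I < 2 * N := by nlinarith
  have h3 : I ^ 2 ≤ (2 * N) ^ 2 := Nat.pow_le_pow_left h2.le 2
  have h4 : N ^ 2 ≤ N ^ 3 := by
    rcases Nat.eq_zero_or_pos N with h0 | h0
    · simp [h0]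
    · exact Nat.pow_le_pow_right h0 (by norm_num)
  nlinarith

open Classical in
/-- The relation between segments `(b, b')`, `(c, c')` coming from non-degenerate pairs of good
pairs `(b, c)`, `(b', c')` with the same axis. -/
def SegRel (A : Finset (F × F)) (K : ℕ) (s t : (F × F) × (F × F)) : Prop :=
  IsGood A K s.1 t.1 ∧ IsGood A K s.2 t.2 ∧ SameAxis s.1 t.1 s.2 t.2 ∧ isoD s.1 s.2 ≠ 0 ∧
    isoD s.1 t.2 ≠ 0

lemma SameAxis.isoD_eq {b c b' c' : F × F} (h : SameAxis b c b' c') : isoD c c' = isoD b b' := by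
  obtain ⟨α, β, hα, h1, h2, h3, h4⟩ := h
  rw [isoD, isoD, h1, h2, h3, h4]; ring

lemma SameAxis.relation {b c b' c' : F × F} (h : SameAxis b c b' c') :
    isoD b b' * (b.1 - c.1) + (b'.1 - b.1) * (c'.1 - c.1) * (b.2 - c.2) = 0 := by
  obtain ⟨α, β, hα, h1, h2, h3, h4⟩ := h
  rw [isoD, h1, h2, h3, h4]; ring

/-- Heisenberg coordinates of a segment. -/
def segPt (r : F) (s : (F × F) × (F × F)) : F × F × F :=
  (r * s.1.1, s.2.1 - s.1.1, -((s.2.1 - s.1.1) * s.1.2))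

lemma segPt_injOn (A : Finset (F × F)) {r : F} (hr : r ≠ 0) :
    Set.InjOn (segPt r) (seg A r) := by
  classical
  intro s hs t ht h
  rw [Finset.mem_coe, seg, Finset.mem_filter] at hs ht
  simp only [isoD] at hs ht
  have h1 := hs.2
  have h2 := ht.2
  simp only [segPt, Prod.mk.injEq] at h
  obtain ⟨e1, e2, e3⟩ := h
  have d1 : s.1.1 = t.1.1 := mul_left_cancel₀ hr e1
  have d2 : s.2.1 = t.2.1 := by linear_combination e2 + d1
  have hw : t.1.1 - t.2.1 ≠ 0 := fun h0 => hr (by rw [← h2, h0, zero_mul])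
  rw [d1, d2] at h1 e3
  have d3 : s.1.2 = t.1.2 := by
    apply mul_left_cancel₀ hw; linear_combination e3
  rw [d3] at h1
  have d4 : s.2.2 = t.2.2 := by
    apply mul_left_cancel₀ hw; linear_combination h2 - h1
  exact Prod.ext (Prod.ext d1 d3) (Prod.ext d2 d4)

open Classical in
lemma card_segRel_fiber_le [Infinite F] (p : ℕ) [CharP F p] (A : Finset (F × F)) (K : ℕ)
    (hN : A.card ^ 3 ≤ p ^ 4) {r : F} (hr : r ≠ 0) :
    ((((seg A r ×ˢ seg A r).filter fun q => SegRel A K q.1 q.2).card : ℕ) : ℝ) ≤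
      10 ^ 9 * (√(seg A r).card + K) * (seg A r).card := by
  have hn : (seg A r).card ≤ 2 * p ^ 2 := by
    have h1 := card_seg_sq_le A hr
    rw [← Nat.pow_le_pow_iff_left two_ne_zero]
    nlinarith
  have hinj := segPt_injOn A hr
  let G : F × F × F → F × F × F → Prop := fun P Q => ∃ s ∈ seg A r, ∃ t ∈ seg A r,
    segPt r s = P ∧ segPt r t = Q ∧ SegRel A K s t
  have hmain := card_incidences_le_real p ((seg A r).image (segPt r)) ((seg A r).image (segPt r))
    G ?_ K (seg A r).card ?_ Finset.card_image_le Finset.card_image_le hn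
  · refine le_trans ?_ hmain
    rw [Nat.cast_le]
    refine Finset.card_le_card_of_injOn (fun q => (segPt r q.1, segPt r q.2)) ?_ ?_
    · rintro ⟨s, t⟩ hq
      rw [Finset.mem_coe, Finset.mem_filter, Finset.mem_product] at hq
      rw [Finset.mem_coe, Finset.mem_filter, Finset.mem_product]
      exact ⟨⟨Finset.mem_image_of_mem _ hq.1.1, Finset.mem_image_of_mem _ hq.1.2⟩,
        s, hq.1.1, t, hq.1.2, rfl, rfl, hq.2⟩
    · rintro ⟨s, t⟩ hq ⟨s', t'⟩ hq' h
      rw [Finset.mem_coe, Finset.mem_filter, Finset.mem_product] at hq hq'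
      simp only [Prod.mk.injEq] at h
      exact Prod.ext (hinj hq.1.1 hq'.1.1 h.1) (hinj hq.1.2 hq'.1.2 h.2)
  · rintro P - Q - ⟨s, hs, t, ht, rfl, rfl, hst⟩
    have h1 := hst.2.2.1.relation
    have h2 : isoD s.1 s.2 = r := (Finset.mem_filter.1 hs).2
    rw [h2] at h1
    simp only [inc, segPt]
    linear_combination h1
  · intro Q hQ c e κ hce
    obtain ⟨t, ht, rfl⟩ := Finset.mem_image.1 hQ
    have hsub : (((seg A r).image (segPt r)).filter fun P => G P (segPt r t) ∧
        e * P.2.1 - c * P.2.2 = κ) ⊆ ((seg A r).filter fun s => SegRel A K s t ∧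
          (s.2.1 - s.1.1) * (e + c * s.1.2) = κ).image (segPt r) := by
      intro P hP
      rw [Finset.mem_filter] at hP
      obtain ⟨-, ⟨s, hs, t', ht', rfl, htt, hst⟩, hκ⟩ := hP
      have := hinj ht' ht htt
      subst this
      refine Finset.mem_image_of_mem _ (Finset.mem_filter.2 ⟨hs, hst, ?_⟩)
      simp only [segPt] at hκ
      linear_combination hκ
    refine (Finset.card_le_card hsub).trans (Finset.card_image_le.trans ?_)
    have hmem : ∀ s ∈ ((seg A r).filter fun s => SegRel A K s t ∧
          (s.2.1 - s.1.1) * (e + c * s.1.2) = κ), s.1 ∈ A ∧ s.2 ∈ A ∧ isoD s.1 s.2 = r ∧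
          SegRel A K s t ∧ (s.2.1 - s.1.1) * (e + c * s.1.2) = κ := by
      intro s hs
      simp only [seg, Finset.mem_filter, Finset.mem_product] at hs
      tauto
    refine card_degenerate_le t.1 t.2 r hr (Finset.mem_filter.1 ht).2 _ c e κ hce
      (fun s hs => ⟨(hmem s hs).1, (hmem s hs).2.1⟩) (fun s hs => (hmem s hs).2.2.1)
      (fun s hs => ?_) (fun s hs => (hmem s hs).2.2.2.1.1) (fun s hs => (hmem s hs).2.2.2.1.2.1)
      (fun s hs => (hmem s hs).2.2.2.1.2.2.2.2) (fun s hs => (hmem s hs).2.2.2.2)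
    have := (hmem s hs).2.2.2.1.2.2.1.relation
    rwa [(hmem s hs).2.2.1] at this

end Energy

section Energy
variable {F : Type*} [Field F]

open Classical in
/-- Isosceles triangles `(a, b, c)` of `A` in isotropic coordinates with `b - c` anisotropic. -/
noncomputable def isoTri (A : Finset (F × F)) : Finset ((F × F) × (F × F) × (F × F)) :=
  (A ×ˢ A ×ˢ A).filter fun q => isoD q.1 q.2.1 = isoD q.1 q.2.2 ∧ q.2.1.1 ≠ q.2.2.1 ∧
    q.2.1.2 ≠ q.2.2.2

lemma eq_of_isoD_eq_of_fst_eq {a b c : F × F} (h0 : isoD a b ≠ 0) (h : isoD a b = isoD a c)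
    (h1 : b.1 = c.1) : b = c := by
  refine Prod.ext h1 ?_
  rw [isoD] at h0
  rw [isoD, isoD, ← h1] at h
  have := mul_left_cancel₀ (left_ne_zero_of_mul h0) h
  linear_combination -this

lemma eq_of_isoD_eq_of_snd_eq {a b c : F × F} (h0 : isoD a b ≠ 0) (h : isoD a b = isoD a c)
    (h1 : b.2 = c.2) : b = c := by
  refine Prod.ext ?_ h1
  rw [isoD] at h0
  rw [isoD, isoD, ← h1] at h
  have := mul_right_cancel₀ (right_ne_zero_of_mul h0) h
  linear_combination -this

open Classical in
lemma card_equidistant_le (A : Finset (F × F)) :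
    ((A ×ˢ A ×ˢ A).filter fun q => isoD q.1 q.2.1 = isoD q.1 q.2.2 ∧ isoD q.1 q.2.1 ≠ 0).card ≤
      (isoTri A).card + A.card ^ 2 := by
  have hsub : ((A ×ˢ A ×ˢ A).filter fun q =>
      isoD q.1 q.2.1 = isoD q.1 q.2.2 ∧ isoD q.1 q.2.1 ≠ 0) ⊆
      isoTri A ∪ (A ×ˢ A).image fun q => (q.1, q.2, q.2) := by
    rintro ⟨a, b, c⟩ hq
    simp only [Finset.mem_filter, Finset.mem_product] at hq
    obtain ⟨⟨ha, hb, hc⟩, h1, h2⟩ := hq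
    by_cases hbc : b = c
    · subst hbc
      exact Finset.mem_union_right _ (Finset.mem_image.2 ⟨(a, b), by simp [ha, hb], rfl⟩)
    · refine Finset.mem_union_left _ ?_
      simp only [isoTri, Finset.mem_filter, Finset.mem_product]
      exact ⟨⟨ha, hb, hc⟩, h1, fun h => hbc (eq_of_isoD_eq_of_fst_eq h2 h1 h),
        fun h => hbc (eq_of_isoD_eq_of_snd_eq h2 h1 h)⟩
  refine (Finset.card_le_card hsub).trans ((Finset.card_union_le _ _).trans ?_)
  gcongr
  refine Finset.card_image_le.trans ?_
  rw [Finset.card_product, sq]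

open Classical in
/-- The nonzero distances spanned by `A`. -/
noncomputable def distSet (A : Finset (F × F)) : Finset F :=
  ((A ×ˢ A).image fun q => isoD q.1 q.2).erase 0

lemma sum_card_seg_le (A : Finset (F × F)) : ∑ r ∈ distSet A, (seg A r).card ≤ A.card ^ 2 := by
  classical
  unfold seg
  rw [← Finset.card_biUnion]
  · refine (Finset.card_le_card (t := A ×ˢ A) ?_).trans ?_
    · exact Finset.biUnion_subset.2 fun r _ => Finset.filter_subset _ _
    · rw [Finset.card_product, sq]
  · intro r _ r' _ hrr
    rw [Function.onFun, Finset.disjoint_left]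
    intro q h1 h2
    exact hrr ((Finset.mem_filter.1 h1).2.symm.trans (Finset.mem_filter.1 h2).2)

lemma sum_card_seg_sq_le (A : Finset (F × F)) :
    ∑ r ∈ distSet A, (seg A r).card ^ 2 ≤ A.card * ((isoTri A).card + A.card ^ 2) := by
  classical
  have h1 : ∀ r, (seg A r).card = ∑ a ∈ A, (A.filter fun b => isoD a b = r).card := by
    intro r
    rw [seg, Finset.card_filter, Finset.sum_product]
    exact Finset.sum_congr rfl fun y _ => (Finset.card_filter _ _).symm
  calc _ ≤ ∑ r ∈ distSet A, A.card * ∑ a ∈ A, (A.filter fun b => isoD a b = r).card ^ 2 := by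
        refine Finset.sum_le_sum fun r _ => ?_
        rw [h1]
        exact sq_sum_le_card_mul_sum_sq
    _ = A.card * ∑ a ∈ A, ∑ r ∈ distSet A, (A.filter fun b => isoD a b = r).card ^ 2 := by
        rw [← Finset.mul_sum, Finset.sum_comm]
    _ ≤ _ := by
        refine Nat.mul_le_mul_left _ (le_trans ?_ (card_equidistant_le A))
        rw [Finset.card_filter, Finset.sum_product]
        refine Finset.sum_le_sum fun a _ => ?_
        rw [← Finset.card_filter]
        have : ∀ r ∈ distSet A, (A.filter fun b => isoD a b = r).card ^ 2 =
            ((A.filter fun b => isoD a b = r) ×ˢ (A.filter fun b => isoD a b = r)).card := by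
          intro r _; rw [Finset.card_product, sq]
        rw [Finset.sum_congr rfl this, ← Finset.card_biUnion]
        · refine Finset.card_le_card fun q hq => ?_
          simp only [Finset.mem_biUnion, Finset.mem_product, Finset.mem_filter, distSet,
            Finset.mem_erase] at hq ⊢
          obtain ⟨r, ⟨hr, -⟩, ⟨h1, h2⟩, h3, h4⟩ := hq
          exact ⟨⟨h1, h3⟩, by rw [h2, h4], by rwa [h2]⟩
        · intro r _ r' _ hrr
          rw [Function.onFun, Finset.disjoint_left]
          intro q h1 h2
          simp only [Finset.mem_product, Finset.mem_filter] at h1 h2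
          exact hrr (h1.1.2.symm.trans h2.1.2)

open Classical in
/-- Nondegenerate quadruples: two good pairs with the same axis. -/
noncomputable def axisQuad (A : Finset (F × F)) (K : ℕ) :
    Finset (((F × F) × (F × F)) × ((F × F) × (F × F))) :=
  ((A ×ˢ A) ×ˢ (A ×ˢ A)).filter fun q => SegRel A K q.1 q.2

lemma card_axisQuad_le [Infinite F] (p : ℕ) [CharP F p] (A : Finset (F × F)) (K : ℕ)
    (hN : A.card ^ 3 ≤ p ^ 4) :
    ((axisQuad A K).card : ℝ) ≤ 10 ^ 9 *
      (A.card * √(A.card * ((isoTri A).card + A.card ^ 2)) + K * A.card ^ 2) := by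
  classical
  have h1 : (axisQuad A K).card ≤ ∑ r ∈ distSet A,
      ((seg A r ×ˢ seg A r).filter fun q => SegRel A K q.1 q.2).card := by
    refine (Finset.card_le_card (fun q hq => ?_)).trans Finset.card_biUnion_le
    simp only [axisQuad, Finset.mem_filter, Finset.mem_product] at hq
    obtain ⟨⟨⟨a1, a2⟩, a3, a4⟩, hq⟩ := hq
    simp only [Finset.mem_biUnion, distSet, Finset.mem_erase, seg, Finset.mem_filter,
      Finset.mem_product, Finset.mem_image]
    exact ⟨isoD q.1.1 q.1.2, ⟨hq.2.2.2.1, (q.1.1, q.1.2), ⟨a1, a2⟩, rfl⟩,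
      ⟨⟨⟨a1, a2⟩, rfl⟩, ⟨a3, a4⟩, hq.2.2.1.isoD_eq⟩, hq⟩
  have h2 : ((axisQuad A K).card : ℝ) ≤ ∑ r ∈ distSet A,
      10 ^ 9 * (√(seg A r).card + K) * (seg A r).card := by
    refine (Nat.cast_le.2 h1).trans ?_
    rw [Nat.cast_sum]
    exact Finset.sum_le_sum fun r hr =>
      card_segRel_fiber_le p A K hN (Finset.ne_of_mem_erase hr)
  have h3 : ∑ r ∈ distSet A, √((seg A r).card : ℝ) * (seg A r).card ≤
      A.card * √(A.card * ((isoTri A).card + A.card ^ 2)) := by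
    refine (Real.sum_mul_le_sqrt_mul_sqrt _ _ _).trans ?_
    have e1 : √(∑ r ∈ distSet A, √((seg A r).card : ℝ) ^ 2) ≤ A.card := by
      rw [Real.sqrt_le_left (by positivity)]
      simp only [Nat.cast_nonneg, Real.sq_sqrt]
      exact_mod_cast sum_card_seg_le A
    gcongr
    exact_mod_cast sum_card_seg_sq_le A
  have h4 : (∑ r ∈ distSet A, ((seg A r).card : ℝ)) ≤ (A.card : ℝ) ^ 2 := by
    exact_mod_cast sum_card_seg_le A
  refine h2.trans ?_
  have : ∑ r ∈ distSet A, 10 ^ 9 * (√((seg A r).card : ℝ) + K) * (seg A r).card =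
      10 ^ 9 * (∑ r ∈ distSet A, √((seg A r).card : ℝ) * (seg A r).card +
        K * ∑ r ∈ distSet A, ((seg A r).card : ℝ)) := by
    rw [Finset.mul_sum, ← Finset.sum_add_distrib, Finset.mul_sum]
    exact Finset.sum_congr rfl fun r _ => by ring
  rw [this]
  gcongr

end Energy

section BadPairs
variable {F : Type*} [Field F]

open Classical in
/-- The traces on `A` of Möbius graphs containing more than `K` points of `A`. -/
noncomputable def richTraces (A : Finset (F × F)) (K : ℕ) : Finset (Finset (F × F)) :=
  A.powerset.filter fun S => K < S.card ∧
    ∃ e f g h : F, f * g - e * h ≠ 0 ∧ S = A.filter fun x => onCurve e f g h x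

lemma richTraces_subset_of_three {A : Finset (F × F)} {K : ℕ} {S : Finset (F × F)}
    (hS : S ∈ richTraces A K) {e f g h : F} {x y z : F × F} (hxy : x ≠ y) (hxz : x ≠ z)
    (hyz : y ≠ z) (hx : x ∈ S) (hy : y ∈ S) (hz : z ∈ S) (hx' : onCurve e f g h x)
    (hy' : onCurve e f g h y) (hz' : onCurve e f g h z) {w : F × F} (hw : w ∈ S) :
    onCurve e f g h w := by
  classical
  obtain ⟨-, -, e', f', g', h', hdet, rfl⟩ := Finset.mem_filter.1 hS
  rw [Finset.mem_filter] at hx hy hz hw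
  exact onCurve.subset_of_three hdet hxy hxz hyz hx.2 hy.2 hz.2 hx' hy' hz' hw.2

lemma eq_of_mem_richTraces {A : Finset (F × F)} {K : ℕ} {S S' : Finset (F × F)}
    (hS : S ∈ richTraces A K) (hS' : S' ∈ richTraces A K) {x y z : F × F} (hxy : x ≠ y)
    (hxz : x ≠ z) (hyz : y ≠ z) (hx : x ∈ S) (hy : y ∈ S) (hz : z ∈ S) (hx' : x ∈ S')
    (hy' : y ∈ S') (hz' : z ∈ S') : S ⊆ S' := by
  classical
  intro w hw
  have hwA : w ∈ A := Finset.mem_powerset.1 (Finset.mem_filter.1 hS).1 hw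
  obtain ⟨-, -, e', f', g', h', hdet, rfl⟩ := Finset.mem_filter.1 hS'
  rw [Finset.mem_filter] at hx' hy' hz'
  exact Finset.mem_filter.2
    ⟨hwA, richTraces_subset_of_three hS hxy hxz hyz hx hy hz hx'.2 hy'.2 hz'.2 hw⟩

lemma sum_card_richTraces_le (A : Finset (F × F)) (K : ℕ) (hK : 4 * A.card ≤ K ^ 2) :
    ∑ S ∈ richTraces A K, S.card ≤ 2 * A.card := by
  classical
  have hsub : ∀ S ∈ richTraces A K, S ⊆ A := fun S hS =>
    Finset.mem_powerset.1 (Finset.mem_filter.1 hS).1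
  have hI : (((richTraces A K) ×ˢ A).filter fun q => q.2 ∈ q.1).card =
      ∑ S ∈ richTraces A K, S.card := by
    rw [Finset.card_filter, Finset.sum_product]
    refine Finset.sum_congr rfl fun S hS => ?_
    rw [← Finset.card_filter, Finset.filter_mem_eq_inter, Finset.inter_eq_right.2 (hsub S hS)]
  have h := card_incid_sq_le (richTraces A K) A (fun S x => x ∈ S) 2 (fun S hS S' hS' hne => by
    by_contra! hcon
    obtain ⟨x, y, z, hx, hy, hz, hxy, hxz, hyz⟩ := Finset.two_lt_card_iff.1 hcon
    simp only [Finset.mem_filter] at hx hy hz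
    exact hne (Finset.Subset.antisymm
      (eq_of_mem_richTraces hS hS' hxy hxz hyz hx.2.1 hy.2.1 hz.2.1 hx.2.2 hy.2.2 hz.2.2)
      (eq_of_mem_richTraces hS' hS hxy hxz hyz hx.2.2 hy.2.2 hz.2.2 hx.2.1 hy.2.1 hz.2.1)))
  have h' : (∑ S ∈ richTraces A K, S.card) ^ 2 ≤
      A.card * (∑ S ∈ richTraces A K, S.card + 2 * (richTraces A K).card ^ 2) := by
    rw [← hI]; convert h
  have hX : (richTraces A K).card * K ≤ ∑ S ∈ richTraces A K, S.card := by
    rw [← smul_eq_mul]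
    exact Finset.card_nsmul_le_sum _ _ _ fun S hS => (Finset.mem_filter.1 hS).2.1.le
  generalize ∑ S ∈ richTraces A K, S.card = I at *
  generalize (richTraces A K).card = X at *
  have h1 : X ^ 2 * K ^ 2 ≤ I ^ 2 := by rw [← mul_pow]; exact Nat.pow_le_pow_left hX 2
  have h2 : X ^ 2 * (4 * A.card) ≤ I ^ 2 := (Nat.mul_le_mul_left _ hK).trans h1
  by_contra! hcon
  nlinarith

/-- A circle of nonzero radius has a unique centre. -/
lemma center_unique {a a' : F × F} {r r' : F} (hr : r ≠ 0) {x y z : F × F} (hxy : x ≠ y)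
    (hxz : x ≠ z) (hyz : y ≠ z) (hx : isoD a x = r) (hy : isoD a y = r) (hz : isoD a z = r)
    (hx' : isoD a' x = r') (hy' : isoD a' y = r') (hz' : isoD a' z = r') : a = a' := by
  rw [isoD_eq_iff_onCurve] at hx hy hz hx' hy' hz'
  have hdet : -a.2 * -a.1 - 1 * (a.1 * a.2 - r) ≠ 0 := by
    intro h; apply hr; linear_combination h
  obtain ⟨h1, h2, h3⟩ := onCurve.coeffs_of_three hdet hxy hxz hyz hx hy hz hx' hy' hz'
  have e2 : a.2 = a'.2 := by linear_combination h1
  refine Prod.ext ?_ e2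
  rw [← e2] at h2 h3
  apply mul_left_cancel₀ hr
  linear_combination h3 + a.1 * h2

open Classical in
/-- Isosceles triangles whose base is not good. -/
noncomputable def badTri (A : Finset (F × F)) (K : ℕ) :
    Finset ((F × F) × (F × F) × (F × F)) :=
  (isoTri A).filter fun q => ¬ IsGood A K q.2.1 q.2.2

lemma card_badTri_le (A : Finset (F × F)) (K : ℕ) (hK : 4 * A.card ≤ K ^ 2) :
    (badTri A K).card ≤ 8 * A.card ^ 2 := by
  classical
  have hI := sum_card_richTraces_le A K hK
  let P0 : Finset ((F × F) × (F × F) × (F × F)) :=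
    ((A ×ˢ A).image fun q => ((q.1.1, q.2.2), q.1, q.2)) ∪
      ((A ×ˢ A).image fun q => ((q.2.1, q.1.2), q.1, q.2))
  let C1 : Finset (F × F) → F × F → F × F → Finset (F × F) := fun S a b =>
    if (S.filter fun c => isoD a c = isoD a b).card ≤ 2 then S.filter fun c => isoD a c = isoD a b
    else ∅
  let P1 : Finset ((F × F) × (F × F) × (F × F)) :=
    (richTraces A K).biUnion fun S => (A ×ˢ S).biUnion fun q =>
      (C1 S q.1 q.2).image fun c => (q.1, q.2, c)
  let C2 : Finset (F × F) → Finset (F × F) := fun S =>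
    A.filter fun a => ∃ r : F, r ≠ 0 ∧ ∀ x ∈ S, isoD a x = r
  let P2 : Finset ((F × F) × (F × F) × (F × F)) :=
    (richTraces A K).biUnion fun S => (S ×ˢ S).biUnion fun q =>
      (C2 S).image fun a => (a, q.1, q.2)
  have hsub : badTri A K ⊆ P0 ∪ (P1 ∪ P2) := by
    rintro ⟨a, b, c⟩ hq
    simp only [badTri, isoTri, Finset.mem_filter, Finset.mem_product] at hq
    obtain ⟨⟨⟨ha, hb, hc⟩, hD, h1, h2⟩, hbad⟩ := hq
    by_cases hr : isoD a b = 0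
    · refine Finset.mem_union_left _ ?_
      have hr' : isoD a c = 0 := by rw [← hD, hr]
      rw [isoD, mul_eq_zero, sub_eq_zero, sub_eq_zero] at hr hr'
      rcases hr with hr | hr
      · have h3 : a.2 = c.2 := hr'.resolve_left fun h => h1 (hr.symm.trans h)
        exact Finset.mem_union_left _ (Finset.mem_image.2 ⟨(b, c), by simp [hb, hc],
          by simp [← hr, ← h3]⟩)
      · have h3 : a.1 = c.1 := hr'.resolve_right fun h => h2 (hr.symm.trans h)
        exact Finset.mem_union_right _ (Finset.mem_image.2 ⟨(b, c), by simp [hb, hc],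
          by simp [← hr, ← h3]⟩)
    · refine Finset.mem_union_right _ ?_
      rw [IsGood] at hbad
      push Not at hbad
      obtain ⟨e, f, g, h, hdet, hbS, hcS, hlt⟩ := hbad h1 h2
      have hS : (A.filter fun x => onCurve e f g h x) ∈ richTraces A K := by
        refine Finset.mem_filter.2 ⟨Finset.mem_powerset.2 (Finset.filter_subset _ _), ?_, e, f, g,
          h, hdet, rfl⟩
        rw [← Set.ncard_coe_finset, Finset.coe_filter]
        exact hlt
      have hbS' := Finset.mem_filter.2 ⟨hb, hbS⟩
      have hcS' := Finset.mem_filter.2 ⟨hc, hcS⟩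
      generalize (A.filter fun x => onCurve e f g h x) = S at hS hbS' hcS'
      by_cases h2 : (S.filter fun c => isoD a c = isoD a b).card ≤ 2
      · refine Finset.mem_union_left _ ?_
        refine Finset.mem_biUnion.2 ⟨S, hS, Finset.mem_biUnion.2 ⟨(a, b),
          Finset.mem_product.2 ⟨ha, hbS'⟩, Finset.mem_image.2 ⟨c, ?_, rfl⟩⟩⟩
        simp only [C1, if_pos h2]
        exact Finset.mem_filter.2 ⟨hcS', hD.symm⟩
      · refine Finset.mem_union_right _ ?_
        refine Finset.mem_biUnion.2 ⟨S, hS, Finset.mem_biUnion.2 ⟨(b, c),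
          Finset.mem_product.2 ⟨hbS', hcS'⟩, Finset.mem_image.2 ⟨a, ?_, rfl⟩⟩⟩
        refine Finset.mem_filter.2 ⟨ha, isoD a b, hr, fun w hw => ?_⟩
        obtain ⟨x, y, z, hx, hy, hz, hxy, hxz, hyz⟩ := Finset.two_lt_card_iff.1 (not_le.1 h2)
        simp only [Finset.mem_filter, isoD_eq_iff_onCurve] at hx hy hz
        rw [isoD_eq_iff_onCurve]
        exact richTraces_subset_of_three hS hxy hxz hyz hx.1 hy.1 hz.1 hx.2 hy.2 hz.2 hw
  have hP0 : P0.card ≤ 2 * A.card ^ 2 := by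
    refine (Finset.card_union_le _ _).trans ?_
    rw [two_mul, sq, ← Finset.card_product]
    exact add_le_add Finset.card_image_le Finset.card_image_le
  have hP1 : P1.card ≤ A.card * (∑ S ∈ richTraces A K, S.card) * 2 := by
    rw [Finset.mul_sum, Finset.sum_mul]
    refine Finset.card_biUnion_le.trans (Finset.sum_le_sum fun S _ => ?_)
    rw [← Finset.card_product]
    refine Finset.card_biUnion_le_card_mul _ _ _ fun q _ => Finset.card_image_le.trans ?_
    simp only [C1]
    split_ifs with h
    · exact h
    · simp
  have hP2 : P2.card ≤ ∑ S ∈ richTraces A K, A.card * S.card := by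
    refine Finset.card_biUnion_le.trans (Finset.sum_le_sum fun S hS => ?_)
    have hSA : S ⊆ A := Finset.mem_powerset.1 (Finset.mem_filter.1 hS).1
    refine (Finset.card_biUnion_le_card_mul _ _ 1 fun q _ => Finset.card_image_le.trans ?_).trans ?_
    · have hcard : 2 < S.card := by
        have h1 := (Finset.mem_filter.1 hS).2.1
        rcases A.eq_empty_or_nonempty with rfl | hne
        · rw [Finset.subset_empty.1 hSA] at h1; simp at h1
        · have : 0 < A.card := hne.card_pos
          have : 2 ≤ K := by nlinarith
          omega
      obtain ⟨x, y, z, hx, hy, hz, hxy, hxz, hyz⟩ := Finset.two_lt_card_iff.1 hcard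
      refine Finset.card_le_one.2 fun a ha a' ha' => ?_
      obtain ⟨-, r, hr, h1⟩ := Finset.mem_filter.1 ha
      obtain ⟨-, r', hr', h2⟩ := Finset.mem_filter.1 ha'
      exact center_unique hr hxy hxz hyz (h1 x hx) (h1 y hy) (h1 z hz) (h2 x hx) (h2 y hy)
        (h2 z hz)
    · rw [mul_one, Finset.card_product]
      exact Nat.mul_le_mul_right _ (Finset.card_le_card hSA)
  rw [← Finset.mul_sum] at hP2
  have h1 := (Finset.card_le_card hsub).trans ((Finset.card_union_le _ _).trans
    (Nat.add_le_add_left (Finset.card_union_le _ _) _))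
  nlinarith

end BadPairs

section Prune
variable {F : Type*} [Field F]

open Classical in
/-- The points of `A` on no isotropic line with more than `K` points of `A`. -/
noncomputable def prune (A : Finset (F × F)) (K : ℕ) : Finset (F × F) :=
  A.filter fun x => (A.filter fun y => y.1 = x.1).card ≤ K ∧ (A.filter fun y => y.2 = x.2).card ≤ K

lemma prune_subset {G : Type*} (A : Finset (G × G)) (K : ℕ) : prune A K ⊆ A := by
  classical exact Finset.filter_subset _ _

open Classical in
lemma card_rich_fibers_le {β γ : Type*} (A : Finset β) (f : β → γ) (K : ℕ) :
    K * ((A.image f).filter fun u => K < (A.filter fun y => f y = u).card).card ≤ A.card := by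
  rw [mul_comm, ← smul_eq_mul]
  refine (Finset.card_nsmul_le_sum _ (fun u => (A.filter fun y => f y = u).card) _ fun u hu =>
    (Finset.mem_filter.1 hu).2.le).trans ?_
  rw [Finset.card_eq_sum_card_image f A]
  exact Finset.sum_le_sum_of_subset (Finset.filter_subset _ _)

open Classical in
lemma card_isoTri_rich_fst_le (A : Finset (F × F)) (K : ℕ) :
    K * ((isoTri A).filter fun q => K < (A.filter fun y => y.1 = q.2.1.1).card).card ≤
      A.card ^ 3 + K * A.card ^ 2 := by
  set R := (A.image Prod.fst).filter fun u => K < (A.filter fun y => y.1 = u).card with hR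
  have hRc : K * R.card ≤ A.card := card_rich_fibers_le A Prod.fst K
  have h1 : ((isoTri A).filter fun q => K < (A.filter fun y => y.1 = q.2.1.1).card).card ≤
      ((A ×ˢ A) ×ˢ R).card + (A ×ˢ A).card := by
    rw [← Finset.card_filter_add_card_filter_not (fun q : (F × F) × (F × F) × (F × F) =>
      q.1.1 = q.2.1.1), add_comm]
    refine add_le_add ?_ ?_
    · refine Finset.card_le_card_of_injOn (fun q => ((q.1, q.2.2), q.2.1.1)) ?_ ?_
      · rintro ⟨a, b, c⟩ hq
        rw [Finset.mem_coe] at hq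
        simp only [isoTri, Finset.mem_filter, Finset.mem_product] at hq
        rw [Finset.mem_coe, Finset.mem_product, Finset.mem_product, hR, Finset.mem_filter]
        exact ⟨⟨hq.1.1.1.1, hq.1.1.1.2.2⟩, Finset.mem_image_of_mem _ hq.1.1.1.2.1, hq.1.2⟩
      · rintro ⟨a, b, c⟩ hq ⟨a', b', c'⟩ hq' h
        rw [Finset.mem_coe] at hq hq'
        simp only [isoTri, Finset.mem_filter, Finset.mem_product] at hq hq'
        simp only [Prod.mk.injEq] at h
        obtain ⟨⟨rfl, rfl⟩, h3⟩ := h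
        have e1 := hq.1.1.2.1
        have e2 := hq'.1.1.2.1
        have hne := sub_ne_zero.2 hq.2
        have : b.2 = b'.2 := by
          rw [← e2, isoD, isoD, ← h3] at e1
          have := mul_left_cancel₀ hne e1
          linear_combination -this
        rw [Prod.ext h3 this]
    · refine Finset.card_le_card_of_injOn (fun q => q.2) ?_ ?_
      · rintro ⟨a, b, c⟩ hq
        rw [Finset.mem_coe] at hq
        simp only [isoTri, Finset.mem_filter, Finset.mem_product] at hq
        exact Finset.mem_coe.2 (Finset.mem_product.2 hq.1.1.1.2)
      · rintro ⟨a, b, c⟩ hq ⟨a', b', c'⟩ hq' h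
        rw [Finset.mem_coe] at hq hq'
        simp only [isoTri, Finset.mem_filter, Finset.mem_product] at hq hq'
        simp only [Prod.mk.injEq] at h
        obtain ⟨rfl, rfl⟩ := h
        have key : ∀ x : F × F, x.1 = b.1 → isoD x b = isoD x c → x.2 = c.2 := by
          intro x h1 h2
          rw [isoD, isoD, h1, sub_self, zero_mul, eq_comm, mul_eq_zero] at h2
          exact sub_eq_zero.1 (h2.resolve_left (sub_ne_zero.2 hq.1.1.2.2.1))
        rw [Prod.ext (hq.2.trans hq'.2.symm)
          ((key a hq.2 hq.1.1.2.1).trans (key a' hq'.2 hq'.1.1.2.1).symm)]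
  rw [Finset.card_product, Finset.card_product] at h1
  calc _ ≤ K * (A.card * A.card * R.card + A.card * A.card) := Nat.mul_le_mul_left _ h1
    _ = A.card ^ 2 * (K * R.card) + K * A.card ^ 2 := by ring
    _ ≤ A.card ^ 2 * A.card + K * A.card ^ 2 := by gcongr
    _ = _ := by ring

lemma isoD_swap (a b : F × F) : isoD a.swap b.swap = isoD a b := by
  simp only [isoD, Prod.fst_swap, Prod.snd_swap]; ring

open Classical in
lemma card_isoTri_rich_snd_le (A : Finset (F × F)) (K : ℕ) :
    K * ((isoTri A).filter fun q => K < (A.filter fun y => y.2 = q.2.1.2).card).card ≤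
      A.card ^ 3 + K * A.card ^ 2 := by
  have h := card_isoTri_rich_fst_le (A.image Prod.swap) K
  rw [Finset.card_image_of_injective _ Prod.swap_injective] at h
  refine (Nat.mul_le_mul_left _ ?_).trans h
  refine Finset.card_le_card_of_injOn (fun q => (q.1.swap, q.2.1.swap, q.2.2.swap)) ?_ ?_
  · rintro ⟨a, b, c⟩ hq
    rw [Finset.mem_coe] at hq
    simp only [isoTri, Finset.mem_filter, Finset.mem_product] at hq
    rw [Finset.mem_coe]
    simp only [isoTri, Finset.mem_filter, Finset.mem_product, isoD_swap]
    refine ⟨⟨⟨Finset.mem_image_of_mem _ hq.1.1.1, Finset.mem_image_of_mem _ hq.1.1.2.1,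
      Finset.mem_image_of_mem _ hq.1.1.2.2⟩, hq.1.2.1, hq.1.2.2.2, hq.1.2.2.1⟩, ?_⟩
    rw [Finset.filter_image, Finset.card_image_of_injective _ Prod.swap_injective]
    exact hq.2
  · rintro ⟨a, b, c⟩ - ⟨a', b', c'⟩ - h
    simp only [Prod.mk.injEq, Prod.swap_inj] at h
    rw [h.1, h.2.1, h.2.2]

open Classical in
lemma card_isoTri_not_prune_le (A : Finset (F × F)) (K : ℕ) :
    K * ((isoTri A).filter fun q => q.2.1 ∉ prune A K).card ≤
      2 * A.card ^ 3 + 2 * K * A.card ^ 2 := by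
  have h1 := card_isoTri_rich_fst_le A K
  have h2 := card_isoTri_rich_snd_le A K
  have h3 : ((isoTri A).filter fun q => q.2.1 ∉ prune A K).card ≤
      ((isoTri A).filter fun q => K < (A.filter fun y => y.1 = q.2.1.1).card).card +
      ((isoTri A).filter fun q => K < (A.filter fun y => y.2 = q.2.1.2).card).card := by
    refine (Finset.card_le_card fun q hq => ?_).trans (Finset.card_union_le _ _)
    rw [Finset.mem_filter, prune, Finset.mem_filter] at hq
    rw [Finset.mem_union, Finset.mem_filter, Finset.mem_filter]
    have : q.2.1 ∈ A := (Finset.mem_product.1 (Finset.mem_product.1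
      (Finset.mem_filter.1 hq.1).1).2).1
    by_contra! hcon
    exact hq.2 ⟨this, hcon.1 hq.1, hcon.2 hq.1⟩
  nlinarith

open Classical in
/-- Isosceles triangles with apex in `A` and good base in `B`. -/
noncomputable def goodTri (A B : Finset (F × F)) (K : ℕ) :
    Finset ((F × F) × (F × F) × (F × F)) :=
  (A ×ˢ B ×ˢ B).filter fun q => isoD q.1 q.2.1 = isoD q.1 q.2.2 ∧ IsGood A K q.2.1 q.2.2

lemma card_isoTri_le (A : Finset (F × F)) (K : ℕ) (hK : 4 * A.card ≤ K ^ 2) :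
    (isoTri A).card ≤ (goodTri A A K).card + 8 * A.card ^ 2 := by
  classical
  refine le_trans ?_ (Nat.add_le_add_left (card_badTri_le A K hK) _)
  refine (Finset.card_le_card fun q hq => ?_).trans (Finset.card_union_le _ _)
  rw [Finset.mem_union]
  by_cases h : IsGood A K q.2.1 q.2.2
  · simp only [isoTri, Finset.mem_filter] at hq
    exact Or.inl (Finset.mem_filter.2 ⟨hq.1, hq.2.1, h⟩)
  · exact Or.inr (Finset.mem_filter.2 ⟨hq, h⟩)

lemma card_isoTri_le_prune (A : Finset (F × F)) (K L : ℕ) (hK : 4 * A.card ≤ K ^ 2) :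
    L * (isoTri A).card ≤ L * ((goodTri A (prune A L) K).card + 12 * A.card ^ 2) +
      4 * A.card ^ 3 := by
  classical
  have h1 := card_isoTri_not_prune_le A L
  have h2 : ((isoTri A).filter fun q => q.2.2 ∉ prune A L).card ≤
      ((isoTri A).filter fun q => q.2.1 ∉ prune A L).card := by
    refine Finset.card_le_card_of_injOn (fun q => (q.1, q.2.2, q.2.1)) ?_ ?_
    · rintro ⟨a, b, c⟩ hq
      rw [Finset.mem_coe] at hq ⊢
      simp only [isoTri, Finset.mem_filter, Finset.mem_product] at hq ⊢
      exact ⟨⟨⟨hq.1.1.1, hq.1.1.2.2, hq.1.1.2.1⟩, hq.1.2.1.symm, hq.1.2.2.1.symm,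
        hq.1.2.2.2.symm⟩, hq.2⟩
    · rintro ⟨a, b, c⟩ - ⟨a', b', c'⟩ - h
      simp only [Prod.mk.injEq] at h
      rw [h.1, h.2.1, h.2.2]
  have h3 := card_badTri_le A K hK
  have h4 : (isoTri A).card ≤ (goodTri A (prune A L) K).card + (badTri A K).card +
      ((isoTri A).filter fun q => q.2.1 ∉ prune A L).card +
      ((isoTri A).filter fun q => q.2.2 ∉ prune A L).card := by
    refine (Finset.card_le_card (t := ((goodTri A (prune A L) K ∪ badTri A K) ∪
      ((isoTri A).filter fun q => q.2.1 ∉ prune A L)) ∪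
      ((isoTri A).filter fun q => q.2.2 ∉ prune A L)) fun q hq => ?_).trans ?_
    · by_cases h1 : q.2.1 ∈ prune A L
      · by_cases h2 : q.2.2 ∈ prune A L
        · refine Finset.mem_union_left _ (Finset.mem_union_left _ (Finset.mem_union.2 ?_))
          by_cases h : IsGood A K q.2.1 q.2.2
          · simp only [isoTri, Finset.mem_filter, Finset.mem_product] at hq
            exact Or.inl (Finset.mem_filter.2 ⟨Finset.mem_product.2 ⟨hq.1.1,
              Finset.mem_product.2 ⟨h1, h2⟩⟩, hq.2.1, h⟩)
          · exact Or.inr (Finset.mem_filter.2 ⟨hq, h⟩)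
        · exact Finset.mem_union_right _ (Finset.mem_filter.2 ⟨hq, h2⟩)
      · exact Finset.mem_union_left _ (Finset.mem_union_right _ (Finset.mem_filter.2 ⟨hq, h1⟩))
    · refine (Finset.card_union_le _ _).trans (Nat.add_le_add_right ?_ _)
      refine (Finset.card_union_le _ _).trans (Nat.add_le_add_right ?_ _)
      exact Finset.card_union_le _ _
  nlinarith

end Prune

section Axis
variable {F : Type*} [Field F]

/-- The coefficients of the perpendicular bisector `u = α v + β` of a pair of points. -/
def axis (b c : F × F) : F × F :=
  ((c.1 - b.1) / (b.2 - c.2), c.1 - (c.1 - b.1) / (b.2 - c.2) * b.2)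

lemma axis_fst_ne_zero {b c : F × F} (h1 : b.1 ≠ c.1) (h2 : b.2 ≠ c.2) : (axis b c).1 ≠ 0 :=
  div_ne_zero (sub_ne_zero.2 h1.symm) (sub_ne_zero.2 h2)

lemma fst_eq_axis (b c : F × F) : c.1 = (axis b c).1 * b.2 + (axis b c).2 := by
  simp only [axis]; ring

lemma fst_eq_axis' {b c : F × F} (h2 : b.2 ≠ c.2) :
    b.1 = (axis b c).1 * c.2 + (axis b c).2 := by
  have := sub_ne_zero.2 h2
  simp only [axis]; field_simp; ring

lemma isoD_eq_iff_axis {b c : F × F} (h2 : b.2 ≠ c.2) (a : F × F) :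
    isoD a b = isoD a c ↔ a.1 = (axis b c).1 * a.2 + (axis b c).2 := by
  have h := fst_eq_axis b c
  have h' := fst_eq_axis' h2
  simp only [isoD]
  rw [h, h']
  have := sub_ne_zero.2 h2
  constructor
  · intro h
    apply mul_left_cancel₀ this
    linear_combination -h
  · intro h
    linear_combination -(b.2 - c.2) * h

lemma sameAxis_iff {b c b' c' : F × F} (h1 : b.1 ≠ c.1) (h2 : b.2 ≠ c.2) (h2' : b'.2 ≠ c'.2) :
    SameAxis b c b' c' ↔ axis b' c' = axis b c := by
  constructor
  · rintro ⟨α, β, hα, e1, e2, e3, e4⟩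
    have key : ∀ x y : F × F, x.2 ≠ y.2 → y.1 = α * x.2 + β → x.1 = α * y.2 + β →
        axis x y = (α, β) := by
      intro x y h3 h4 h5
      have : (y.1 - x.1) / (x.2 - y.2) = α := by
        rw [div_eq_iff (sub_ne_zero.2 h3), h4, h5]; ring
      rw [axis, this, h4]
      simp
    rw [key b c h2 e1 e2, key b' c' h2' e3 e4]
  · intro h
    refine ⟨(axis b c).1, (axis b c).2, axis_fst_ne_zero h1 h2, fst_eq_axis b c, fst_eq_axis' h2,
      ?_, ?_⟩
    · rw [← h]; exact fst_eq_axis b' c'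
    · rw [← h]; exact fst_eq_axis' h2'

open Classical in
/-- Pairs of good pairs of points of `B` with the same axis. -/
noncomputable def axisEnergy (A B : Finset (F × F)) (K : ℕ) :
    Finset (((F × F) × (F × F)) × ((F × F) × (F × F))) :=
  ((B ×ˢ B) ×ˢ (B ×ˢ B)).filter fun q => IsGood A K q.1.1 q.1.2 ∧ IsGood A K q.2.1 q.2.2 ∧
    axis q.2.1 q.2.2 = axis q.1.1 q.1.2

open Classical in
lemma card_isoD_eq_zero_le {B : Finset (F × F)} {L : ℕ} {b : F × F}
    (h1 : (B.filter fun y => y.1 = b.1).card ≤ L) (h2 : (B.filter fun y => y.2 = b.2).card ≤ L) :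
    (B.filter fun y => isoD b y = 0).card ≤ 2 * L := by
  refine (Finset.card_le_card fun y hy => ?_).trans ((Finset.card_union_le _ _).trans
    ((add_le_add h1 h2).trans_eq (two_mul L).symm))
  rw [Finset.mem_filter, isoD, mul_eq_zero, sub_eq_zero, sub_eq_zero] at hy
  rw [Finset.mem_union, Finset.mem_filter, Finset.mem_filter]
  exact hy.2.imp (fun h => ⟨hy.1, h.symm⟩) fun h => ⟨hy.1, h.symm⟩

open Classical in
lemma card_axisEnergy_le {A B : Finset (F × F)} (hBA : B ⊆ A) (K L : ℕ)
    (h1 : ∀ b ∈ B, (B.filter fun y => y.1 = b.1).card ≤ L)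
    (h2 : ∀ b ∈ B, (B.filter fun y => y.2 = b.2).card ≤ L) :
    (axisEnergy A B K).card ≤ (axisQuad A K).card + 4 * L * B.card ^ 2 := by
  have hcount : ((B ×ˢ B).sigma fun p => B.filter fun y => isoD p.1 y = 0).card ≤
      2 * L * B.card ^ 2 := by
    rw [Finset.card_sigma]
    refine (Finset.sum_le_card_nsmul _ _ (2 * L) fun p hp => ?_).trans_eq ?_
    · have := (Finset.mem_product.1 hp).1
      exact card_isoD_eq_zero_le (h1 _ this) (h2 _ this)
    · rw [smul_eq_mul, Finset.card_product]; ring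
  have hmem : ∀ b c b' c' : F × F, ((b, c), (b', c')) ∈ axisEnergy A B K → b ∈ B ∧ c ∈ B ∧ b' ∈ B ∧
      c' ∈ B ∧ IsGood A K b c ∧ IsGood A K b' c' ∧ axis b' c' = axis b c := by
    intro b c b' c' h
    simp only [axisEnergy, Finset.mem_filter, Finset.mem_product] at h
    tauto
  have e1 : ((axisEnergy A B K).filter fun q => isoD q.1.1 q.2.1 = 0).card ≤
      2 * L * B.card ^ 2 := by
    refine (Finset.card_le_card_of_injOn (fun q => (⟨q.1, q.2.1⟩ : Sigma fun _ => F × F)) ?_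
      ?_).trans hcount
    · rintro ⟨⟨b, c⟩, ⟨b', c'⟩⟩ hq
      rw [Finset.mem_coe, Finset.mem_filter] at hq
      obtain ⟨hb, hc, hb', hc', -⟩ := hmem _ _ _ _ hq.1
      rw [Finset.mem_coe, Finset.mem_sigma, Finset.mem_product, Finset.mem_filter]
      exact ⟨⟨hb, hc⟩, hb', hq.2⟩
    · rintro ⟨⟨b, c⟩, ⟨b', c'⟩⟩ hq ⟨⟨b₁, c₁⟩, ⟨b₁', c₁'⟩⟩ hq' h
      rw [Finset.mem_coe, Finset.mem_filter] at hq hq'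
      obtain ⟨-, -, -, -, g1, g2, g3⟩ := hmem _ _ _ _ hq.1
      obtain ⟨-, -, -, -, g1', g2', g3'⟩ := hmem _ _ _ _ hq'.1
      simp only [Sigma.mk.injEq, heq_eq_eq, Prod.mk.injEq] at h
      obtain ⟨⟨rfl, rfl⟩, rfl⟩ := h
      have f1 := fst_eq_axis b' c'
      have f2 := fst_eq_axis b' c₁'
      have f3 := fst_eq_axis' g2.2.1
      have f4 := fst_eq_axis' g2'.2.1
      have hα := axis_fst_ne_zero g2.1 g2.2.1
      rw [g3'] at f2 f4
      rw [g3] at f1 f3 hα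
      have : c' = c₁' := by
        refine Prod.ext (f1.trans f2.symm) (mul_left_cancel₀ hα ?_)
        linear_combination f4 - f3
      rw [this]
  have e2 : ((axisEnergy A B K).filter fun q => isoD q.1.1 q.2.2 = 0).card ≤
      2 * L * B.card ^ 2 := by
    refine (Finset.card_le_card_of_injOn (fun q => (⟨q.1, q.2.2⟩ : Sigma fun _ => F × F)) ?_
      ?_).trans hcount
    · rintro ⟨⟨b, c⟩, ⟨b', c'⟩⟩ hq
      rw [Finset.mem_coe, Finset.mem_filter] at hq
      obtain ⟨hb, hc, hb', hc', -⟩ := hmem _ _ _ _ hq.1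
      rw [Finset.mem_coe, Finset.mem_sigma, Finset.mem_product, Finset.mem_filter]
      exact ⟨⟨hb, hc⟩, hc', hq.2⟩
    · rintro ⟨⟨b, c⟩, ⟨b', c'⟩⟩ hq ⟨⟨b₁, c₁⟩, ⟨b₁', c₁'⟩⟩ hq' h
      rw [Finset.mem_coe, Finset.mem_filter] at hq hq'
      obtain ⟨-, -, -, -, g1, g2, g3⟩ := hmem _ _ _ _ hq.1
      obtain ⟨-, -, -, -, g1', g2', g3'⟩ := hmem _ _ _ _ hq'.1
      simp only [Sigma.mk.injEq, heq_eq_eq, Prod.mk.injEq] at h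
      obtain ⟨⟨rfl, rfl⟩, rfl⟩ := h
      have f1 := fst_eq_axis b' c'
      have f2 := fst_eq_axis b₁' c'
      have f3 := fst_eq_axis' g2.2.1
      have f4 := fst_eq_axis' g2'.2.1
      have hα := axis_fst_ne_zero g2.1 g2.2.1
      rw [g3'] at f2 f4
      rw [g3] at f1 f3 hα
      have : b' = b₁' := by
        refine Prod.ext (f3.trans f4.symm) (mul_left_cancel₀ hα ?_)
        linear_combination f2 - f1
      rw [this]
  have e3 : ((axisEnergy A B K).filter fun q =>
      isoD q.1.1 q.2.1 ≠ 0 ∧ isoD q.1.1 q.2.2 ≠ 0).card ≤ (axisQuad A K).card := by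
    refine Finset.card_le_card_of_injOn (fun q => ((q.1.1, q.2.1), (q.1.2, q.2.2))) ?_ ?_
    · rintro ⟨⟨b, c⟩, ⟨b', c'⟩⟩ hq
      rw [Finset.mem_coe, Finset.mem_filter] at hq
      obtain ⟨hb, hc, hb', hc', g1, g2, g3⟩ := hmem _ _ _ _ hq.1
      rw [Finset.mem_coe, axisQuad, Finset.mem_filter]
      simp only [Finset.mem_product]
      exact ⟨⟨⟨hBA hb, hBA hb'⟩, hBA hc, hBA hc'⟩, g1, g2,
        (sameAxis_iff g1.1 g1.2.1 g2.2.1).2 g3, hq.2.1, hq.2.2⟩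
    · rintro ⟨⟨b, c⟩, ⟨b', c'⟩⟩ - ⟨⟨b₁, c₁⟩, ⟨b₁', c₁'⟩⟩ - h
      simp only [Prod.mk.injEq] at h
      obtain ⟨⟨rfl, rfl⟩, rfl, rfl⟩ := h
      rfl
  have e4 : (axisEnergy A B K).card ≤
      ((axisEnergy A B K).filter fun q => isoD q.1.1 q.2.1 ≠ 0 ∧ isoD q.1.1 q.2.2 ≠ 0).card +
      (((axisEnergy A B K).filter fun q => isoD q.1.1 q.2.1 = 0).card +
        ((axisEnergy A B K).filter fun q => isoD q.1.1 q.2.2 = 0).card) := by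
    refine (Finset.card_le_card fun q hq => ?_).trans ((Finset.card_union_le _ _).trans
      (Nat.add_le_add_left (Finset.card_union_le _ _) _))
    simp only [Finset.mem_union, Finset.mem_filter]
    tauto
  linarith

open Classical in
/-- The number of points of `A` on the line `u = α v + β`. -/
noncomputable def onAxis (A : Finset (F × F)) (l : F × F) : ℕ :=
  (A.filter fun a => a.1 = l.1 * a.2 + l.2).card

open Classical in
/-- The number of good pairs of points of `B` with axis `l`. -/
noncomputable def axisMult (A B : Finset (F × F)) (K : ℕ) (l : F × F) : ℕ :=
  ((B ×ˢ B).filter fun q => IsGood A K q.1 q.2 ∧ axis q.1 q.2 = l).card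

open Classical in
/-- The axes of the good pairs of points of `B`. -/
noncomputable def axes (A B : Finset (F × F)) (K : ℕ) : Finset (F × F) :=
  ((B ×ˢ B).filter fun q => IsGood A K q.1 q.2).image fun q => axis q.1 q.2

lemma card_goodTri_eq (A B : Finset (F × F)) (K : ℕ) :
    (goodTri A B K).card = ∑ l ∈ axes A B K, axisMult A B K l * onAxis A l := by
  classical
  rw [Finset.card_eq_sum_card_fiberwise (f := fun q => axis q.2.1 q.2.2) (t := axes A B K)]
  · refine Finset.sum_congr rfl fun l _ => ?_
    rw [axisMult, onAxis, mul_comm, ← Finset.card_product]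
    congr 1
    ext ⟨a, b, c⟩
    simp only [goodTri, Finset.mem_filter, Finset.mem_product]
    constructor
    · rintro ⟨⟨⟨ha, hb, hc⟩, h1, h2⟩, rfl⟩
      exact ⟨⟨ha, (isoD_eq_iff_axis h2.2.1 a).1 h1⟩, ⟨hb, hc⟩, h2, rfl⟩
    · rintro ⟨⟨ha, h1⟩, ⟨hb, hc⟩, h2, rfl⟩
      exact ⟨⟨⟨ha, hb, hc⟩, (isoD_eq_iff_axis h2.2.1 a).2 h1, h2⟩, rfl⟩
  · intro q hq
    simp only [goodTri, Finset.coe_filter, Finset.mem_product, Set.mem_ofPred_eq] at hq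
    exact Finset.mem_coe.2 (Finset.mem_image.2 ⟨q.2, Finset.mem_filter.2
      ⟨Finset.mem_product.2 hq.1.2, hq.2.2⟩, rfl⟩)

lemma sum_axisMult_le (A B : Finset (F × F)) (K : ℕ) :
    ∑ l ∈ axes A B K, axisMult A B K l ≤ B.card ^ 2 := by
  classical
  have h := Finset.card_eq_sum_card_image (fun q : (F × F) × (F × F) => axis q.1 q.2)
    ((B ×ˢ B).filter fun q => IsGood A K q.1 q.2)
  simp only [Finset.filter_filter] at h
  rw [sq, ← Finset.card_product]
  refine le_trans (le_of_eq ?_) (Finset.card_le_card (Finset.filter_subset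
    (fun q => IsGood A K q.1 q.2) _))
  exact h.symm

lemma sum_axisMult_sq (A B : Finset (F × F)) (K : ℕ) :
    ∑ l ∈ axes A B K, axisMult A B K l ^ 2 = (axisEnergy A B K).card := by
  classical
  rw [Finset.card_eq_sum_card_fiberwise (f := fun q => axis q.1.1 q.1.2) (t := axes A B K)]
  · refine Finset.sum_congr rfl fun l _ => ?_
    rw [axisMult, sq, ← Finset.card_product]
    congr 1
    ext ⟨⟨b, c⟩, b', c'⟩
    simp only [axisEnergy, Finset.mem_filter, Finset.mem_product]
    constructor
    · rintro ⟨⟨⟨hb, hc⟩, h1, rfl⟩, ⟨hb', hc'⟩, h2, h3⟩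
      exact ⟨⟨⟨⟨hb, hc⟩, hb', hc'⟩, h1, h2, h3⟩, rfl⟩
    · rintro ⟨⟨⟨⟨hb, hc⟩, hb', hc'⟩, h1, h2, h3⟩, rfl⟩
      exact ⟨⟨⟨hb, hc⟩, h1, rfl⟩, ⟨hb', hc'⟩, h2, h3⟩
  · intro q hq
    simp only [axisEnergy, Finset.coe_filter, Finset.mem_product, Set.mem_ofPred_eq] at hq
    exact Finset.mem_coe.2 (Finset.mem_image.2 ⟨q.1, Finset.mem_filter.2
      ⟨Finset.mem_product.2 hq.1.1, hq.2.1⟩, rfl⟩)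

lemma sum_onAxis_sub_one_sq_le (A : Finset (F × F)) (S : Finset (F × F)) :
    ∑ l ∈ S, (onAxis A l - 1) ^ 2 ≤ A.card ^ 2 := by
  classical
  calc _ ≤ ∑ l ∈ S, (A.filter fun a => a.1 = l.1 * a.2 + l.2).offDiag.card := by
        refine Finset.sum_le_sum fun l _ => ?_
        rw [Finset.offDiag_card, ← onAxis, sq, ← Nat.mul_sub_one]
        exact Nat.mul_le_mul_right _ (Nat.sub_le _ _)
    _ ≤ (A ×ˢ A).card := by
        rw [← Finset.card_biUnion]
        · refine Finset.card_le_card fun q hq => ?_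
          simp only [Finset.mem_biUnion, Finset.mem_offDiag, Finset.mem_filter] at hq
          obtain ⟨l, -, h1, h2, -⟩ := hq
          exact Finset.mem_product.2 ⟨h1.1, h2.1⟩
        · intro l _ l' _ hne
          rw [Function.onFun, Finset.disjoint_left]
          rintro ⟨x, y⟩ h1 h2
          simp only [Finset.mem_offDiag, Finset.mem_filter] at h1 h2
          obtain ⟨⟨-, f1⟩, ⟨-, f2⟩, f3⟩ := h1
          obtain ⟨⟨-, f1'⟩, ⟨-, f2'⟩, -⟩ := h2
          have h0 : x.2 - y.2 ≠ 0 := fun h0 => f3 (Prod.ext (by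
            rw [f1, f2, sub_eq_zero.1 h0]) (sub_eq_zero.1 h0))
          have e1 : l.1 = l'.1 := by
            apply mul_left_cancel₀ h0
            linear_combination f1' - f1 - f2' + f2
          refine hne (Prod.ext e1 ?_)
          rw [e1] at f1
          linear_combination f1' - f1
    _ = _ := by rw [Finset.card_product, sq]

lemma card_goodTri_le (A B : Finset (F × F)) (K : ℕ) :
    ((goodTri A B K).card : ℝ) ≤ B.card ^ 2 + A.card * √(axisEnergy A B K).card := by
  have h1 : (goodTri A B K).card ≤ ∑ l ∈ axes A B K, axisMult A B K l +
      ∑ l ∈ axes A B K, axisMult A B K l * (onAxis A l - 1) := by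
    rw [card_goodTri_eq, ← Finset.sum_add_distrib]
    refine Finset.sum_le_sum fun l _ => ?_
    exact (Nat.mul_le_mul_left _ (by omega : onAxis A l ≤ 1 + (onAxis A l - 1))).trans_eq (by ring)
  have h2 : ((goodTri A B K).card : ℝ) ≤ ∑ l ∈ axes A B K, (axisMult A B K l : ℝ) +
      ∑ l ∈ axes A B K, (axisMult A B K l : ℝ) * ((onAxis A l - 1 : ℕ) : ℝ) := by
    exact_mod_cast h1
  refine h2.trans (add_le_add (by exact_mod_cast sum_axisMult_le A B K) ?_)
  refine (Real.sum_mul_le_sqrt_mul_sqrt _ _ _).trans ?_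
  rw [mul_comm]
  have e1 : √(∑ l ∈ axes A B K, ((onAxis A l - 1 : ℕ) : ℝ) ^ 2) ≤ A.card := by
    rw [Real.sqrt_le_left (by positivity)]
    exact_mod_cast sum_onAxis_sub_one_sq_le A _
  have e2 : ∑ l ∈ axes A B K, (axisMult A B K l : ℝ) ^ 2 = (axisEnergy A B K).card := by
    exact_mod_cast sum_axisMult_sq A B K
  rw [e2]
  gcongr

end Axis

section SevenThirds
variable {F : Type*} [Field F]

lemma exists_richness (N : ℕ) (hN : 0 < N) : ∃ K : ℕ, 4 * N ≤ K ^ 2 ∧ (K : ℝ) ≤ 4 * √N := by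
  refine ⟨2 * (Nat.sqrt N + 1), ?_, ?_⟩
  · have := Nat.lt_succ_sqrt N
    rw [Nat.succ_eq_add_one] at this
    nlinarith
  · have h1 : (Nat.sqrt N : ℝ) ≤ √N := Real.nat_sqrt_le_real_sqrt
    have h2 : (1 : ℝ) ≤ √N := Real.one_le_sqrt.2 (by exact_mod_cast hN)
    push_cast
    linarith

lemma exists_sqrt_sqrt {t : ℝ} (ht : 0 ≤ t) : ∃ w : ℝ, 1 ≤ w ∧ w ^ 4 = t + 1 := by
  refine ⟨√√(t + 1), ?_, ?_⟩
  · exact Real.one_le_sqrt.2 (Real.one_le_sqrt.2 (by linarith))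
  · rw [show 4 = 2 * 2 from rfl, pow_mul, Real.sq_sqrt (Real.sqrt_nonneg _),
      Real.sq_sqrt (by linarith)]

open Classical in
lemma card_prune_le {G : Type*} {A : Finset (G × G)} {L : ℕ} {b : G × G} (hb : b ∈ prune A L) :
    ((prune A L).filter fun y => y.1 = b.1).card ≤ L ∧
      ((prune A L).filter fun y => y.2 = b.2).card ≤ L := by
  have h := (Finset.mem_filter.1 hb).2
  exact ⟨(Finset.card_le_card (Finset.filter_subset_filter _ (prune_subset A L))).trans h.1,
    (Finset.card_le_card (Finset.filter_subset_filter _ (prune_subset A L))).trans h.2⟩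

/-- The number of isosceles triangles is `O(N ^ (7 / 3))`. -/
lemma card_isoTri_le_seven_thirds [Infinite F] (p : ℕ) [CharP F p] (A : Finset (F × F))
    (hN : A.card ^ 3 ≤ p ^ 4) {x : ℝ} (hx : 1 ≤ x) (hA : (A.card : ℝ) = x ^ 3) :
    ((isoTri A).card : ℝ) ≤ 10 ^ 7 * x ^ 7 := by
  have hx0 : 0 < x := by linarith
  have hpos : 0 < A.card := by
    have : (0 : ℝ) < A.card := by rw [hA]; positivity
    exact_mod_cast this
  obtain ⟨K, hK, hK'⟩ := exists_richness A.card hpos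
  set L := ⌈x ^ 2⌉₊ with hL
  have hL1 : x ^ 2 ≤ L := Nat.le_ceil _
  have hL2 : (L : ℝ) ≤ 2 * x ^ 2 := by
    have h1 := (Nat.ceil_lt_add_one (by positivity : 0 ≤ x ^ 2)).le
    have h2 : 1 ≤ x ^ 2 := one_le_pow₀ hx
    linarith
  have hKx : (K : ℝ) ≤ 4 * x ^ 2 := by
    have : √(A.card : ℝ) ≤ x ^ 2 := by
      rw [hA, Real.sqrt_le_left (by positivity), ← pow_mul]
      exact pow_le_pow_right₀ hx (by norm_num)
    linarith
  have h1 := card_isoTri_le_prune A K L hK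
  have h2 := card_goodTri_le A (prune A L) K
  have h3 := card_axisEnergy_le (prune_subset A L) K L
    (fun b hb => (card_prune_le hb).1) (fun b hb => (card_prune_le hb).2)
  have h4 := card_axisQuad_le p A K hN
  have hB : ((prune A L).card : ℝ) ≤ x ^ 3 := by
    rw [← hA]; exact_mod_cast Finset.card_le_card (prune_subset A L)
  have h1' : (L : ℝ) * (isoTri A).card ≤
      L * ((goodTri A (prune A L) K).card + 12 * A.card ^ 2) + 4 * A.card ^ 3 := by
    exact_mod_cast h1
  have h3' : ((axisEnergy A (prune A L) K).card : ℝ) ≤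
      (axisQuad A K).card + 4 * L * (prune A L).card ^ 2 := by exact_mod_cast h3
  rw [hA] at h1' h2 h4
  generalize ((axisEnergy A (prune A L) K).card : ℝ) = E at *
  generalize ((axisQuad A K).card : ℝ) = Q at *
  generalize ((goodTri A (prune A L) K).card : ℝ) = g at *
  have hB0 : (0 : ℝ) ≤ (prune A L).card := by positivity
  generalize ((prune A L).card : ℝ) = B at *
  have hT0 : (0 : ℝ) ≤ (isoTri A).card := by positivity
  generalize ((isoTri A).card : ℝ) = T at *
  obtain ⟨w, hw, hwt⟩ := exists_sqrt_sqrt (t := T / x ^ 7) (by positivity)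
  have hT : T = x ^ 7 * (w ^ 4 - 1) := by
    rw [hwt]; field_simp; ring
  have hw0 : 0 < w := by linarith
  have hs : √(x ^ 3 * (T + (x ^ 3) ^ 2)) ≤ x ^ 5 * w ^ 2 := by
    rw [Real.sqrt_le_left (by positivity), hT]
    have : x ^ 6 ≤ x ^ 7 := pow_le_pow_right₀ hx (by norm_num)
    calc x ^ 3 * (x ^ 7 * (w ^ 4 - 1) + (x ^ 3) ^ 2) =
        x ^ 10 * w ^ 4 + x ^ 3 * (x ^ 6 - x ^ 7) := by ring
      _ ≤ x ^ 10 * w ^ 4 + 0 := by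
        gcongr
        exact mul_nonpos_of_nonneg_of_nonpos (by positivity) (by linarith)
      _ = _ := by ring
  have hw2 : 1 ≤ w ^ 2 := one_le_pow₀ hw
  have hQ : Q ≤ 10 ^ 9 * (5 * x ^ 8 * w ^ 2) := by
    refine h4.trans ?_
    have e1 : x ^ 3 * √(x ^ 3 * (T + (x ^ 3) ^ 2)) ≤ x ^ 8 * w ^ 2 := by
      calc _ ≤ x ^ 3 * (x ^ 5 * w ^ 2) := by gcongr
        _ = _ := by ring
    have e2 : K * (x ^ 3) ^ 2 ≤ 4 * x ^ 8 * w ^ 2 := by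
      calc _ ≤ 4 * x ^ 2 * (x ^ 3) ^ 2 := by gcongr
        _ = 4 * x ^ 8 * 1 := by ring
        _ ≤ _ := by gcongr
    nlinarith
  have hE : √E ≤ 8 * 10 ^ 4 * x ^ 4 * w := by
    rw [Real.sqrt_le_left (by positivity)]
    have e1 : 4 * L * B ^ 2 ≤ 8 * x ^ 8 * w ^ 2 := by
      calc _ ≤ 4 * (2 * x ^ 2) * (x ^ 3) ^ 2 := by gcongr
        _ = 8 * x ^ 8 * 1 := by ring
        _ ≤ _ := by gcongr
    have e2 : 0 ≤ x ^ 8 * w ^ 2 := by positivity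
    calc E ≤ 6 * 10 ^ 9 * (x ^ 8 * w ^ 2) := by nlinarith
      _ ≤ 64 * 10 ^ 8 * (x ^ 8 * w ^ 2) := by nlinarith
      _ = _ := by ring
  have hg : g ≤ x ^ 7 * (1 + 8 * 10 ^ 4 * w) := by
    have e0 : x ^ 6 ≤ x ^ 7 := pow_le_pow_right₀ hx (by norm_num)
    have e1 : B ^ 2 ≤ x ^ 6 := by
      calc _ ≤ (x ^ 3) ^ 2 := by gcongr
        _ = _ := by ring
    have e2 : x ^ 3 * √E ≤ x ^ 7 * (8 * 10 ^ 4 * w) := by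
      calc _ ≤ x ^ 3 * (8 * 10 ^ 4 * x ^ 4 * w) := by gcongr
        _ = _ := by ring
    linarith
  have hL0 : (0 : ℝ) < L := lt_of_lt_of_le (by positivity) hL1
  have hfin : T ≤ g + 16 * x ^ 7 := by
    apply le_of_mul_le_mul_left _ hL0
    have e0 : 12 * (x ^ 3) ^ 2 ≤ 12 * x ^ 7 := by
      have : x ^ 6 ≤ x ^ 7 := pow_le_pow_right₀ hx (by norm_num)
      linarith
    have e1 : 4 * (x ^ 3) ^ 3 ≤ L * (4 * x ^ 7) := by
      calc _ = x ^ 2 * (4 * x ^ 7) := by ring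
        _ ≤ _ := by gcongr
    have e2 := mul_le_mul_of_nonneg_left e0 hL0.le
    nlinarith
  have hw4 : w ^ 4 ≤ 18 + 8 * 10 ^ 4 * w := by
    have hx7 : 0 < x ^ 7 := by positivity
    apply le_of_mul_le_mul_left _ hx7
    rw [hT] at hfin
    nlinarith
  have hw50 : w ≤ 50 := by
    by_contra! hcon
    have e1 : 50 ^ 3 ≤ w ^ 3 := by gcongr
    nlinarith
  have hw4' : w ^ 4 ≤ 50 ^ 4 := by gcongr
  rw [hT, mul_comm]
  have hx7 : 0 < x ^ 7 := by positivity
  gcongr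
  linarith

end SevenThirds

section Discrepancy
variable {V Λ F : Type*} [Fintype Λ] [Field F] [Fintype F]

open Classical in
/-- The number of points of `R` on the graph of `g l.1 + l.2`. -/
noncomputable def graphCount (g : Λ → V → F) (R : Finset (V × F)) (l : Λ × F) : ℕ :=
  (R.filter fun P => P.2 = g l.1 P.1 + l.2).card

open Classical in
lemma card_graph_through (g : Λ → V → F) (P : V × F) :
    (Finset.univ.filter fun l : Λ × F => P.2 = g l.1 P.1 + l.2).card = Fintype.card Λ := by
  rw [← Finset.card_univ]
  refine Finset.card_bij' (fun l _ => l.1) (fun μ _ => (μ, P.2 - g μ P.1)) ?_ ?_ ?_ ?_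
  · simp
  · simp
  · rintro ⟨μ, t⟩ h
    simp only [Finset.mem_filter, Finset.mem_univ, true_and] at h
    simp [h]
  · simp

lemma sum_graphCount (g : Λ → V → F) (R : Finset (V × F)) :
    ∑ l, graphCount g R l = R.card * Fintype.card Λ := by
  classical
  simp only [graphCount, Finset.card_filter]
  rw [Finset.sum_comm]
  simp only [← Finset.card_filter, card_graph_through, Finset.sum_const, smul_eq_mul]

open Classical in
lemma sum_graphCount_sq_le (g : Λ → V → F) (R : Finset (V × F))
    (hg : ∀ s s' : V, s ≠ s' → ∀ w : F,
      (Finset.univ.filter fun μ => g μ s - g μ s' = w).card * Fintype.card F ≤ Fintype.card Λ) :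
    (∑ l, graphCount g R l ^ 2) * Fintype.card F ≤
      R.card * Fintype.card Λ * Fintype.card F + R.card ^ 2 * Fintype.card Λ := by
  have h1 : ∑ l, graphCount g R l ^ 2 = ∑ P ∈ R, ∑ P' ∈ R,
      (Finset.univ.filter fun l : Λ × F =>
        P.2 = g l.1 P.1 + l.2 ∧ P'.2 = g l.1 P'.1 + l.2).card := by
    have : ∀ l : Λ × F, graphCount g R l ^ 2 = ∑ P ∈ R, ∑ P' ∈ R,
        if P.2 = g l.1 P.1 + l.2 ∧ P'.2 = g l.1 P'.1 + l.2 then 1 else 0 := by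
      intro l
      rw [sq, graphCount, Finset.card_filter, Finset.sum_mul_sum]
      refine Finset.sum_congr rfl fun x _ => Finset.sum_congr rfl fun x' _ => ?_
      split_ifs <;> simp_all
    simp only [this]
    rw [Finset.sum_comm]
    refine Finset.sum_congr rfl fun x _ => ?_
    rw [Finset.sum_comm]
    exact Finset.sum_congr rfl fun x' _ => (Finset.card_filter _ _).symm
  have h2 : ∀ P ∈ R, ∀ P' ∈ R, (Finset.univ.filter fun l : Λ × F =>
      P.2 = g l.1 P.1 + l.2 ∧ P'.2 = g l.1 P'.1 + l.2).card * Fintype.card F ≤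
      (if P = P' then Fintype.card Λ * Fintype.card F else 0) + Fintype.card Λ := by
    intro P _ P' _
    split_ifs with h
    · subst h
      simp only [and_self, card_graph_through]
      exact Nat.le_add_right _ _
    · rw [zero_add]
      by_cases hs : P.1 = P'.1
      · rw [Finset.card_eq_zero.2, zero_mul]
        · exact Nat.zero_le _
        · refine Finset.filter_eq_empty_iff.2 fun l _ hl => h (Prod.ext hs ?_)
          rw [hl.1, hl.2, hs]
      · refine le_trans (Nat.mul_le_mul_right _ ?_) (hg _ _ hs (P.2 - P'.2))
        refine Finset.card_le_card_of_injOn Prod.fst ?_ ?_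
        · intro l hl
          simp only [Finset.coe_filter, Finset.mem_univ, true_and, Set.mem_ofPred_eq] at hl ⊢
          rw [hl.1, hl.2]; ring
        · rintro ⟨μ, t⟩ hl ⟨μ', t'⟩ hl' (rfl : μ = μ')
          simp only [Finset.coe_filter, Finset.mem_univ, true_and, Set.mem_ofPred_eq] at hl hl'
          rw [add_left_cancel (hl.1.symm.trans hl'.1)]
  rw [h1, Finset.sum_mul]
  calc _ ≤ ∑ P ∈ R, (Fintype.card Λ * Fintype.card F + R.card * Fintype.card Λ) := by
        refine Finset.sum_le_sum fun P hP => ?_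
        rw [Finset.sum_mul]
        refine (Finset.sum_le_sum (h2 P hP)).trans ?_
        rw [Finset.sum_add_distrib, Finset.sum_ite_eq, if_pos hP, Finset.sum_const, smul_eq_mul]
    _ = _ := by rw [Finset.sum_const, smul_eq_mul]; ring

open Classical in
/-- Second moment of the discrepancy of point–graph incidences. -/
lemma sum_sq_graphCount_sub_le (g : Λ → V → F) (R : Finset (V × F))
    (hg : ∀ s s' : V, s ≠ s' → ∀ w : F,
      (Finset.univ.filter fun μ => g μ s - g μ s' = w).card * Fintype.card F ≤ Fintype.card Λ) :
    ∑ l, ((graphCount g R l : ℝ) - R.card / Fintype.card F) ^ 2 ≤ R.card * Fintype.card Λ := by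
  have hq : (0 : ℝ) < Fintype.card F := by exact_mod_cast Fintype.card_pos
  have h1 : (∑ l, (graphCount g R l : ℝ)) = R.card * Fintype.card Λ := by
    exact_mod_cast sum_graphCount g R
  have h2 : (∑ l, (graphCount g R l : ℝ) ^ 2) * Fintype.card F ≤
      R.card * Fintype.card Λ * Fintype.card F + R.card ^ 2 * Fintype.card Λ := by
    exact_mod_cast sum_graphCount_sq_le g R hg
  have h3 : ∑ l, ((graphCount g R l : ℝ) - R.card / Fintype.card F) ^ 2 =
      (∑ l, (graphCount g R l : ℝ) ^ 2) - R.card ^ 2 * Fintype.card Λ / Fintype.card F := by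
    simp only [sub_sq, Finset.sum_add_distrib, Finset.sum_sub_distrib, ← Finset.sum_mul,
      ← Finset.mul_sum, h1, Finset.sum_const, Finset.card_univ, Fintype.card_prod, nsmul_eq_mul]
    push_cast
    field_simp
    ring
  rw [h3, sub_le_iff_le_add]
  apply le_of_mul_le_mul_right _ hq
  refine h2.trans_eq ?_
  field_simp

open Classical in
lemma sum_weight_mul_graphCount_le (g : Λ → V → F) (R : Finset (V × F))
    (hg : ∀ s s' : V, s ≠ s' → ∀ w : F,
      (Finset.univ.filter fun μ => g μ s - g μ s' = w).card * Fintype.card F ≤ Fintype.card Λ)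
    (S : Finset (Λ × F)) (m : Λ × F → ℝ) :
    ∑ l ∈ S, m l * ((graphCount g R l : ℝ) - R.card / Fintype.card F) ≤
      √(∑ l ∈ S, m l ^ 2) * √(R.card * Fintype.card Λ) := by
  refine (Real.sum_mul_le_sqrt_mul_sqrt _ _ _).trans ?_
  gcongr
  refine le_trans ?_ (sum_sq_graphCount_sub_le g R hg)
  exact Finset.sum_le_sum_of_subset_of_nonneg (Finset.subset_univ _) fun _ _ _ => sq_nonneg _

open Classical in
lemma onAxis_eq_graphCount {k : Type*} [Field k] (A : Finset (k × k)) (l : k × k) :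
    onAxis A l = graphCount (fun μ v => μ * v) (A.image Prod.swap) l := by
  rw [onAxis, graphCount, Finset.filter_image, Finset.card_image_of_injective _ Prod.swap_injective]
  rfl

lemma card_linear_le [DecidableEq F] (s s' : F) (h : s ≠ s') (w : F) :
    (Finset.univ.filter fun μ : F => μ * s - μ * s' = w).card * Fintype.card F ≤
      Fintype.card F := by
  have : (Finset.univ.filter fun μ : F => μ * s - μ * s' = w).card ≤ 1 := by
    refine Finset.card_le_one.2 fun μ hμ μ' hμ' => ?_
    simp only [Finset.mem_filter, Finset.mem_univ, true_and] at hμ hμ'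
    apply mul_right_cancel₀ (sub_ne_zero.2 h)
    linear_combination hμ - hμ'
  nlinarith

lemma sum_weight_mul_onAxis_le (A : Finset (F × F)) (S : Finset (F × F)) (m : F × F → ℝ) :
    ∑ l ∈ S, m l * ((onAxis A l : ℝ) - A.card / Fintype.card F) ≤
      √(∑ l ∈ S, m l ^ 2) * √(A.card * Fintype.card F) := by
  classical
  have h := sum_weight_mul_graphCount_le (fun μ v : F => μ * v) (A.image Prod.swap)
    (fun s s' hs w => by convert card_linear_le s s' hs w) S m
  rw [Finset.card_image_of_injective _ Prod.swap_injective] at h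
  simpa only [onAxis_eq_graphCount] using h

end Discrepancy

section Rotated
variable {k F : Type*} [Field k] [Field F] (j : k →+* F) (i : F)

/-- Isotropic coordinates over a field containing a square root `i` of `-1`. -/
def isoEmb (x : k × k) : F × F := (j x.1 + i * j x.2, j x.1 - i * j x.2)

variable {j i}

lemma isoD_isoEmb (hi : i ^ 2 = -1) (a b : k × k) :
    isoD (isoEmb j i a) (isoEmb j i b) = j (dist2 a b) := by
  simp only [isoD, isoEmb, dist2, map_add, map_sub, map_pow]
  linear_combination -(j a.2 - j b.2) ^ 2 * hi

lemma isoEmb_fst_inj (hij : i ∉ Set.range j) {a b : k × k}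
    (h : (isoEmb j i a).1 = (isoEmb j i b).1) : a = b := by
  simp only [isoEmb] at h
  by_cases h2 : a.2 = b.2
  · refine Prod.ext (j.injective ?_) h2
    rw [h2] at h; linear_combination h
  · refine absurd ⟨(b.1 - a.1) / (a.2 - b.2), ?_⟩ hij
    have : j a.2 - j b.2 ≠ 0 := by
      rw [← map_sub]; exact (map_ne_zero j).2 (sub_ne_zero.2 h2)
    rw [map_div₀, map_sub, map_sub, div_eq_iff this]
    linear_combination -h

lemma isoEmb_snd_inj (hij : i ∉ Set.range j) {a b : k × k}
    (h : (isoEmb j i a).2 = (isoEmb j i b).2) : a = b := by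
  have hij' : -i ∉ Set.range j := fun ⟨x, hx⟩ => hij ⟨-x, by rw [map_neg, hx, neg_neg]⟩
  apply isoEmb_fst_inj hij'
  simp only [isoEmb] at h ⊢
  linear_combination h

/-- The bisector `x = μ y + ν` of two points with distinct abscissae. -/
def bisector (b c : k × k) : k × k :=
  ((b.2 - c.2) / (c.1 - b.1), (c.1 ^ 2 + c.2 ^ 2 - b.1 ^ 2 - b.2 ^ 2) / (2 * (c.1 - b.1)))

lemma dist2_eq_iff_bisector (h2 : (2 : k) ≠ 0) {b c : k × k} (h : b.1 ≠ c.1) (a : k × k) :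
    dist2 a b = dist2 a c ↔ a.1 = (bisector b c).1 * a.2 + (bisector b c).2 := by
  have h' := sub_ne_zero.2 h.symm
  simp only [dist2, bisector]
  field_simp
  constructor <;> intro h <;> linear_combination h

lemma axis_isoEmb (hi : i ^ 2 = -1) (h2 : (2 : k) ≠ 0) {b c : k × k}
    (hne : (isoEmb j i b).2 ≠ (isoEmb j i c).2) (h : b.1 ≠ c.1) :
    axis (isoEmb j i b) (isoEmb j i c) =
      (-(1 - i * j (bisector b c).1) / (1 + i * j (bisector b c).1),
        2 * j (bisector b c).2 / (1 + i * j (bisector b c).1)) := by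
  have h' : j c.1 - j b.1 ≠ 0 := by
    rw [← map_sub]; exact (map_ne_zero j).2 (sub_ne_zero.2 h.symm)
  have h2' : (2 : F) ≠ 0 := by
    rw [← map_ofNat j 2]; exact (map_ne_zero j).2 h2
  have hd : (isoEmb j i b).2 - (isoEmb j i c).2 =
      -(j c.1 - j b.1) * (1 + i * j (bisector b c).1) := by
    simp only [isoEmb, bisector, map_div₀, map_sub]
    field_simp
    ring
  have hd0 : 1 + i * j (bisector b c).1 ≠ 0 := by
    intro h0
    rw [h0, mul_zero] at hd
    exact hne (sub_eq_zero.1 hd)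
  have hn : (isoEmb j i c).1 - (isoEmb j i b).1 =
      (j c.1 - j b.1) * (1 - i * j (bisector b c).1) := by
    simp only [isoEmb, bisector, map_div₀, map_sub]
    field_simp
    ring
  have hν : 2 * j (bisector b c).2 * (j c.1 - j b.1) =
      j c.1 ^ 2 + j c.2 ^ 2 - j b.1 ^ 2 - j b.2 ^ 2 := by
    simp only [bisector, map_div₀, map_sub, map_add, map_pow, map_mul, map_ofNat]
    field_simp
  have hμ : j (bisector b c).1 * (j c.1 - j b.1) = j b.2 - j c.2 := by
    simp only [bisector, map_div₀, map_sub]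
    field_simp
  have hfst : (axis (isoEmb j i b) (isoEmb j i c)).1 =
      -(1 - i * j (bisector b c).1) / (1 + i * j (bisector b c).1) := by
    rw [axis, hd, hn]
    field_simp
  refine Prod.ext hfst ?_
  rw [axis] at hfst ⊢
  simp only at hfst ⊢
  rw [hfst, eq_div_iff hd0]
  apply mul_right_cancel₀ h'
  rw [hν]
  simp only [isoEmb]
  field_simp
  generalize j (bisector b c).1 = μ at *
  have e1 : j b.2 = j c.2 + μ * (j c.1 - j b.1) := by linear_combination -hμ
  rw [e1]
  linear_combination (j c.1 - j b.1) * (2 * j c.2 * μ + μ ^ 2 * (j c.1 - j b.1)) * hi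

end Rotated

section Rotated

lemma sum_card_fiber_sq {α β : Type*} [DecidableEq β] (P : Finset α) (f : α → β) :
    ∑ l ∈ P.image f, (P.filter fun x => f x = l).card ^ 2 =
      ((P ×ˢ P).filter fun q => f q.2 = f q.1).card := by
  rw [Finset.card_filter, Finset.sum_product, ← Finset.sum_fiberwise_of_maps_to
    (g := f) (t := P.image f) (fun x hx => Finset.mem_image_of_mem f hx)]
  refine Finset.sum_congr rfl fun l _ => ?_
  rw [sq, ← smul_eq_mul, ← Finset.sum_const]
  refine Finset.sum_congr rfl fun x hx => ?_
  obtain rfl := (Finset.mem_filter.1 hx).2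
  rw [Finset.card_filter]

variable {k F : Type*} [Field k] [Field F] {j : k →+* F} {i : F}

open Classical in
lemma card_vertical_le (A₀ : Finset (k × k)) :
    ((A₀ ×ˢ A₀ ×ˢ A₀).filter fun q => q.2.1.1 = q.2.2.1 ∧ q.2.1 ≠ q.2.2 ∧
      dist2 q.1 q.2.1 = dist2 q.1 q.2.2).card ≤ A₀.card ^ 2 := by
  rw [sq, ← Finset.card_product]
  refine Finset.card_le_card_of_injOn (fun q => (q.1, q.2.1)) ?_ ?_
  · rintro ⟨a, b, c⟩ hq
    rw [Finset.mem_coe, Finset.mem_filter] at hq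
    simp only [Finset.mem_product] at hq
    exact Finset.mem_coe.2 (Finset.mem_product.2 ⟨hq.1.1, hq.1.2.1⟩)
  · rintro ⟨a, b, c⟩ hq ⟨a', b', c'⟩ hq' h
    rw [Finset.mem_coe, Finset.mem_filter] at hq hq'
    simp only [Prod.mk.injEq] at h
    obtain ⟨rfl, rfl⟩ := h
    have key : ∀ x : k × k, b.1 = x.1 → b ≠ x → dist2 a b = dist2 a x → x.2 = 2 * a.2 - b.2 := by
      intro x h1 h3 h4
      have h5 : b.2 - x.2 ≠ 0 := fun h0 => h3 (Prod.ext h1 (sub_eq_zero.1 h0))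
      apply mul_left_cancel₀ h5
      simp only [dist2, h1] at h4
      linear_combination h4
    have e : c = c' := Prod.ext (hq.2.1.symm.trans hq'.2.1)
      ((key c hq.2.1 hq.2.2.1 hq.2.2.2).trans (key c' hq'.2.1 hq'.2.2.1 hq'.2.2.2).symm)
    rw [e]

lemma isoEmb_injective (hij : i ∉ Set.range j) : Function.Injective (isoEmb j i) :=
  fun _ _ h => isoEmb_fst_inj hij (congrArg Prod.fst h)

open Classical in
lemma card_goodTri_isoEmb_le [Fintype k] (hi : i ^ 2 = -1) (hij : i ∉ Set.range j)
    (h2 : (2 : k) ≠ 0) (A₀ : Finset (k × k)) (K : ℕ) :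
    ((goodTri (A₀.image (isoEmb j i)) (A₀.image (isoEmb j i)) K).card : ℝ) ≤
      A₀.card ^ 2 + (A₀.card ^ 3 / Fintype.card k +
        √(axisEnergy (A₀.image (isoEmb j i)) (A₀.image (isoEmb j i)) K).card *
          √(A₀.card * Fintype.card k)) := by
  set φ := isoEmb j i with hφ
  set A := A₀.image φ with hA
  have hinj : Function.Injective φ := isoEmb_injective hij
  set P := (A₀ ×ˢ A₀).filter fun q => q.1.1 ≠ q.2.1 ∧ IsGood A K (φ q.1) (φ q.2) with hP
  set f : (k × k) × (k × k) → k × k := fun q => bisector q.1 q.2 with hf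
  set m : k × k → ℕ := fun l => (P.filter fun q => f q = l).card with hm
  have h1 : (goodTri A A K).card ≤ A₀.card ^ 2 + ∑ l ∈ P.image f, m l * onAxis A₀ l := by
    have hsub : goodTri A A K ⊆ (((A₀ ×ˢ A₀ ×ˢ A₀).filter fun q => q.2.1.1 = q.2.2.1 ∧
        q.2.1 ≠ q.2.2 ∧ dist2 q.1 q.2.1 = dist2 q.1 q.2.2) ∪
        ((P.image f).biUnion fun l => (A₀.filter fun a => a.1 = l.1 * a.2 + l.2) ×ˢ
          (P.filter fun q => f q = l))).image fun q => (φ q.1, φ q.2.1, φ q.2.2) := by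
      rintro ⟨a', b', c'⟩ hq
      simp only [goodTri, Finset.mem_filter, Finset.mem_product, hA, Finset.mem_image] at hq
      obtain ⟨⟨⟨a, ha, rfl⟩, ⟨b, hb, rfl⟩, ⟨c, hc, rfl⟩⟩, hD, hG⟩ := hq
      refine Finset.mem_image.2 ⟨(a, b, c), ?_, rfl⟩
      rw [hφ, isoD_isoEmb hi, isoD_isoEmb hi] at hD
      have hD' := j.injective hD
      by_cases h : b.1 = c.1
      · refine Finset.mem_union_left _ (Finset.mem_filter.2 ⟨?_, h, ?_, hD'⟩)
        · simp [ha, hb, hc]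
        · intro hbc; apply hG.1; rw [show b = c from hbc]
      · have hbc : (b, c) ∈ P :=
          Finset.mem_filter.2 ⟨Finset.mem_product.2 ⟨hb, hc⟩, h, hG⟩
        refine Finset.mem_union_right _ (Finset.mem_biUnion.2 ⟨f (b, c),
          Finset.mem_image_of_mem f hbc, Finset.mem_product.2 ⟨Finset.mem_filter.2 ⟨ha, ?_⟩,
            Finset.mem_filter.2 ⟨hbc, rfl⟩⟩⟩)
        exact (dist2_eq_iff_bisector h2 h a).1 hD'
    refine (Finset.card_le_card hsub).trans (Finset.card_image_le.trans
      ((Finset.card_union_le _ _).trans (add_le_add (card_vertical_le A₀) ?_)))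
    refine Finset.card_biUnion_le.trans (Finset.sum_le_sum fun l _ => ?_)
    rw [Finset.card_product, mul_comm, onAxis]
  have hsum : ∑ l ∈ P.image f, m l ≤ A₀.card ^ 2 := by
    rw [← Finset.card_eq_sum_card_image, sq, ← Finset.card_product]
    exact Finset.card_filter_le _ _
  have hsq : ∑ l ∈ P.image f, m l ^ 2 ≤ (axisEnergy A A K).card := by
    refine (sum_card_fiber_sq P f).le.trans ?_
    refine Finset.card_le_card_of_injOn (fun q => ((φ q.1.1, φ q.1.2), (φ q.2.1, φ q.2.2))) ?_ ?_
    · rintro ⟨⟨b, c⟩, b', c'⟩ hq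
      rw [Finset.mem_coe, Finset.mem_filter, Finset.mem_product, hP, Finset.mem_filter,
        Finset.mem_filter, Finset.mem_product, Finset.mem_product] at hq
      obtain ⟨⟨⟨⟨hb, hc⟩, hne, hg⟩, ⟨hb', hc'⟩, hne', hg'⟩, he⟩ := hq
      rw [Finset.mem_coe, axisEnergy, Finset.mem_filter]
      simp only [Finset.mem_product]
      refine ⟨⟨⟨Finset.mem_image_of_mem _ hb, Finset.mem_image_of_mem _ hc⟩,
        Finset.mem_image_of_mem _ hb', Finset.mem_image_of_mem _ hc'⟩, hg, hg', ?_⟩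
      simp only [hf] at he
      rw [hφ, axis_isoEmb hi h2 hg'.2.1 hne', axis_isoEmb hi h2 hg.2.1 hne, he]
    · rintro ⟨⟨b, c⟩, b', c'⟩ - ⟨⟨b₁, c₁⟩, b₁', c₁'⟩ - h
      simp only [Prod.mk.injEq, hinj.eq_iff] at h
      obtain ⟨⟨rfl, rfl⟩, rfl, rfl⟩ := h
      rfl
  have hmain := sum_weight_mul_onAxis_le A₀ (P.image f) (fun l => (m l : ℝ))
  simp only [mul_sub, Finset.sum_sub_distrib, ← Finset.sum_mul] at hmain
  have hsum' : (∑ l ∈ P.image f, (m l : ℝ)) ≤ A₀.card ^ 2 := by exact_mod_cast hsum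
  have hsq' : ∑ l ∈ P.image f, (m l : ℝ) ^ 2 ≤ (axisEnergy A A K).card := by exact_mod_cast hsq
  have h1' : ((goodTri A A K).card : ℝ) ≤
      A₀.card ^ 2 + ∑ l ∈ P.image f, (m l : ℝ) * onAxis A₀ l := by exact_mod_cast h1
  refine h1'.trans (add_le_add_right ?_ _)
  rw [sub_le_iff_le_add'] at hmain
  refine hmain.trans (add_le_add ?_ ?_)
  · calc _ ≤ (A₀.card : ℝ) ^ 2 * (A₀.card / Fintype.card k) := by gcongr
      _ = _ := by ring
  · gcongr

open Classical in
lemma card_axisEnergy_isoEmb_le (hij : i ∉ Set.range j) (A₀ : Finset (k × k)) (K : ℕ) :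
    (axisEnergy (A₀.image (isoEmb j i)) (A₀.image (isoEmb j i)) K).card ≤
      (axisQuad (A₀.image (isoEmb j i)) K).card + 4 * A₀.card ^ 2 := by
  have h := card_axisEnergy_le (Finset.Subset.refl (A₀.image (isoEmb j i))) K 1 ?_ ?_
  · rwa [Finset.card_image_of_injective _ (isoEmb_injective hij), mul_one] at h
  all_goals
    intro b hb
    refine Finset.card_le_one.2 fun x hx y hy => ?_
    obtain ⟨hx, hxb⟩ := Finset.mem_filter.1 hx
    obtain ⟨hy, hyb⟩ := Finset.mem_filter.1 hy
    obtain ⟨x, -, rfl⟩ := Finset.mem_image.1 hx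
    obtain ⟨y, -, rfl⟩ := Finset.mem_image.1 hy
  · rw [isoEmb_fst_inj hij (hxb.trans hyb.symm)]
  · rw [isoEmb_snd_inj hij (hxb.trans hyb.symm)]

open Classical in
lemma card_isoTri_isoEmb_le [Fintype k] (hi : i ^ 2 = -1) (hij : i ∉ Set.range j)
    (h2 : (2 : k) ≠ 0) (A₀ : Finset (k × k)) (K : ℕ) (hK : 4 * A₀.card ≤ K ^ 2) :
    ((isoTri (A₀.image (isoEmb j i))).card : ℝ) ≤
      A₀.card ^ 3 / Fintype.card k + 9 * A₀.card ^ 2 +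
        √(Fintype.card k * A₀.card *
          ((axisQuad (A₀.image (isoEmb j i)) K).card + 4 * A₀.card ^ 2)) := by
  have hc := Finset.card_image_of_injective A₀ (isoEmb_injective hij)
  have h1 := card_isoTri_le (A₀.image (isoEmb j i)) K (by rwa [hc])
  have h2 := card_goodTri_isoEmb_le hi hij h2 A₀ K
  have h3 := card_axisEnergy_isoEmb_le hij A₀ K
  rw [hc] at h1
  have h1' : ((isoTri (A₀.image (isoEmb j i))).card : ℝ) ≤
      (goodTri (A₀.image (isoEmb j i)) (A₀.image (isoEmb j i)) K).card + 8 * A₀.card ^ 2 := by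
    exact_mod_cast h1
  have h3' : ((axisEnergy (A₀.image (isoEmb j i)) (A₀.image (isoEmb j i)) K).card : ℝ) ≤
      (axisQuad (A₀.image (isoEmb j i)) K).card + 4 * A₀.card ^ 2 := by exact_mod_cast h3
  have h4 : √(axisEnergy (A₀.image (isoEmb j i)) (A₀.image (isoEmb j i)) K).card *
      √(A₀.card * Fintype.card k) ≤ √(Fintype.card k * A₀.card *
          ((axisQuad (A₀.image (isoEmb j i)) K).card + 4 * A₀.card ^ 2)) := by
    rw [← Real.sqrt_mul (by positivity)]
    apply Real.sqrt_le_sqrt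
    calc _ ≤ ((axisQuad (A₀.image (isoEmb j i)) K).card + 4 * A₀.card ^ 2) *
          ((A₀.card : ℝ) * Fintype.card k) := by gcongr
      _ = _ := by ring
  linarith

end Rotated

section BadQuad
variable {F : Type*} [Field F]

open Classical in
lemma card_richTrace_le {A : Finset (F × F)} {K s : ℕ}
    (hs : (A.image Prod.fst).card ≤ s) {S : Finset (F × F)} (hS : S ∈ richTraces A K) :
    S.card ≤ s := by

  refine le_trans ?_ hs
  obtain ⟨hSA, -, e, f, g, h, hdet, hSe⟩ := Finset.mem_filter.1 hS
  refine Finset.card_le_card_of_injOn Prod.fst (fun x hx => Finset.mem_coe.2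
    (Finset.mem_image_of_mem _ (Finset.mem_powerset.1 hSA hx))) fun x hx y hy hxy => ?_
  rw [Finset.mem_coe, hSe, Finset.mem_filter, onCurve] at hx hy
  refine Prod.ext hxy ?_
  have h1 := hx.2
  have h2 := hy.2
  rw [← hxy] at h2
  by_contra hne
  have h3 : e * x.1 + g = 0 := by
    apply (mul_eq_zero.1 (_ : (e * x.1 + g) * (x.2 - y.2) = 0)).resolve_right (sub_ne_zero.2 hne)
    linear_combination h1 - h2
  apply hdet
  have h4 : f * x.1 + h = 0 := by linear_combination h1 - x.2 * h3
  linear_combination f * h3 - e * h4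

open Classical in
/-- Pairs of pairs of points of `B`, the first one not good and having an axis through the
projection point of the second one. -/
noncomputable def badQuad (A B : Finset (F × F)) (K : ℕ) :
    Finset (((F × F) × (F × F)) × ((F × F) × (F × F))) :=
  ((B ×ˢ B) ×ˢ (B ×ˢ B)).filter fun q => (q.1.1.1 ≠ q.1.2.1 ∧ q.1.1.2 ≠ q.1.2.2 ∧
    ¬ IsGood A K q.1.1 q.1.2) ∧ isoD (q.2.2.1, q.2.1.2) q.1.1 = isoD (q.2.2.1, q.2.1.2) q.1.2

open Classical in
lemma card_badQuad_le {A B : Finset (F × F)} (hBA : B ⊆ A) (K M s : ℕ)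
    (hK : 4 * A.card ≤ K ^ 2) (hs : ∀ S ∈ richTraces A K, S.card ≤ s)
    (hM : ∀ O : F × F, ((B ×ˢ B).filter fun q => (q.2.1, q.1.2) = O).card ≤ M) :
    (badQuad A B K).card ≤ 4 * A.card ^ 3 + 6 * A.card * M * s := by
  have hI := sum_card_richTraces_le A K hK
  let T : F × F → Finset ((F × F) × (F × F)) := fun O =>
    (B ×ˢ B).filter fun q => (q.2.1, q.1.2) = O
  let P0 : Finset (((F × F) × (F × F)) × ((F × F) × (F × F))) :=
    (richTraces A K).biUnion fun S => (S ×ˢ S).biUnion fun q =>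
      (T (q.1.1, q.2.2) ∪ T (q.2.1, q.1.2)).image fun t => (q, t)
  let C1 : Finset (F × F) → F × F → F × F → Finset (F × F) := fun S a b =>
    if (S.filter fun c => isoD a c = isoD a b).card ≤ 2 then S.filter fun c => isoD a c = isoD a b
    else ∅
  let P1 : Finset (((F × F) × (F × F)) × ((F × F) × (F × F))) :=
    (richTraces A K).biUnion fun S => ((B ×ˢ B) ×ˢ S).biUnion fun q =>
      (C1 S (q.1.2.1, q.1.1.2) q.2).image fun c => ((q.2, c), q.1)
  let C2 : Finset (F × F) → Finset ((F × F) × (F × F)) := fun S =>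
    (B ×ˢ B).filter fun t => ∃ r : F, r ≠ 0 ∧ ∀ x ∈ S, isoD (t.2.1, t.1.2) x = r
  let P2 : Finset (((F × F) × (F × F)) × ((F × F) × (F × F))) :=
    (richTraces A K).biUnion fun S => (S ×ˢ S).biUnion fun q =>
      (C2 S).image fun t => (q, t)
  have hsub : badQuad A B K ⊆ P0 ∪ (P1 ∪ P2) := by
    rintro ⟨⟨b, c⟩, t⟩ hq
    simp only [badQuad, Finset.mem_filter] at hq
    obtain ⟨hq, ⟨h1, h2, hbad⟩, hD⟩ := hq
    obtain ⟨hbc, ht⟩ := Finset.mem_product.1 hq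
    obtain ⟨hb, hc⟩ := Finset.mem_product.1 hbc
    simp only at hb hc ht
    rw [IsGood] at hbad
    push Not at hbad
    obtain ⟨e, f, g, h, hdet, hbS, hcS, hlt⟩ := hbad h1 h2
    have hS : (A.filter fun x => onCurve e f g h x) ∈ richTraces A K := by
      refine Finset.mem_filter.2 ⟨Finset.mem_powerset.2 (Finset.filter_subset _ _), ?_, e, f, g,
        h, hdet, rfl⟩
      rw [← Set.ncard_coe_finset, Finset.coe_filter]
      exact hlt
    have hbS' := Finset.mem_filter.2 ⟨hBA hb, hbS⟩
    have hcS' := Finset.mem_filter.2 ⟨hBA hc, hcS⟩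
    generalize (A.filter fun x => onCurve e f g h x) = S at hS hbS' hcS'
    by_cases hr : isoD (t.2.1, t.1.2) b = 0
    · refine Finset.mem_union_left _ (Finset.mem_biUnion.2 ⟨S, hS, Finset.mem_biUnion.2
        ⟨(b, c), Finset.mem_product.2 ⟨hbS', hcS'⟩, Finset.mem_image_of_mem _ ?_⟩⟩)
      have hr' : isoD (t.2.1, t.1.2) c = 0 := by rw [← hD, hr]
      rw [isoD, mul_eq_zero, sub_eq_zero, sub_eq_zero] at hr hr'
      simp only at hr hr'
      rcases hr with hr | hr
      · have h3 : t.1.2 = c.2 := hr'.resolve_left fun h => h1 (hr.symm.trans h)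
        exact Finset.mem_union_left _ (Finset.mem_filter.2 ⟨ht, Prod.ext hr h3⟩)
      · have h3 : t.2.1 = c.1 := hr'.resolve_right fun h => h2 (hr.symm.trans h)
        exact Finset.mem_union_right _ (Finset.mem_filter.2 ⟨ht, Prod.ext h3 hr⟩)
    · refine Finset.mem_union_right _ ?_
      by_cases h2 : (S.filter fun c => isoD (t.2.1, t.1.2) c = isoD (t.2.1, t.1.2) b).card ≤ 2
      · refine Finset.mem_union_left _ ?_
        refine Finset.mem_biUnion.2 ⟨S, hS, Finset.mem_biUnion.2 ⟨(t, b),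
          Finset.mem_product.2 ⟨ht, hbS'⟩, Finset.mem_image.2 ⟨c, ?_, rfl⟩⟩⟩
        simp only [C1, if_pos h2]
        exact Finset.mem_filter.2 ⟨hcS', hD.symm⟩
      · refine Finset.mem_union_right _ ?_
        refine Finset.mem_biUnion.2 ⟨S, hS, Finset.mem_biUnion.2 ⟨(b, c),
          Finset.mem_product.2 ⟨hbS', hcS'⟩, Finset.mem_image.2 ⟨t, ?_, rfl⟩⟩⟩
        refine Finset.mem_filter.2 ⟨ht, isoD (t.2.1, t.1.2) b, hr, fun w hw => ?_⟩
        obtain ⟨x, y, z, hx, hy, hz, hxy, hxz, hyz⟩ := Finset.two_lt_card_iff.1 (not_le.1 h2)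
        simp only [Finset.mem_filter, isoD_eq_iff_onCurve] at hx hy hz
        rw [isoD_eq_iff_onCurve]
        exact richTraces_subset_of_three hS hxy hxz hyz hx.1 hy.1 hz.1 hx.2 hy.2 hz.2 hw
  have hSS : ∀ S ∈ richTraces A K, ∀ m, (S ×ˢ S).card * m ≤ S.card * (s * m) := fun S hS m => by
    rw [Finset.card_product, mul_assoc]
    exact Nat.mul_le_mul_left _ (Nat.mul_le_mul_right _ (hs S hS))
  have hP0 : P0.card ≤ (∑ S ∈ richTraces A K, S.card) * (s * (2 * M)) := by
    rw [Finset.sum_mul]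
    refine Finset.card_biUnion_le.trans (Finset.sum_le_sum fun S hS => ?_)
    refine (Finset.card_biUnion_le_card_mul _ _ (2 * M) fun q _ =>
      Finset.card_image_le.trans ?_).trans (hSS S hS _)
    rw [two_mul]
    exact (Finset.card_union_le _ _).trans (add_le_add (hM _) (hM _))
  have hP1 : P1.card ≤ A.card * A.card * (∑ S ∈ richTraces A K, S.card) * 2 := by
    rw [Finset.mul_sum, Finset.sum_mul]
    refine Finset.card_biUnion_le.trans (Finset.sum_le_sum fun S _ => ?_)
    refine (Finset.card_biUnion_le_card_mul _ _ 2 fun q _ =>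
      Finset.card_image_le.trans ?_).trans ?_
    · simp only [C1]
      split_ifs with h
      · exact h
      · simp
    · rw [Finset.card_product, Finset.card_product]
      have := Finset.card_le_card hBA
      gcongr
  have hP2 : P2.card ≤ (∑ S ∈ richTraces A K, S.card) * (s * M) := by
    rw [Finset.sum_mul]
    refine Finset.card_biUnion_le.trans (Finset.sum_le_sum fun S hS => ?_)
    have hSA : S ⊆ A := Finset.mem_powerset.1 (Finset.mem_filter.1 hS).1
    refine (Finset.card_biUnion_le_card_mul _ _ M fun q _ =>
      Finset.card_image_le.trans ?_).trans (hSS S hS _)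
    have hcard : 2 < S.card := by
      have h1 := (Finset.mem_filter.1 hS).2.1
      rcases A.eq_empty_or_nonempty with rfl | hne
      · rw [Finset.subset_empty.1 hSA] at h1; simp at h1
      · have : 0 < A.card := hne.card_pos
        have : 2 ≤ K := by nlinarith
        omega
    obtain ⟨x, y, z, hx, hy, hz, hxy, hxz, hyz⟩ := Finset.two_lt_card_iff.1 hcard
    rcases (C2 S).eq_empty_or_nonempty with h0 | ⟨t, ht⟩
    · rw [h0]; exact Nat.zero_le _
    · refine le_trans (Finset.card_le_card fun t' ht' => ?_) (hM (t.2.1, t.1.2))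
      obtain ⟨-, r, hr, h1⟩ := Finset.mem_filter.1 ht
      obtain ⟨ht', r', hr', h2⟩ := Finset.mem_filter.1 ht'
      exact Finset.mem_filter.2 ⟨ht', center_unique hr' hxy hxz hyz (h2 x hx) (h2 y hy)
        (h2 z hz) (h1 x hx) (h1 y hy) (h1 z hz)⟩
  have h1 := (Finset.card_le_card hsub).trans ((Finset.card_union_le _ _).trans
    (Nat.add_le_add_left (Finset.card_union_le _ _) _))
  generalize ∑ S ∈ richTraces A K, S.card = I at *
  calc _ ≤ _ := h1
    _ ≤ I * (s * (2 * M)) + (A.card * A.card * I * 2 + I * (s * M)) := by gcongr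
    _ = I * (3 * (s * M) + 2 * A.card ^ 2) := by ring
    _ ≤ (2 * A.card) * (3 * (s * M) + 2 * A.card ^ 2) := by gcongr
    _ = _ := by ring

end BadQuad

section Corners
variable {k : Type*} [Field k] [Fintype k]

lemma sum_univ_card_fiber_sq {α β : Type*} [DecidableEq β] [Fintype β] (P : Finset α)
    (f : α → β) :
    ∑ l, (P.filter fun x => f x = l).card ^ 2 =
      ((P ×ˢ P).filter fun q => f q.2 = f q.1).card := by
  rw [← sum_card_fiber_sq]
  refine (Finset.sum_subset (Finset.subset_univ _) fun l _ hl => ?_).symm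
  have h0 : (P.filter fun x => f x = l) = ∅ := by
    refine Finset.filter_eq_empty_iff.2 fun x hx h => hl ?_
    rw [← h]
    exact Finset.mem_image_of_mem f hx
  rw [h0, Finset.card_empty, zero_pow two_ne_zero]

open Classical in
/-- Pairs of points of `B` with both coordinates distinct. -/
noncomputable def skewPairs (B : Finset (k × k)) : Finset ((k × k) × (k × k)) :=
  (B ×ˢ B).filter fun q => q.1.1 ≠ q.2.1 ∧ q.1.2 ≠ q.2.2

/-- The projection point of a pair, with the slope of its axis. -/
def corner (q : (k × k) × (k × k)) : (k × k) × k := ((q.2.1, q.1.2), (axis q.1 q.2).1)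

open Classical in
lemma card_cross_le (s s' : k × k) (h : s ≠ s') (w : k) :
    (Finset.univ.filter fun μ : k × k =>
      (s.2 * μ.1 - s.1 * μ.2) - (s'.2 * μ.1 - s'.1 * μ.2) = w).card * Fintype.card k ≤
      Fintype.card (k × k) := by
  rw [Fintype.card_prod]
  refine Nat.mul_le_mul_right _ ?_
  rw [← Finset.card_univ]
  by_cases h2 : s.2 = s'.2
  · have h1 : s.1 - s'.1 ≠ 0 := sub_ne_zero.2 fun h1 => h (Prod.ext h1 h2)
    refine Finset.card_le_card_of_injOn Prod.fst (fun _ _ => Finset.mem_coe.2 (Finset.mem_univ _))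
      fun x hx y hy hxy => Prod.ext hxy (mul_left_cancel₀ h1 ?_)
    rw [Finset.mem_coe, Finset.mem_filter] at hx hy
    rw [hxy] at hx
    linear_combination hy.2 - hx.2
  · refine Finset.card_le_card_of_injOn Prod.snd (fun _ _ => Finset.mem_coe.2 (Finset.mem_univ _))
      fun x hx y hy hxy => Prod.ext (mul_left_cancel₀ (sub_ne_zero.2 h2) ?_) hxy
    rw [Finset.mem_coe, Finset.mem_filter] at hx hy
    rw [hxy] at hx
    linear_combination hx.2 - hy.2

open Classical in
lemma card_corner_energy_le (B : Finset (k × k)) :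
    ((((skewPairs B) ×ˢ (skewPairs B)).filter fun q => corner q.2 = corner q.1).card : ℝ) ≤
      B.card ^ 2 + (((B ×ˢ B).filter fun q => q.1.2 = q.2.2).card *
        ((B ×ˢ B).filter fun q => q.1.1 = q.2.1).card / Fintype.card k +
        Fintype.card k * √(((B ×ˢ B).filter fun q => q.1.2 = q.2.2).card *
          ((B ×ˢ B).filter fun q => q.1.1 = q.2.1).card)) := by
  set E := ((skewPairs B) ×ˢ (skewPairs B)).filter fun q => corner q.2 = corner q.1 with hE
  set X := (B ×ˢ B).filter fun q => q.1.2 = q.2.2 ∧ q.1 ≠ q.2 with hX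
  set Y := (B ×ˢ B).filter fun q => q.1.1 = q.2.1 ∧ q.1 ≠ q.2 with hY
  set ρ : (k × k) × (k × k) → (k × k) × k :=
    fun q => ((q.1.1, q.2.1), q.1.2 * (q.2.1 - q.1.1)) with hρ
  set σ : (k × k) × (k × k) → (k × k) × k :=
    fun q => ((q.1.2, q.2.2), q.1.1 * (q.2.2 - q.1.2)) with hσ
  set g : k × k → k × k → k := fun μ s => s.2 * μ.1 - s.1 * μ.2 with hg
  have hmem : ∀ x y x' y' : k × k, ((x, y), (x', y')) ∈ E → x ∈ B ∧ y ∈ B ∧ x' ∈ B ∧ y' ∈ B ∧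
      x.1 ≠ y.1 ∧ x.2 ≠ y.2 ∧ x'.1 ≠ y.1 ∧ x.2 ≠ y'.2 ∧ x'.2 = x.2 ∧ y'.1 = y.1 ∧
      (y.1 - x'.1) * (x.2 - y.2) = (y.1 - x.1) * (x.2 - y'.2) := by
    intro x y x' y' h
    simp only [hE, skewPairs, Finset.mem_filter, Finset.mem_product, corner, axis,
      Prod.mk.injEq] at h
    obtain ⟨⟨⟨⟨hx, hy⟩, h1, h2⟩, ⟨hx', hy'⟩, h1', h2'⟩, ⟨h3, h4⟩, h5⟩ := h
    rw [h3] at h1' h5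
    rw [h4] at h2' h5
    rw [div_eq_div_iff (sub_ne_zero.2 h2') (sub_ne_zero.2 h2)] at h5
    exact ⟨hx, hy, hx', hy', h1, h2, h1', h2', h4, h3, h5⟩
  have hρi : Set.InjOn ρ X := by
    rintro ⟨x, x'⟩ hx ⟨z, z'⟩ hz h
    rw [Finset.mem_coe, Finset.mem_filter] at hx hz
    simp only [hρ, Prod.mk.injEq] at h
    obtain ⟨⟨h1, h2⟩, h3⟩ := h
    have hne : x'.1 - x.1 ≠ 0 :=
      sub_ne_zero.2 fun h0 => hx.2.2 (Prod.ext h0.symm hx.2.1)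
    rw [← h1, ← h2] at h3
    have h4 := mul_right_cancel₀ hne h3
    exact Prod.ext (Prod.ext h1 h4) (Prod.ext h2 (hx.2.1.symm.trans (h4.trans hz.2.1)))
  have hσi : Set.InjOn σ Y := by
    rintro ⟨x, x'⟩ hx ⟨z, z'⟩ hz h
    rw [Finset.mem_coe, Finset.mem_filter] at hx hz
    simp only [hσ, Prod.mk.injEq] at h
    obtain ⟨⟨h1, h2⟩, h3⟩ := h
    have hne : x'.2 - x.2 ≠ 0 :=
      sub_ne_zero.2 fun h0 => hx.2.2 (Prod.ext hx.2.1 h0.symm)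
    rw [← h1, ← h2] at h3
    have h4 := mul_right_cancel₀ hne h3
    exact Prod.ext (Prod.ext h4 h1) (Prod.ext (hx.2.1.symm.trans (h4.trans hz.2.1)) h2)
  have e1 : (E.filter fun q => q.1.1 = q.2.1).card ≤ B.card ^ 2 := by
    rw [sq, ← Finset.card_product]
    refine Finset.card_le_card_of_injOn (fun q => q.1) ?_ ?_
    · rintro ⟨⟨x, y⟩, x', y'⟩ hq
      rw [Finset.mem_coe, Finset.mem_filter] at hq
      obtain ⟨hx, hy, -⟩ := hmem _ _ _ _ hq.1
      exact Finset.mem_coe.2 (Finset.mem_product.2 ⟨hx, hy⟩)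
    · rintro ⟨⟨x, y⟩, x', y'⟩ hq ⟨⟨z, w⟩, z', w'⟩ hq' h
      rw [Finset.mem_coe, Finset.mem_filter] at hq hq'
      simp only [Prod.mk.injEq] at h
      obtain ⟨rfl, rfl⟩ := h
      obtain ⟨hq, (rfl : x = x')⟩ := hq
      obtain ⟨hq', (rfl : x = z')⟩ := hq'
      obtain ⟨-, -, -, -, h1, -, -, -, -, h2, h3⟩ := hmem _ _ _ _ hq
      obtain ⟨-, -, -, -, -, -, -, -, -, h2', h3'⟩ := hmem _ _ _ _ hq'
      have : y' = w' := by
        refine Prod.ext (h2.trans h2'.symm) (mul_left_cancel₀ (sub_ne_zero.2 h1.symm) ?_)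
        linear_combination h3 - h3'
      rw [this]
  have e2 : (E.filter fun q => q.1.1 ≠ q.2.1).card ≤
      ∑ l ∈ Y.image σ, graphCount g (X.image ρ) l := by
    simp only [graphCount]
    rw [← Finset.card_sigma]
    refine Finset.card_le_card_of_injOn
      (fun q => ⟨σ (q.1.2, q.2.2), ρ (q.1.1, q.2.1)⟩) ?_ ?_
    · rintro ⟨⟨x, y⟩, x', y'⟩ hq
      rw [Finset.mem_coe, Finset.mem_filter] at hq
      obtain ⟨hx, hy, hx', hy', h1, h2, h3, h4, h5, h6, h7⟩ := hmem _ _ _ _ hq.1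
      rw [Finset.mem_coe, Finset.mem_sigma, Finset.mem_filter]
      have hne : x ≠ x' := hq.2
      have hne' : y ≠ y' := by
        rintro rfl
        refine hne (Prod.ext (mul_right_cancel₀ (sub_ne_zero.2 h2) ?_) h5.symm)
        linear_combination h7
      refine ⟨Finset.mem_image_of_mem σ (Finset.mem_filter.2
        ⟨Finset.mem_product.2 ⟨hy, hy'⟩, h6.symm, hne'⟩), Finset.mem_image_of_mem ρ
        (Finset.mem_filter.2 ⟨Finset.mem_product.2 ⟨hx, hx'⟩, h5.symm, hne⟩), ?_⟩
      simp only [hρ, hσ, hg]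
      linear_combination -h7
    · rintro ⟨⟨x, y⟩, x', y'⟩ hq ⟨⟨z, w⟩, z', w'⟩ hq' h
      rw [Finset.mem_coe, Finset.mem_filter] at hq hq'
      have key : ∀ x y x' y' : k × k, ((x, y), (x', y')) ∈ E → x ≠ x' →
          (x, x') ∈ (X : Set _) ∧ (y, y') ∈ (Y : Set _) := by
        intro x y x' y' hq hne
        obtain ⟨hx, hy, hx', hy', h1, h2, h3, h4, h5, h6, h7⟩ := hmem _ _ _ _ hq
        have hne' : y ≠ y' := by
          rintro rfl
          refine hne (Prod.ext (mul_right_cancel₀ (sub_ne_zero.2 h2) ?_) h5.symm)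
          linear_combination h7
        exact ⟨Finset.mem_coe.2 (Finset.mem_filter.2 ⟨Finset.mem_product.2 ⟨hx, hx'⟩, h5.symm,
          hne⟩), Finset.mem_coe.2 (Finset.mem_filter.2 ⟨Finset.mem_product.2 ⟨hy, hy'⟩, h6.symm,
          hne'⟩)⟩
      simp only [Sigma.mk.injEq, heq_eq_eq] at h
      have k1 := key _ _ _ _ hq.1 hq.2
      have k2 := key _ _ _ _ hq'.1 hq'.2
      have f1 := hσi k1.2 k2.2 h.1
      have f2 := hρi k1.1 k2.1 h.2
      simp only [Prod.mk.injEq] at f1 f2 ⊢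
      exact ⟨⟨f2.1, f1.1⟩, f2.2, f1.2⟩
  have hmain := sum_weight_mul_graphCount_le g (X.image ρ)
    (fun s s' hs w => card_cross_le s s' hs w) (Y.image σ) (fun _ => 1)
  simp only [one_mul, one_pow, Finset.sum_sub_distrib, Finset.sum_const, nsmul_eq_mul, mul_one,
    Finset.card_image_of_injOn hρi, Finset.card_image_of_injOn hσi, Fintype.card_prod] at hmain
  have hE' : (E.card : ℝ) = (E.filter fun q => q.1.1 = q.2.1).card +
      (E.filter fun q => q.1.1 ≠ q.2.1).card := by
    exact_mod_cast (Finset.card_filter_add_card_filter_not (s := E)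
      (fun q => q.1.1 = q.2.1)).symm
  have e1' : ((E.filter fun q => q.1.1 = q.2.1).card : ℝ) ≤ B.card ^ 2 := by exact_mod_cast e1
  have e2' : ((E.filter fun q => q.1.1 ≠ q.2.1).card : ℝ) ≤
      ∑ l ∈ Y.image σ, (graphCount g (X.image ρ) l : ℝ) := by exact_mod_cast e2
  have hXc : (X.card : ℝ) ≤ ((B ×ˢ B).filter fun q => q.1.2 = q.2.2).card := by
    rw [Nat.cast_le]
    refine Finset.card_le_card fun q hq => ?_
    rw [Finset.mem_filter] at hq ⊢
    exact ⟨hq.1, hq.2.1⟩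
  have hYc : (Y.card : ℝ) ≤ ((B ×ˢ B).filter fun q => q.1.1 = q.2.1).card := by
    rw [Nat.cast_le]
    refine Finset.card_le_card fun q hq => ?_
    rw [Finset.mem_filter] at hq ⊢
    exact ⟨hq.1, hq.2.1⟩
  have t1 : (Y.card : ℝ) * (X.card / Fintype.card k) ≤
      ((B ×ˢ B).filter fun q => q.1.2 = q.2.2).card *
        ((B ×ˢ B).filter fun q => q.1.1 = q.2.1).card / Fintype.card k := by
    rw [← mul_div_assoc, mul_comm]
    gcongr
  have t2 : √(Y.card : ℝ) * √(X.card * ((Fintype.card k * Fintype.card k : ℕ) : ℝ)) ≤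
      Fintype.card k * √(((B ×ˢ B).filter fun q => q.1.2 = q.2.2).card *
          ((B ×ˢ B).filter fun q => q.1.1 = q.2.1).card) := by
    rw [Nat.cast_mul, Real.sqrt_mul (Nat.cast_nonneg _), Real.sqrt_mul_self (Nat.cast_nonneg _),
      ← mul_assoc, mul_comm, ← Real.sqrt_mul (Nat.cast_nonneg _), mul_comm (Y.card : ℝ)]
    gcongr
  linarith

end Corners

section Corners
open Classical in
/-- The number of pairs of points of `B` with projection point `O`. -/
noncomputable def cornerWt {G : Type*} (B : Finset (G × G)) (O : G × G) : ℕ :=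
  ((B ×ˢ B).filter fun q => (q.2.1, q.1.2) = O).card

lemma sum_cornerWt {G : Type*} [Fintype G] (B : Finset (G × G)) : ∑ O, cornerWt B O = B.card ^ 2 := by
  classical
  rw [sq, ← Finset.card_product]
  exact (Finset.card_eq_sum_card_fiberwise (t := Finset.univ)
    fun _ _ => Finset.mem_coe.2 (Finset.mem_univ _)).symm

open Classical in
lemma sum_cornerWt_sq {G : Type*} [Fintype G] (B : Finset (G × G)) : ∑ O, cornerWt B O ^ 2 =
    ((B ×ˢ B).filter fun q => q.1.2 = q.2.2).card *
      ((B ×ˢ B).filter fun q => q.1.1 = q.2.1).card := by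
  rw [← Finset.card_product]
  refine (sum_univ_card_fiber_sq (B ×ˢ B) fun q => (q.2.1, q.1.2)).trans ?_
  refine Finset.card_bij' (fun q _ => ((q.1.1, q.2.1), (q.1.2, q.2.2)))
    (fun q _ => ((q.1.1, q.2.1), (q.1.2, q.2.2))) ?_ ?_ ?_ ?_
  · rintro ⟨⟨b, c⟩, b', c'⟩ h
    simp only [Finset.mem_filter, Finset.mem_product, Prod.mk.injEq] at h ⊢
    tauto
  · rintro ⟨⟨b, c⟩, b', c'⟩ h
    simp only [Finset.mem_filter, Finset.mem_product, Prod.mk.injEq] at h ⊢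
    tauto
  · intros; rfl
  · intros; rfl

variable {k : Type*} [Field k] [Fintype k]

open Classical in
/-- The number of skew pairs of points of `B` with a given projection point and slope. -/
noncomputable def cornerMult (B : Finset (k × k)) (c : (k × k) × k) : ℕ :=
  ((skewPairs B).filter fun q => corner q = c).card

lemma sum_cornerMult_slope (B : Finset (k × k)) (O : k × k) :
    cornerWt B O ≤ ∑ α, cornerMult B (O, α) + 2 * Fintype.card k := by
  classical
  have h1 : ∑ α, cornerMult B (O, α) = ((skewPairs B).filter fun q => (q.2.1, q.1.2) = O).card := by
    rw [Finset.card_eq_sum_card_fiberwise (f := fun q => (axis q.1 q.2).1) (t := Finset.univ)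
      fun _ _ => Finset.mem_coe.2 (Finset.mem_univ _)]
    refine Finset.sum_congr rfl fun α _ => ?_
    rw [cornerMult, Finset.filter_filter]
    congr 1
    refine Finset.filter_congr fun q _ => ?_
    rw [corner, Prod.mk.injEq]
  have e1 : ((B ×ˢ B).filter fun q => (q.2.1, q.1.2) = O ∧ q.1 = O).card ≤ Fintype.card k := by
    rw [← Finset.card_univ]
    refine Finset.card_le_card_of_injOn (fun q => q.2.2)
      (fun _ _ => Finset.mem_coe.2 (Finset.mem_univ _)) ?_
    rintro ⟨b, c⟩ h ⟨b', c'⟩ h' hc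
    rw [Finset.mem_coe, Finset.mem_filter] at h h'
    have f1 := congrArg Prod.fst h.2.1
    have f2 := congrArg Prod.fst h'.2.1
    exact Prod.ext (h.2.2.trans h'.2.2.symm) (Prod.ext (f1.trans f2.symm) hc)
  have e2 : ((B ×ˢ B).filter fun q => (q.2.1, q.1.2) = O ∧ q.2 = O).card ≤ Fintype.card k := by
    rw [← Finset.card_univ]
    refine Finset.card_le_card_of_injOn (fun q => q.1.1)
      (fun _ _ => Finset.mem_coe.2 (Finset.mem_univ _)) ?_
    rintro ⟨b, c⟩ h ⟨b', c'⟩ h' hc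
    rw [Finset.mem_coe, Finset.mem_filter] at h h'
    have f1 := congrArg Prod.snd h.2.1
    have f2 := congrArg Prod.snd h'.2.1
    exact Prod.ext (Prod.ext hc (f1.trans f2.symm)) (h.2.2.trans h'.2.2.symm)
  have hsub : ((B ×ˢ B).filter fun q => (q.2.1, q.1.2) = O) ⊆
      ((skewPairs B).filter fun q => (q.2.1, q.1.2) = O) ∪
      (((B ×ˢ B).filter fun q => (q.2.1, q.1.2) = O ∧ q.1 = O) ∪
        ((B ×ˢ B).filter fun q => (q.2.1, q.1.2) = O ∧ q.2 = O)) := by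
    rintro ⟨b, c⟩ h
    obtain ⟨hB, hO⟩ := Finset.mem_filter.1 h
    by_cases h1 : b.1 = c.1
    · refine Finset.mem_union_right _ (Finset.mem_union_left _ (Finset.mem_filter.2 ⟨hB, hO, ?_⟩))
      rw [← hO]
      exact Prod.ext h1 rfl
    · by_cases h2 : b.2 = c.2
      · refine Finset.mem_union_right _ (Finset.mem_union_right _
          (Finset.mem_filter.2 ⟨hB, hO, ?_⟩))
        rw [← hO]
        exact Prod.ext rfl h2.symm
      · exact Finset.mem_union_left _ (Finset.mem_filter.2 ⟨Finset.mem_filter.2 ⟨hB, h1, h2⟩, hO⟩)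
  rw [h1, cornerWt]
  refine (Finset.card_le_card hsub).trans ((Finset.card_union_le _ _).trans ?_)
  have := Finset.card_union_le ((B ×ˢ B).filter fun q => (q.2.1, q.1.2) = O ∧ q.1 = O)
    ((B ×ˢ B).filter fun q => (q.2.1, q.1.2) = O ∧ q.2 = O)
  omega

/-- The sum of `w` over the line `u = α v + β`. -/
def lineSum (w : k × k → ℝ) (l : k × k) : ℝ := ∑ v, w (l.1 * v + l.2, v)

lemma sum_line_points {M : Type*} [AddCommMonoid M] (f : (k × k) × k → M) :
    ∑ l : k × k, ∑ v, f ((l.1 * v + l.2, v), l.1) = ∑ c, f c := by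
  rw [← Fintype.sum_prod_type' (f := fun (l : k × k) v => f ((l.1 * v + l.2, v), l.1))]
  refine Fintype.sum_equiv
    ⟨fun x => ((x.1.1 * x.2 + x.1.2, x.2), x.1.1), fun c => ((c.2, c.1.1 - c.2 * c.1.2), c.1.2),
      fun x => ?_, fun c => ?_⟩ _ _ fun x => rfl
  · simp
  · simp

lemma sum_lineSum (w : k × k → ℝ) : ∑ l, lineSum w l = Fintype.card k * ∑ O, w O := by
  simp only [lineSum]
  rw [sum_line_points (fun c => w c.1), Fintype.sum_prod_type]
  simp [Finset.mul_sum]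

lemma sum_lineSum_mul_le (w w' : k × k → ℝ) (hw : ∀ O, 0 ≤ w O) (hw' : ∀ O, 0 ≤ w' O) :
    ∑ l, lineSum w l * lineSum w' l ≤
      Fintype.card k * ∑ O, w O * w' O + (∑ O, w O) * ∑ O, w' O := by
  classical
  have hT : ∀ v v' : k, v ≠ v' → ∑ l : k × k, w (l.1 * v + l.2, v) * w' (l.1 * v' + l.2, v') =
      ∑ z : k × k, w (z.1, v) * w' (z.2, v') := by
    intro v v' h
    have h0 := sub_ne_zero.2 h
    refine Fintype.sum_equiv ⟨fun l => (l.1 * v + l.2, l.1 * v' + l.2),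
      fun z => ((z.1 - z.2) / (v - v'), z.1 - (z.1 - z.2) / (v - v') * v), fun l => ?_,
      fun z => ?_⟩ _ _ fun l => rfl
    · have : (l.1 * v + l.2 - (l.1 * v' + l.2)) / (v - v') = l.1 := by
        rw [div_eq_iff h0]; ring
      refine Prod.ext this ?_
      simp only [this]; ring
    · refine Prod.ext ?_ ?_
      · simp
      · simp only; field_simp; ring
  have hle : ∀ v v' : k, ∑ l : k × k, w (l.1 * v + l.2, v) * w' (l.1 * v' + l.2, v') ≤
      (if v = v' then ∑ l : k × k, w (l.1 * v + l.2, v) * w' (l.1 * v + l.2, v) else 0) +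
        ∑ z : k × k, w (z.1, v) * w' (z.2, v') := by
    intro v v'
    split_ifs with h
    · subst h
      exact le_add_of_nonneg_right (Finset.sum_nonneg fun z _ => mul_nonneg (hw _) (hw' _))
    · rw [hT v v' h, zero_add]
  calc _ = ∑ v, ∑ v', ∑ l : k × k, w (l.1 * v + l.2, v) * w' (l.1 * v' + l.2, v') := by
        simp only [lineSum, Finset.sum_mul_sum]
        rw [Finset.sum_comm]
        exact Finset.sum_congr rfl fun v _ => Finset.sum_comm
    _ ≤ ∑ v, ∑ v', ((if v = v' then
          ∑ l : k × k, w (l.1 * v + l.2, v) * w' (l.1 * v + l.2, v) else 0) +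
        ∑ z : k × k, w (z.1, v) * w' (z.2, v')) :=
      Finset.sum_le_sum fun v _ => Finset.sum_le_sum fun v' _ => hle v v'
    _ = _ := by
      simp only [Finset.sum_add_distrib, Finset.sum_ite_eq, Finset.mem_univ, if_true]
      congr 1
      · rw [Finset.sum_comm, sum_line_points (fun c => w c.1 * w' c.1), Fintype.sum_prod_type]
        simp [Finset.mul_sum]
      · simp only [Fintype.sum_prod_type_right]
        rw [Finset.sum_mul_sum]
        refine Finset.sum_congr rfl fun v _ => Finset.sum_congr rfl fun v' _ => ?_
        rw [Finset.sum_mul_sum, Finset.sum_comm]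

end Corners

section Skew
variable {k : Type*}

lemma swap_mem_skewPairs {B : Finset (k × k)} {b c : k × k} (h : (b, c) ∈ skewPairs B) :
    (c, b) ∈ skewPairs B := by
  classical
  rw [skewPairs, Finset.mem_filter, Finset.mem_product] at h ⊢
  exact ⟨h.1.symm, h.2.1.symm, h.2.2.symm⟩

lemma snd_ne_of_mem_skewPairs {B : Finset (k × k)} {b c : k × k} (h : (b, c) ∈ skewPairs B) :
    b.2 ≠ c.2 := by
  classical exact (Finset.mem_filter.1 h).2.2

lemma fst_ne_of_mem_skewPairs {B : Finset (k × k)} {b c : k × k} (h : (b, c) ∈ skewPairs B) :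
    b.1 ≠ c.1 := by
  classical exact (Finset.mem_filter.1 h).2.1

end Skew

section Axes
variable {k : Type*} [Field k]

open Classical in
/-- The number of pairs in `P` with axis `l`. -/
noncomputable def axMult (P : Finset ((k × k) × (k × k))) (l : k × k) : ℕ :=
  (P.filter fun q => axis q.1 q.2 = l).card

lemma corner_eq_iff (q : (k × k) × (k × k)) (l : k × k) (v : k) :
    corner q = ((l.1 * v + l.2, v), l.1) ↔ q.1.2 = v ∧ axis q.1 q.2 = l := by
  have h := fst_eq_axis q.1 q.2
  simp only [corner, Prod.mk.injEq]
  constructor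
  · rintro ⟨⟨h1, h2⟩, h3⟩
    refine ⟨h2, Prod.ext h3 ?_⟩
    rw [h1, h3, h2] at h
    exact (add_left_cancel h).symm
  · rintro ⟨h1, h2⟩
    rw [h2, h1] at h
    exact ⟨⟨h, h1⟩, by rw [h2]⟩

lemma axis_swap {b c : k × k} (h : b.2 ≠ c.2) : axis c b = axis b c := by
  have e : (axis c b).1 = (axis b c).1 := by
    simp only [axis]
    rw [← neg_sub, ← neg_sub b.2, neg_div_neg_eq]
  refine Prod.ext e ?_
  have h1 := fst_eq_axis c b
  have h2 := fst_eq_axis' h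
  rw [e] at h1
  exact add_left_cancel (h1.symm.trans h2)

lemma corner_eq_of_axis {q q' : (k × k) × (k × k)} (h : axis q'.1 q'.2 = axis q.1 q.2)
    (h2 : q'.1.2 = q.1.2) : corner q' = corner q := by
  have h1 := (corner_eq_iff q (axis q.1 q.2) q.1.2).2 ⟨rfl, rfl⟩
  rw [h1]
  exact (corner_eq_iff _ _ _).2 ⟨h2, h⟩

open Classical in
lemma two_mul_cornerMult_le (B : Finset (k × k)) (l : k × k) (v : k) :
    2 * cornerMult B ((l.1 * v + l.2, v), l.1) ≤ axMult (skewPairs B) l := by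
  set X := (skewPairs B).filter fun q => corner q = ((l.1 * v + l.2, v), l.1) with hX
  have hmem : ∀ q ∈ X, q ∈ skewPairs B ∧ q.1.2 = v ∧ axis q.1 q.2 = l := by
    intro q hq
    rw [hX, Finset.mem_filter, corner_eq_iff] at hq
    exact hq
  have h1 : Disjoint X (X.image Prod.swap) := by
    rw [Finset.disjoint_left]
    intro q hq hq'
    obtain ⟨r, hr, rfl⟩ := Finset.mem_image.1 hq'
    exact snd_ne_of_mem_skewPairs (hmem _ hr).1 ((hmem _ hr).2.1.trans (hmem _ hq).2.1.symm)
  have h2 := Finset.card_union_of_disjoint h1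
  rw [Finset.card_image_of_injective _ Prod.swap_injective, ← two_mul] at h2
  rw [cornerMult, ← h2, axMult]
  refine Finset.card_le_card fun q hq => Finset.mem_filter.2 ?_
  rcases Finset.mem_union.1 hq with hq | hq
  · exact ⟨(hmem q hq).1, (hmem q hq).2.2⟩
  · obtain ⟨r, hr, rfl⟩ := Finset.mem_image.1 hq
    obtain ⟨h1, -, h3⟩ := hmem r hr
    exact ⟨swap_mem_skewPairs h1, (axis_swap (snd_ne_of_mem_skewPairs h1)).trans h3⟩

open Classical in
/-- Pairs of pairs in `P` with the same axis and no two points on a common isotropic line. -/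
noncomputable def freeEnergy (P : Finset ((k × k) × (k × k))) :
    Finset (((k × k) × (k × k)) × ((k × k) × (k × k))) :=
  (P ×ˢ P).filter fun z => axis z.2.1 z.2.2 = axis z.1.1 z.1.2 ∧ isoD z.1.1 z.2.1 ≠ 0 ∧
    isoD z.1.1 z.2.2 ≠ 0

open Classical in
lemma card_energy_le {B : Finset (k × k)} {P : Finset ((k × k) × (k × k))}
    (hP : P ⊆ skewPairs B) :
    ((P ×ˢ P).filter fun z => axis z.2.1 z.2.2 = axis z.1.1 z.1.2).card ≤
      (freeEnergy P).card + 4 *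
        (((skewPairs B) ×ˢ (skewPairs B)).filter fun z => corner z.2 = corner z.1).card := by
  set E := (P ×ˢ P).filter fun z => axis z.2.1 z.2.2 = axis z.1.1 z.1.2 with hE
  set C := ((skewPairs B) ×ˢ (skewPairs B)).filter fun z => corner z.2 = corner z.1 with hC
  let T : ((k × k) × (k × k)) × ((k × k) × (k × k)) →
    ((k × k) × (k × k)) × ((k × k) × (k × k)) := fun z => (z.1, z.2.swap)
  let T' : ((k × k) × (k × k)) × ((k × k) × (k × k)) →
    ((k × k) × (k × k)) × ((k × k) × (k × k)) := fun z => (z.1.swap, z.2)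
  have hsub : E ⊆ freeEnergy P ∪ ((C ∪ C.image T) ∪ (C.image T' ∪ C.image (T ∘ T'))) := by
    rintro ⟨⟨b, c⟩, b', c'⟩ hz
    obtain ⟨hz, hax⟩ := Finset.mem_filter.1 hz
    obtain ⟨h1, h2⟩ := Finset.mem_product.1 hz
    have s1 : (b, c) ∈ skewPairs B := hP h1
    have s2 : (b', c') ∈ skewPairs B := hP h2
    have n1 := snd_ne_of_mem_skewPairs s1
    have n2 := snd_ne_of_mem_skewPairs s2
    simp only at hax
    have hα := axis_fst_ne_zero (fst_ne_of_mem_skewPairs s1) n1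
    have a1 := axis_swap n1
    have a2 := axis_swap n2
    have hCm : ∀ q q', q ∈ skewPairs B → q' ∈ skewPairs B → axis q'.1 q'.2 = axis q.1 q.2 →
        q'.1.2 = q.1.2 → (q, q') ∈ C := fun q q' hq hq' h h' =>
      Finset.mem_filter.2 ⟨Finset.mem_product.2 ⟨hq, hq'⟩, corner_eq_of_axis h h'⟩
    by_cases d1 : isoD b b' = 0
    · refine Finset.mem_union_right _ ?_
      rw [isoD, mul_eq_zero, sub_eq_zero, sub_eq_zero] at d1
      rcases d1 with d | d
      · refine Finset.mem_union_right _ (Finset.mem_union_right _ (Finset.mem_image.2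
          ⟨((c, b), (c', b')), hCm _ _ (swap_mem_skewPairs s1) (swap_mem_skewPairs s2) ?_ ?_, rfl⟩))
        · simp only [a1, a2, hax]
        · have f1 := fst_eq_axis' n1
          have f2 := fst_eq_axis' n2
          rw [hax] at f2
          exact mul_left_cancel₀ hα (by linear_combination f1 - f2 - d)
      · exact Finset.mem_union_left _ (Finset.mem_union_left _ (hCm _ _ s1 s2 hax d.symm))
    · by_cases d2 : isoD b c' = 0
      · refine Finset.mem_union_right _ ?_
        rw [isoD, mul_eq_zero, sub_eq_zero, sub_eq_zero] at d2
        rcases d2 with d | d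
        · refine Finset.mem_union_right _ (Finset.mem_union_left _ (Finset.mem_image.2
            ⟨((c, b), (b', c')), hCm _ _ (swap_mem_skewPairs s1) s2 ?_ ?_, rfl⟩))
          · simp only [a1, hax]
          · have f1 := fst_eq_axis' n1
            have f2 := fst_eq_axis b' c'
            rw [hax] at f2
            exact mul_left_cancel₀ hα (by linear_combination f1 - f2 - d)
        · refine Finset.mem_union_left _ (Finset.mem_union_right _ (Finset.mem_image.2
            ⟨((b, c), (c', b')), hCm _ _ s1 (swap_mem_skewPairs s2) ?_ d.symm, rfl⟩))
          simp only [a2, hax]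
      · exact Finset.mem_union_left _ (Finset.mem_filter.2 ⟨hz, hax, d1, d2⟩)
  have i1 := Finset.card_image_le (s := C) (f := T)
  have i2 := Finset.card_image_le (s := C) (f := T')
  have i3 := Finset.card_image_le (s := C) (f := T ∘ T')
  have u1 := Finset.card_union_le C (C.image T)
  have u2 := Finset.card_union_le (C.image T') (C.image (T ∘ T'))
  have u3 := Finset.card_union_le (C ∪ C.image T) (C.image T' ∪ C.image (T ∘ T'))
  have u4 := Finset.card_union_le (freeEnergy P)
    ((C ∪ C.image T) ∪ (C.image T' ∪ C.image (T ∘ T')))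
  have := Finset.card_le_card hsub
  omega

open Classical in
lemma axMult_add_sdiff {B : Finset (k × k)} {P : Finset ((k × k) × (k × k))}
    (hP : P ⊆ skewPairs B) (l : k × k) :
    axMult P l + axMult (skewPairs B \ P) l = axMult (skewPairs B) l := by
  rw [axMult, axMult, axMult, ← Finset.card_union_of_disjoint, ← Finset.filter_union,
    Finset.union_sdiff_of_subset hP]
  exact Finset.disjoint_filter_filter Finset.disjoint_sdiff

end Axes

section Variance
variable {k : Type*} [Field k] [Fintype k]

open Classical in
lemma two_mul_sum_cornerMult_mul_le (B : Finset (k × k)) :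
    2 * ∑ c : (k × k) × k, (cornerMult B c : ℝ) * cornerWt B c.1 ≤
      ∑ l, (axMult (skewPairs B) l : ℝ) * lineSum (fun O => cornerWt B O) l := by
  rw [← sum_line_points (fun c : (k × k) × k => (cornerMult B c : ℝ) * cornerWt B c.1),
    Finset.mul_sum]
  refine Finset.sum_le_sum fun l _ => ?_
  rw [lineSum, Finset.mul_sum, Finset.mul_sum]
  refine Finset.sum_le_sum fun v _ => ?_
  rw [← mul_assoc]
  gcongr
  exact_mod_cast two_mul_cornerMult_le B l v

lemma sum_cornerWt_sq_le (B : Finset (k × k)) :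
    ∑ O, (cornerWt B O : ℝ) ^ 2 ≤ ∑ c : (k × k) × k, (cornerMult B c : ℝ) * cornerWt B c.1 +
      2 * Fintype.card k * B.card ^ 2 := by
  have h : (∑ O, (cornerWt B O : ℝ)) = B.card ^ 2 := by exact_mod_cast sum_cornerWt B
  rw [Fintype.sum_prod_type (f := fun c : (k × k) × k => (cornerMult B c : ℝ) * cornerWt B c.1),
    ← h, Finset.mul_sum, ← Finset.sum_add_distrib]
  refine Finset.sum_le_sum fun O _ => ?_
  simp only
  rw [← Finset.sum_mul, ← add_mul, sq]
  gcongr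
  exact_mod_cast sum_cornerMult_slope B O

open Classical in
/-- Second moment of the axis multiplicities about twice their expected size. -/
lemma sum_sq_axMult_sub_le {B : Finset (k × k)} {P : Finset ((k × k) × (k × k))}
    (hP : P ⊆ skewPairs B) :
    ∑ l, ((axMult P l : ℝ) - 2 * (lineSum (fun O => cornerWt B O) l / Fintype.card k)) ^ 2 ≤
      (freeEnergy P).card + 20 * B.card ^ 2 + 4 * B.card ^ 4 / Fintype.card k ^ 2 +
        4 * Fintype.card k * √(∑ O, (cornerWt B O : ℝ) ^ 2) +
        4 / Fintype.card k *
          ∑ l, (axMult (skewPairs B \ P) l : ℝ) * lineSum (fun O => cornerWt B O) l := by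
  classical
  have hq : (0 : ℝ) < Fintype.card k := by exact_mod_cast Fintype.card_pos
  set q : ℝ := (Fintype.card k : ℝ) with hqdef
  set w : k × k → ℝ := fun O => cornerWt B O with hw
  have hW2 : (∑ O, w O ^ 2) = (((B ×ˢ B).filter fun q => q.1.2 = q.2.2).card : ℝ) *
      ((B ×ˢ B).filter fun q => q.1.1 = q.2.1).card := by
    simp only [hw]
    exact_mod_cast sum_cornerWt_sq B
  have h1 : (∑ l, (axMult P l : ℝ) ^ 2) ≤ (freeEnergy P).card + 4 *
      (((skewPairs B) ×ˢ (skewPairs B)).filter fun z => corner z.2 = corner z.1).card := by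
    simp only [axMult]
    exact_mod_cast (sum_univ_card_fiber_sq P fun z => axis z.1 z.2).trans_le (card_energy_le hP)
  have h2 := card_corner_energy_le B
  rw [← hW2] at h2
  have h3 := two_mul_sum_cornerMult_mul_le B
  have h4 := sum_cornerWt_sq_le B
  have h5 := sum_lineSum_mul_le w w (fun _ => Nat.cast_nonneg _) fun _ => Nat.cast_nonneg _
  have hs : (∑ O, w O) = (B.card : ℝ) ^ 2 := by
    simp only [hw]
    exact_mod_cast sum_cornerWt B
  simp only [← sq] at h5
  rw [hs] at h5
  have h6 : (∑ l, (axMult P l : ℝ) * lineSum w l) +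
      ∑ l, (axMult (skewPairs B \ P) l : ℝ) * lineSum w l =
      ∑ l, (axMult (skewPairs B) l : ℝ) * lineSum w l := by
    rw [← Finset.sum_add_distrib]
    refine Finset.sum_congr rfl fun l _ => ?_
    rw [← add_mul, ← Nat.cast_add]
    congr 2
    convert axMult_add_sdiff hP l
  have h7 : ∑ l, ((axMult P l : ℝ) - 2 * (lineSum w l / q)) ^ 2 = (∑ l, (axMult P l : ℝ) ^ 2) -
      4 / q * (∑ l, (axMult P l : ℝ) * lineSum w l) + 4 / q ^ 2 * ∑ l, lineSum w l ^ 2 := by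
    rw [Finset.mul_sum, Finset.mul_sum, ← Finset.sum_sub_distrib, ← Finset.sum_add_distrib]
    refine Finset.sum_congr rfl fun l _ => ?_
    field_simp
    ring
  rw [h7]
  generalize (∑ l, (axMult P l : ℝ) * lineSum w l) = M1 at *
  generalize (∑ l, (axMult (skewPairs B \ P) l : ℝ) * lineSum w l) = M2 at *
  generalize (∑ l, (axMult (skewPairs B) l : ℝ) * lineSum w l) = M3 at *
  generalize (∑ l, lineSum w l ^ 2) = H at *
  generalize (∑ c : (k × k) × k, (cornerMult B c : ℝ) * cornerWt B c.1) = Y at *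
  change ∑ O, w O ^ 2 ≤ _ at h4
  generalize (∑ O, w O ^ 2) = Z at *
  have a1 : 4 / q ^ 2 * H ≤ 4 / q ^ 2 * (q * Z + (B.card ^ 2) ^ 2) := by gcongr
  have a2 : 4 / q ^ 2 * (q * Z + (B.card ^ 2) ^ 2) = 4 * (Z / q) + 4 * B.card ^ 4 / q ^ 2 := by
    field_simp
  have a3 : 4 / q * (2 * (Z - 2 * q * B.card ^ 2)) ≤ 4 / q * (M1 + M2) := by
    gcongr; linarith
  have a4 : 4 / q * (2 * (Z - 2 * q * B.card ^ 2)) = 8 * (Z / q) - 16 * B.card ^ 2 := by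
    field_simp
    ring
  rw [mul_add] at a3
  linarith

end Variance

section Lines
variable {k : Type*} [Field k] [Fintype k]

open Classical in
lemma lineSum_card_fiber {τ : Type*} (T : Finset τ) (g : τ → k × k) (l : k × k) :
    lineSum (fun O => ((T.filter fun t => g t = O).card : ℝ)) l =
      ((T.filter fun t => (g t).1 = l.1 * (g t).2 + l.2).card : ℝ) := by
  rw [lineSum, Finset.card_eq_sum_card_fiberwise (f := fun t => (g t).2) (t := Finset.univ)
    fun _ _ => Finset.mem_coe.2 (Finset.mem_univ _)]
  push_cast
  refine Finset.sum_congr rfl fun v _ => ?_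
  rw [Finset.filter_filter]
  congr 2
  refine Finset.filter_congr fun t _ => ?_
  rw [Prod.ext_iff]
  constructor
  · rintro ⟨h1, h2⟩
    simp only at h1 h2
    exact ⟨by rw [h1, h2], h2⟩
  · rintro ⟨h1, h2⟩
    exact ⟨by rw [h1, h2], h2⟩

open Classical in
lemma card_incidence_axis {τ : Type*} (P : Finset ((k × k) × (k × k))) (T : Finset τ)
    (g : τ → k × k) :
    ((P ×ˢ T).filter fun z => (g z.2).1 = (axis z.1.1 z.1.2).1 * (g z.2).2 +
        (axis z.1.1 z.1.2).2).card =
      ∑ l, axMult P l * (T.filter fun t => (g t).1 = l.1 * (g t).2 + l.2).card := by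
  rw [Finset.card_eq_sum_card_fiberwise (f := fun z => axis z.1.1 z.1.2) (t := Finset.univ)
    fun _ _ => Finset.mem_coe.2 (Finset.mem_univ _)]
  refine Finset.sum_congr rfl fun l _ => ?_
  rw [axMult, ← Finset.card_product]
  congr 1
  ext ⟨z, t⟩
  simp only [Finset.mem_filter, Finset.mem_product]
  constructor
  · rintro ⟨⟨⟨h1, h2⟩, h3⟩, rfl⟩
    exact ⟨⟨h1, rfl⟩, h2, h3⟩
  · rintro ⟨⟨h1, rfl⟩, h2, h3⟩
    exact ⟨⟨⟨h1, h2⟩, h3⟩, rfl⟩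

open Classical in
lemma lineSum_cornerWt (B : Finset (k × k)) (l : k × k) :
    lineSum (fun O => (cornerWt B O : ℝ)) l =
      (((B ×ˢ B).filter fun t => t.2.1 = l.1 * t.1.2 + l.2).card : ℝ) := by
  have := lineSum_card_fiber (B ×ˢ B) (fun t => (t.2.1, t.1.2)) l
  simpa only [cornerWt] using this

open Classical in
lemma lineSum_indicator (A : Finset (k × k)) (l : k × k) :
    lineSum (fun O => if O ∈ A then 1 else 0) l = (onAxis A l : ℝ) := by
  rw [onAxis, ← lineSum_card_fiber A (fun a => a) l]
  congr 1
  funext O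
  rw [Finset.filter_eq']
  split_ifs <;> simp

/-- The number of incidences of the axes of `P` with `A`, compared with its expected value. -/
lemma sum_axMult_mul_onAxis_le {A B : Finset (k × k)} {P : Finset ((k × k) × (k × k))}
    (hBA : B ⊆ A) (hP : P ⊆ skewPairs B) :
    ∑ l, (axMult P l : ℝ) * onAxis A l ≤ A.card ^ 3 / Fintype.card k + 2 * A.card ^ 2 +
      √(∑ l, ((axMult P l : ℝ) - 2 * (lineSum (fun O => cornerWt B O) l / Fintype.card k)) ^ 2) *
        √(A.card * Fintype.card k) := by
  classical
  have hq : (0 : ℝ) < Fintype.card k := by exact_mod_cast Fintype.card_pos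
  have hNB : (B.card : ℝ) ≤ A.card := by exact_mod_cast Finset.card_le_card hBA
  set w : k × k → ℝ := fun O => cornerWt B O with hw
  have h1 := sum_weight_mul_onAxis_le A Finset.univ
    fun l => (axMult P l : ℝ) - 2 * (lineSum w l / Fintype.card k)
  have hs : (∑ O, w O) = (B.card : ℝ) ^ 2 := by
    simp only [hw]
    exact_mod_cast sum_cornerWt B
  have h2 := sum_lineSum_mul_le w (fun O => if O ∈ A then 1 else 0) (fun _ => Nat.cast_nonneg _)
    fun O => by positivity
  simp only [lineSum_indicator, hs] at h2
  have h3 : (∑ O, w O * if O ∈ A then 1 else 0) ≤ (B.card : ℝ) ^ 2 := by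
    rw [← hs]
    refine Finset.sum_le_sum fun O _ => ?_
    split_ifs
    · rw [mul_one]
    · rw [mul_zero]; exact Nat.cast_nonneg _
  have h4 : (∑ O, if O ∈ A then (1 : ℝ) else 0) = A.card := by simp
  have h5 := sum_lineSum w
  rw [hs] at h5
  have h6 : (∑ l, (axMult P l : ℝ)) ≤ B.card ^ 2 := by
    have : ∑ l, axMult P l ≤ B.card ^ 2 := by
      rw [sq, ← Finset.card_product]
      refine le_trans (le_of_eq ?_) (Finset.card_le_card (hP.trans (Finset.filter_subset _ _)))
      exact (Finset.card_eq_sum_card_fiberwise (t := Finset.univ)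
        fun _ _ => Finset.mem_coe.2 (Finset.mem_univ _)).symm
    exact_mod_cast this
  rw [h4] at h2
  set q : ℝ := (Fintype.card k : ℝ) with hqdef
  have h7 : (∑ l, ((axMult P l : ℝ) - 2 * (lineSum w l / q)) * ((onAxis A l : ℝ) - A.card / q)) =
      (∑ l, (axMult P l : ℝ) * onAxis A l) - A.card / q * (∑ l, (axMult P l : ℝ)) -
        2 / q * (∑ l, lineSum w l * onAxis A l) + 2 * A.card / q ^ 2 * ∑ l, lineSum w l := by
    simp only [Finset.mul_sum]
    rw [← Finset.sum_sub_distrib, ← Finset.sum_sub_distrib, ← Finset.sum_add_distrib]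
    refine Finset.sum_congr rfl fun l _ => ?_
    field_simp
    ring
  rw [h7, h5] at h1
  have h8 : 2 / q * (∑ l, lineSum w l * onAxis A l) ≤
      2 / q * (q * B.card ^ 2 + B.card ^ 2 * A.card) := by
    gcongr
    exact h2.trans (by gcongr)
  have h9 : 2 / q * (q * B.card ^ 2 + B.card ^ 2 * A.card) =
      2 * B.card ^ 2 + 2 * A.card / q ^ 2 * (q * B.card ^ 2) := by
    field_simp
  have h10 : (A.card : ℝ) / q * (∑ l, (axMult P l : ℝ)) ≤ A.card / q * A.card ^ 2 := by
    gcongr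
    exact h6.trans (by gcongr)
  have h11 : (A.card : ℝ) / q * A.card ^ 2 = A.card ^ 3 / q := by ring
  have h12 : (B.card : ℝ) ^ 2 ≤ A.card ^ 2 := by gcongr
  linarith

end Lines

section Fibers

open Classical in
lemma card_filter_eq_le {α β : Type*} {B : Finset α} {f : α → β} {L : ℕ}
    (h : ∀ b ∈ B, (B.filter fun y => f y = f b).card ≤ L) (x : β) :
    (B.filter fun y => f y = x).card ≤ L := by
  rcases (B.filter fun y => f y = x).eq_empty_or_nonempty with h0 | ⟨b, hb⟩
  · rw [h0]; exact Nat.zero_le _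
  · obtain ⟨hb', rfl⟩ := Finset.mem_filter.1 hb
    exact h b hb'

open Classical in
lemma card_pairs_filter_eq_le {α β : Type*} {B : Finset α} {f : α → β} {L : ℕ}
    (h : ∀ b ∈ B, (B.filter fun y => f y = f b).card ≤ L) :
    ((B ×ˢ B).filter fun q => f q.1 = f q.2).card ≤ B.card * L := by
  rw [Finset.card_eq_sum_card_fiberwise (f := Prod.fst) (t := B)
    fun q hq => (Finset.mem_product.1 (Finset.mem_filter.1 hq).1).1]
  refine (Finset.sum_le_card_nsmul _ _ L fun b hb => le_trans ?_ (h b hb)).trans_eq (smul_eq_mul _ _)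
  refine Finset.card_le_card_of_injOn Prod.snd ?_ ?_
  · rintro ⟨b', c⟩ hq
    simp only [Finset.mem_coe, Finset.mem_filter, Finset.mem_product] at hq ⊢
    exact ⟨hq.1.1.2, by rw [← hq.1.2, hq.2]⟩
  · rintro ⟨b', c⟩ hq ⟨b'', c'⟩ hq' hc
    simp only [Finset.mem_coe, Finset.mem_filter, Finset.mem_product] at hq hq'
    exact Prod.ext (hq.2.trans hq'.2.symm) hc

end Fibers

section BaseChange
variable {k F : Type*} [Field k] [Field F] (j : k →+* F)

lemma axis_map (b c : k × k) :
    axis (Prod.map j j b) (Prod.map j j c) = Prod.map j j (axis b c) := by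
  simp [axis]

lemma isoD_map (a b : k × k) : isoD (Prod.map j j a) (Prod.map j j b) = j (isoD a b) := by
  simp [isoD]

lemma isoD_map_eq_iff (a b c : k × k) :
    isoD (Prod.map j j a) (Prod.map j j b) = isoD (Prod.map j j a) (Prod.map j j c) ↔
      isoD a b = isoD a c := by
  rw [isoD_map, isoD_map, j.injective.eq_iff]

lemma prodMap_injective : Function.Injective (Prod.map j j) :=
  Function.Injective.prodMap j.injective j.injective

open Classical in
lemma prune_image_map (A : Finset (k × k)) (L : ℕ) :
    prune (A.image (Prod.map j j)) L = (prune A L).image (Prod.map j j) := by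
  rw [prune, Finset.filter_image, prune]
  congr 1
  refine Finset.filter_congr fun x _ => ?_
  rw [Finset.filter_image, Finset.filter_image,
    Finset.card_image_of_injective _ (prodMap_injective j),
    Finset.card_image_of_injective _ (prodMap_injective j)]
  simp only [Prod.map_fst, Prod.map_snd, j.injective.eq_iff]

open Classical in
/-- Skew pairs of points of `B` whose images are good. -/
noncomputable def goodPairs (A B : Finset (k × k)) (K : ℕ) : Finset ((k × k) × (k × k)) :=
  (skewPairs B).filter fun q =>
    IsGood (A.image (Prod.map j j)) K (Prod.map j j q.1) (Prod.map j j q.2)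

open Classical in
lemma card_freeEnergy_goodPairs_le {A B : Finset (k × k)} (hBA : B ⊆ A) (K : ℕ) :
    (freeEnergy (goodPairs j A B K)).card ≤ (axisQuad (A.image (Prod.map j j)) K).card := by
  refine Finset.card_le_card_of_injOn (fun z => ((Prod.map j j z.1.1, Prod.map j j z.2.1),
    (Prod.map j j z.1.2, Prod.map j j z.2.2))) ?_ ?_
  · rintro ⟨⟨b, c⟩, b', c'⟩ hz
    rw [Finset.mem_coe, freeEnergy, Finset.mem_filter, Finset.mem_product] at hz
    obtain ⟨⟨h1, h2⟩, hax, d1, d2⟩ := hz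
    obtain ⟨s1, g1⟩ := Finset.mem_filter.1 h1
    obtain ⟨s2, g2⟩ := Finset.mem_filter.1 h2
    obtain ⟨hb, hc⟩ := Finset.mem_product.1 (Finset.mem_filter.1 s1).1
    obtain ⟨hb', hc'⟩ := Finset.mem_product.1 (Finset.mem_filter.1 s2).1
    rw [Finset.mem_coe, axisQuad, Finset.mem_filter]
    simp only [Finset.mem_product]
    have hm := fun x (hx : x ∈ B) => Finset.mem_image_of_mem (Prod.map j j) (hBA hx)
    refine ⟨⟨⟨hm _ hb, hm _ hb'⟩, hm _ hc, hm _ hc'⟩, g1, g2,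
      (sameAxis_iff g1.1 g1.2.1 g2.2.1).2 ?_, ?_, ?_⟩
    · simp only at hax ⊢
      rw [axis_map, axis_map, hax]
    · simp only
      rw [isoD_map]
      exact (map_ne_zero j).2 d1
    · simp only
      rw [isoD_map]
      exact (map_ne_zero j).2 d2
  · rintro ⟨⟨b, c⟩, ⟨b', c'⟩⟩ - ⟨⟨b₁, c₁⟩, ⟨b₁', c₁'⟩⟩ - h
    have hJ := prodMap_injective j
    simp only [Prod.mk.injEq, hJ.eq_iff] at h
    obtain ⟨⟨rfl, rfl⟩, rfl, rfl⟩ := h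
    rfl

open Classical in
lemma card_goodTri_map_le [Fintype k] (A B : Finset (k × k)) (K : ℕ) :
    (goodTri (A.image (Prod.map j j)) (B.image (Prod.map j j)) K).card ≤
      ∑ l, axMult (goodPairs j A B K) l * onAxis A l := by
  refine le_trans ?_ (card_incidence_axis (goodPairs j A B K) A fun a => a).le
  refine (Finset.card_le_card (t := (((goodPairs j A B K) ×ˢ A).filter fun z => z.2.1 =
    (axis z.1.1 z.1.2).1 * z.2.2 + (axis z.1.1 z.1.2).2).image fun z =>
      (Prod.map j j z.2, Prod.map j j z.1.1, Prod.map j j z.1.2)) ?_).trans Finset.card_image_le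
  rintro ⟨a, b, c⟩ h
  simp only [goodTri, Finset.mem_filter, Finset.mem_product, Finset.mem_image] at h
  obtain ⟨⟨⟨a, ha, rfl⟩, ⟨b, hb, rfl⟩, ⟨c, hc, rfl⟩⟩, hD, hg⟩ := h
  rw [isoD_map_eq_iff] at hD
  have h1 : b.1 ≠ c.1 := fun h => hg.1 (congrArg j h)
  have h2 : b.2 ≠ c.2 := fun h => hg.2.1 (congrArg j h)
  refine Finset.mem_image.2 ⟨((b, c), a), Finset.mem_filter.2 ⟨Finset.mem_product.2
    ⟨Finset.mem_filter.2 ⟨Finset.mem_filter.2 ⟨Finset.mem_product.2 ⟨hb, hc⟩, h1, h2⟩, hg⟩, ha⟩,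
    (isoD_eq_iff_axis h2 a).1 hD⟩, rfl⟩

open Classical in
lemma sum_axMult_bad_le [Fintype k] (A B : Finset (k × k)) (K : ℕ) :
    ∑ l, (axMult (skewPairs B \ goodPairs j A B K) l : ℝ) *
        lineSum (fun O => (cornerWt B O : ℝ)) l ≤
      (badQuad (A.image (Prod.map j j)) (B.image (Prod.map j j)) K).card := by
  simp only [lineSum_cornerWt]
  have h := card_incidence_axis (skewPairs B \ goodPairs j A B K) (B ×ˢ B)
    fun t => (t.2.1, t.1.2)
  simp only at h
  refine le_trans (le_of_eq ?_) (Nat.cast_le.2 (h.symm.trans_le ?_))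
  · push_cast
    rfl
  · have hJ := prodMap_injective j
    refine Finset.card_le_card_of_injOn (Prod.map (Prod.map (Prod.map j j) (Prod.map j j))
      (Prod.map (Prod.map j j) (Prod.map j j))) ?_ ((hJ.prodMap hJ).prodMap (hJ.prodMap hJ)).injOn
    rintro ⟨⟨b, c⟩, x, y⟩ hz
    rw [Finset.mem_coe, Finset.mem_filter, Finset.mem_product, Finset.mem_sdiff,
      Finset.mem_product] at hz
    obtain ⟨⟨⟨s, hn⟩, hx, hy⟩, hax⟩ := hz
    obtain ⟨hbc, h1, h2⟩ := Finset.mem_filter.1 s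
    obtain ⟨hb, hc⟩ := Finset.mem_product.1 hbc
    have hm := fun x (hx : x ∈ B) => Finset.mem_image_of_mem (Prod.map j j) hx
    rw [Finset.mem_coe, badQuad, Finset.mem_filter]
    simp only [Finset.mem_product, Prod.map_apply]
    refine ⟨⟨⟨hm _ hb, hm _ hc⟩, hm _ hx, hm _ hy⟩, ⟨fun h => h1 (j.injective h),
      fun h => h2 (j.injective h), fun hg => hn (Finset.mem_filter.2 ⟨s, hg⟩)⟩, ?_⟩
    exact (isoD_map_eq_iff j (y.1, x.2) b c).2 ((isoD_eq_iff_axis h2 _).2 hax)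

end BaseChange

section BaseChange
variable {k F : Type*} [Field k] [Fintype k] [Field F] (j : k →+* F)

open Classical in
lemma card_filter_snd_image_map_le (B : Finset (k × k)) (y : F) :
    ((B.image (Prod.map j j)).filter fun x => x.2 = y).card ≤ Fintype.card k := by
  rw [← Finset.card_univ (α := k)]
  refine (Finset.card_le_card_of_injOn (t := Finset.univ.image j) Prod.fst ?_ ?_).trans
    Finset.card_image_le
  · intro x hx
    obtain ⟨b, -, rfl⟩ := Finset.mem_image.1 (Finset.mem_filter.1 hx).1
    exact Finset.mem_coe.2 (Finset.mem_image_of_mem _ (Finset.mem_univ _))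
  · intro x hx x' hx' h
    exact Prod.ext h ((Finset.mem_filter.1 hx).2.trans (Finset.mem_filter.1 hx').2.symm)

open Classical in
lemma card_badQuad_map_le (A : Finset (k × k)) (K L : ℕ) (hK : 4 * A.card ≤ K ^ 2) :
    (badQuad (A.image (Prod.map j j)) ((prune A L).image (Prod.map j j)) K).card ≤
      4 * A.card ^ 3 + 6 * A.card * (L * Fintype.card k) * Fintype.card k := by
  have hc := Finset.card_image_of_injective A (prodMap_injective j)
  have h := card_badQuad_le (A := A.image (Prod.map j j)) (B := (prune A L).image (Prod.map j j))
    (Finset.image_subset_image (prune_subset A L)) K (L * Fintype.card k) (Fintype.card k)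
    (by rwa [hc]) (fun S hS => card_richTrace_le (A := A.image (Prod.map j j)) ?_ hS) fun O => ?_
  · rwa [hc] at h
  · rw [← Finset.card_univ (α := k)]
    refine (Finset.card_le_card (t := Finset.univ.image j) fun x hx => ?_).trans
      Finset.card_image_le
    obtain ⟨y, hy, rfl⟩ := Finset.mem_image.1 hx
    obtain ⟨b, -, rfl⟩ := Finset.mem_image.1 hy
    exact Finset.mem_image_of_mem _ (Finset.mem_univ _)
  · set B' := (prune A L).image (Prod.map j j) with hB'
    have e1 : (B'.filter fun x => x.1 = O.1).card ≤ L :=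
      card_filter_eq_le (f := Prod.fst) (fun b hb => by
        rw [hB', ← prune_image_map] at hb ⊢
        exact (card_prune_le hb).1) O.1
    have e2 : (B'.filter fun x => x.2 = O.2).card ≤ Fintype.card k :=
      card_filter_snd_image_map_le j _ _
    refine le_trans (Finset.card_le_card (t := (B'.filter fun x => x.2 = O.2) ×ˢ
      (B'.filter fun x => x.1 = O.1)) fun q hq => ?_) ?_
    · obtain ⟨hm, rfl⟩ := Finset.mem_filter.1 hq
      obtain ⟨hb, hc⟩ := Finset.mem_product.1 hm
      exact Finset.mem_product.2 ⟨Finset.mem_filter.2 ⟨hb, rfl⟩, Finset.mem_filter.2 ⟨hc, rfl⟩⟩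
    · rw [Finset.card_product, mul_comm]
      exact Nat.mul_le_mul e1 e2

open Classical in
/-- The isosceles triangle count in isotropic coordinates over the ground field. -/
lemma card_isoTri_map_le (A : Finset (k × k)) (K L : ℕ) (hL : 0 < L)
    (hK : 4 * A.card ≤ K ^ 2) :
    ((isoTri (A.image (Prod.map j j))).card : ℝ) ≤
      A.card ^ 3 / Fintype.card k + 14 * A.card ^ 2 + 4 * A.card ^ 3 / L +
        √(Fintype.card k * A.card * ((axisQuad (A.image (Prod.map j j)) K).card +
          20 * A.card ^ 2 + 4 * A.card ^ 4 / Fintype.card k ^ 2 +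
          28 * (Fintype.card k * A.card * L) + 16 * A.card ^ 3 / Fintype.card k)) := by
  have hc := Finset.card_image_of_injective A (prodMap_injective j)
  have hq : (0 : ℝ) < Fintype.card k := by exact_mod_cast Fintype.card_pos
  have hL' : (0 : ℝ) < L := by exact_mod_cast hL
  have hBA := prune_subset A L
  have hNB : ((prune A L).card : ℝ) ≤ A.card := by exact_mod_cast Finset.card_le_card hBA
  have hP : goodPairs j A (prune A L) K ⊆ skewPairs (prune A L) := Finset.filter_subset _ _
  have h1 := card_isoTri_le_prune (A.image (Prod.map j j)) K L (by rwa [hc])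
  rw [prune_image_map, hc] at h1
  have h2 := card_goodTri_map_le j A (prune A L) K
  have h3 := sum_axMult_mul_onAxis_le hBA hP
  have h4 := sum_sq_axMult_sub_le hP
  have h5 := card_freeEnergy_goodPairs_le j hBA K
  have h6 := sum_axMult_bad_le j A (prune A L) K
  have h7 := card_badQuad_map_le j A K L hK
  have h8 : √(∑ O, (cornerWt (prune A L) O : ℝ) ^ 2) ≤ A.card * L := by
    apply Real.sqrt_le_iff.2 ⟨by positivity, ?_⟩
    have e1 := card_pairs_filter_eq_le (B := prune A L) (f := Prod.snd)
      fun b hb => (card_prune_le hb).2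
    have e2 := card_pairs_filter_eq_le (B := prune A L) (f := Prod.fst)
      fun b hb => (card_prune_le hb).1
    have e3 := (sum_cornerWt_sq (prune A L)).trans_le (Nat.mul_le_mul e1 e2)
    have e4 : (∑ O, (cornerWt (prune A L) O : ℝ) ^ 2) ≤
        ((prune A L).card * L) * ((prune A L).card * L) := by exact_mod_cast e3
    calc _ ≤ _ := e4
      _ ≤ (A.card * L) * (A.card * L) := by gcongr
      _ = _ := by ring
  have h1' : ((isoTri (A.image (Prod.map j j))).card : ℝ) ≤
      (goodTri (A.image (Prod.map j j)) ((prune A L).image (Prod.map j j)) K).card +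
        12 * A.card ^ 2 + 4 * A.card ^ 3 / L := by
    have e : (L : ℝ) * (isoTri (A.image (Prod.map j j))).card ≤ L *
        ((goodTri (A.image (Prod.map j j)) ((prune A L).image (Prod.map j j)) K).card +
          12 * A.card ^ 2) + 4 * A.card ^ 3 := by exact_mod_cast h1
    rw [← mul_le_mul_iff_right₀ hL']
    refine e.trans (le_of_eq ?_)
    field_simp
  have h2' : ((goodTri (A.image (Prod.map j j)) ((prune A L).image (Prod.map j j)) K).card : ℝ) ≤
      ∑ l, (axMult (goodPairs j A (prune A L) K) l : ℝ) * onAxis A l := by exact_mod_cast h2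
  have h5' : ((freeEnergy (goodPairs j A (prune A L) K)).card : ℝ) ≤
      (axisQuad (A.image (Prod.map j j)) K).card := by exact_mod_cast h5
  have h7' : ((badQuad (A.image (Prod.map j j)) ((prune A L).image (Prod.map j j)) K).card : ℝ) ≤
      4 * A.card ^ 3 + 6 * A.card * (L * Fintype.card k) * Fintype.card k := by exact_mod_cast h7
  have h9 := h6.trans h7'
  set q : ℝ := (Fintype.card k : ℝ) with hqdef
  have h10 : 4 / q * (∑ l, (axMult (skewPairs (prune A L) \ goodPairs j A (prune A L) K) l : ℝ) *
      lineSum (fun O => (cornerWt (prune A L) O : ℝ)) l) ≤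
      4 / q * (4 * A.card ^ 3 + 6 * A.card * (L * q) * q) := by gcongr
  have h11 : 4 / q * (4 * (A.card : ℝ) ^ 3 + 6 * A.card * (L * q) * q) =
      16 * A.card ^ 3 / q + 24 * (q * A.card * L) := by field_simp; ring
  have h12 : 4 * q * √(∑ O, (cornerWt (prune A L) O : ℝ) ^ 2) ≤ 4 * q * (A.card * L) := by gcongr
  have h13 : 20 * ((prune A L).card : ℝ) ^ 2 ≤ 20 * A.card ^ 2 := by gcongr
  have h14 : 4 * ((prune A L).card : ℝ) ^ 4 / q ^ 2 ≤ 4 * A.card ^ 4 / q ^ 2 := by gcongr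
  have h15 : ∑ l, ((axMult (goodPairs j A (prune A L) K) l : ℝ) -
      2 * (lineSum (fun O => (cornerWt (prune A L) O : ℝ)) l / q)) ^ 2 ≤
      (axisQuad (A.image (Prod.map j j)) K).card +
          20 * A.card ^ 2 + 4 * A.card ^ 4 / q ^ 2 +
          28 * (q * A.card * L) + 16 * A.card ^ 3 / q := by linarith
  have h16 : √(∑ l, ((axMult (goodPairs j A (prune A L) K) l : ℝ) -
      2 * (lineSum (fun O => (cornerWt (prune A L) O : ℝ)) l / q)) ^ 2) * √(A.card * q) ≤
      √(q * A.card * ((axisQuad (A.image (Prod.map j j)) K).card +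
          20 * A.card ^ 2 + 4 * A.card ^ 4 / q ^ 2 +
          28 * (q * A.card * L) + 16 * A.card ^ 3 / q)) := by
    rw [mul_comm, mul_comm q, ← Real.sqrt_mul (by positivity)]
    apply Real.sqrt_le_sqrt
    gcongr
    linarith
  linarith

end BaseChange

section Numeric

/-- Solving the self-improving inequality for the number of triangles. -/
lemma excess_le_of_self_bound {a b T Q K L : ℝ} (ha : 1 ≤ a) (hab : a ≤ b) (hba : b ^ 3 ≤ a ^ 4)
    (hT0 : 0 ≤ T) (hK : K ≤ 4 * b ^ 6) (hL1 : b ^ 16 / a ^ 8 ≤ L) (hL2 : L ≤ 2 * (b ^ 16 / a ^ 8))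
    (hQ : Q ≤ 10 ^ 9 * (b ^ 12 * √(b ^ 12 * (T + b ^ 24)) + K * b ^ 24))
    (hT : T ≤ b ^ 36 / a ^ 12 + 14 * b ^ 24 + 4 * b ^ 36 / L +
      √(a ^ 12 * b ^ 12 * (Q + 20 * b ^ 24 + 4 * b ^ 48 / a ^ 24 + 28 * (a ^ 12 * b ^ 12 * L) +
        16 * b ^ 36 / a ^ 12))) :
    T - b ^ 36 / a ^ 12 ≤ 10 ^ 7 * (a ^ 8 * b ^ 20 + a ^ 3 * b ^ 24) := by
  have ha0 : 0 < a := by linarith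
  have hb1 : 1 ≤ b := ha.trans hab
  have hb0 : 0 < b := by linarith
  have hLpos : 0 < L := lt_of_lt_of_le (by positivity) hL1
  set u := a ^ 8 * b ^ 20 with hu
  set v := a ^ 3 * b ^ 24 with hv
  have hu0 : 0 < u := by positivity
  have hv0 : 0 < v := by positivity
  by_contra! hlt
  set D := T - b ^ 36 / a ^ 12 with hD
  have hD0 : 0 < D := lt_trans (by positivity) hlt
  have hbv : b ^ 24 ≤ v := le_mul_of_one_le_left (by positivity) (one_le_pow₀ ha)
  have t1 : 4 * b ^ 36 / L ≤ 4 * u := by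
    rw [div_le_iff₀ hLpos]
    calc 4 * b ^ 36 = 4 * u * (b ^ 16 / a ^ 8) := by rw [hu]; field_simp
      _ ≤ _ := by gcongr
  have hroot : D / 2 ≤ √(a ^ 12 * b ^ 12 * (Q + 20 * b ^ 24 + 4 * b ^ 48 / a ^ 24 +
      28 * (a ^ 12 * b ^ 12 * L) + 16 * b ^ 36 / a ^ 12)) := by
    linarith
  have hsq := (Real.le_sqrt' (by positivity)).1 hroot
  have e1 : a ^ 12 * b ^ 12 * (20 * b ^ 24) ≤ 20 * v ^ 2 := by
    calc _ = 20 * (a ^ 12 * b ^ 36) := by ring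
      _ ≤ 20 * (b ^ 12 * b ^ 36) := by gcongr
      _ = 20 * (b ^ 24) ^ 2 := by ring
      _ ≤ _ := by gcongr
  have e2 : a ^ 12 * b ^ 12 * (4 * b ^ 48 / a ^ 24) ≤ 4 * v ^ 2 := by
    have h6 : (b ^ 3) ^ 4 ≤ (a ^ 4) ^ 4 := by gcongr
    have h7 : a ^ 16 ≤ a ^ 18 := pow_le_pow_right₀ ha (by norm_num)
    have h8 : b ^ 12 ≤ a ^ 18 := by nlinarith
    calc _ = 4 * (b ^ 12 / a ^ 12 * b ^ 48) := by field_simp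
      _ ≤ 4 * (a ^ 18 / a ^ 12 * b ^ 48) := by gcongr
      _ = _ := by rw [hv]; field_simp
  have e3 : a ^ 12 * b ^ 12 * (28 * (a ^ 12 * b ^ 12 * L)) ≤ 56 * u ^ 2 := by
    calc _ ≤ a ^ 12 * b ^ 12 * (28 * (a ^ 12 * b ^ 12 * (2 * (b ^ 16 / a ^ 8)))) := by gcongr
      _ = _ := by rw [hu]; field_simp; ring
  have e4 : a ^ 12 * b ^ 12 * (16 * b ^ 36 / a ^ 12) ≤ 16 * v ^ 2 := by
    calc _ = 16 * (b ^ 24) ^ 2 := by field_simp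
      _ ≤ _ := by gcongr
  have e5 : a ^ 12 * b ^ 12 * (10 ^ 9 * (K * b ^ 24)) ≤ 4 * 10 ^ 9 * v ^ 2 := by
    calc _ ≤ a ^ 12 * b ^ 12 * (10 ^ 9 * (4 * b ^ 6 * b ^ 24)) := by gcongr
      _ = 4 * 10 ^ 9 * (a ^ 6 * a ^ 6 * b ^ 42) := by ring
      _ ≤ 4 * 10 ^ 9 * (a ^ 6 * b ^ 6 * b ^ 42) := by gcongr
      _ = _ := by rw [hv]; ring
  set M := a ^ 12 * b ^ 12 * (10 ^ 9 * (b ^ 12 * √(b ^ 12 * (T + b ^ 24)))) with hM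
  have hM2 : M ^ 2 ≤ 10 ^ 18 * (2 * v ^ 4 + u ^ 3 * D) := by
    have h1 : b ^ 24 ≤ b ^ 36 / a ^ 12 := by
      rw [le_div_iff₀ (by positivity)]
      calc b ^ 24 * a ^ 12 ≤ b ^ 24 * b ^ 12 := by gcongr
        _ = _ := by ring
    have h2 : T + b ^ 24 ≤ 2 * (b ^ 36 / a ^ 12) + D := by linarith
    calc M ^ 2 = a ^ 24 * b ^ 48 * 10 ^ 18 * √(b ^ 12 * (T + b ^ 24)) ^ 2 := by rw [hM]; ring
      _ = a ^ 24 * b ^ 48 * 10 ^ 18 * (b ^ 12 * (T + b ^ 24)) := by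
        rw [Real.sq_sqrt (by positivity)]
      _ ≤ a ^ 24 * b ^ 48 * 10 ^ 18 * (b ^ 12 * (2 * (b ^ 36 / a ^ 12) + D)) := by gcongr
      _ = _ := by rw [hu, hv]; field_simp
  have hM0 : 0 ≤ M := by positivity
  have hQ' : a ^ 12 * b ^ 12 * Q ≤ M + a ^ 12 * b ^ 12 * (10 ^ 9 * (K * b ^ 24)) := by
    calc _ ≤ a ^ 12 * b ^ 12 * (10 ^ 9 * (b ^ 12 * √(b ^ 12 * (T + b ^ 24)) + K * b ^ 24)) := by
          gcongr
      _ = _ := by rw [hM]; ring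
  have hu' : u ≤ D / 10 ^ 7 := by rw [le_div_iff₀ (by norm_num)]; linarith
  have hv' : v ≤ D / 10 ^ 7 := by rw [le_div_iff₀ (by norm_num)]; linarith
  have hu2 : u ^ 2 ≤ (D / 10 ^ 7) ^ 2 := by gcongr
  have hv2 : v ^ 2 ≤ (D / 10 ^ 7) ^ 2 := by gcongr
  have hu3 : u ^ 3 * D ≤ (D / 10 ^ 7) ^ 3 * D := by gcongr
  have hv4 : v ^ 4 ≤ (D / 10 ^ 7) ^ 4 := by gcongr
  have hM3 : M ≤ D ^ 2 / 16 := by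
    refine le_of_sq_le_sq ?_ (by positivity)
    have : 0 < D ^ 4 := by positivity
    calc M ^ 2 ≤ _ := hM2
      _ ≤ 10 ^ 18 * (2 * (D / 10 ^ 7) ^ 4 + (D / 10 ^ 7) ^ 3 * D) := by linarith
      _ = (2 / 10 ^ 10 + 1 / 10 ^ 3) * D ^ 4 := by ring
      _ ≤ 1 / 256 * D ^ 4 := by gcongr; norm_num
      _ = _ := by ring
  have hD2 : 0 < D ^ 2 := by positivity
  have hexp : a ^ 12 * b ^ 12 * (Q + 20 * b ^ 24 + 4 * b ^ 48 / a ^ 24 +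
      28 * (a ^ 12 * b ^ 12 * L) + 16 * b ^ 36 / a ^ 12) = a ^ 12 * b ^ 12 * Q +
      a ^ 12 * b ^ 12 * (20 * b ^ 24) + a ^ 12 * b ^ 12 * (4 * b ^ 48 / a ^ 24) +
      a ^ 12 * b ^ 12 * (28 * (a ^ 12 * b ^ 12 * L)) +
      a ^ 12 * b ^ 12 * (16 * b ^ 36 / a ^ 12) := by ring
  rw [hexp] at hsq
  have hz : (D / 10 ^ 7) ^ 2 = D ^ 2 / 10 ^ 14 := by ring
  have hz2 : (D / 2) ^ 2 = D ^ 2 / 4 := by ring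
  rw [hz] at hu2 hv2
  rw [hz2] at hsq
  linarith

end Numeric

section Transfer

open Classical in
lemma Tstar_le_card_isoTri {k F : Type*} [Field k] [Field F] {j : k →+* F} {i : F}
    (hi : i ^ 2 = -1) (hinj : Function.Injective (isoEmb j i)) (A : Finset (k × k)) :
    Tstar A ≤ (isoTri (A.image (isoEmb j i))).card := by
  rw [Tstar, ← Set.ncard_coe_finset]
  refine Set.ncard_le_ncard_of_injOn (fun t => (isoEmb j i t.1, isoEmb j i t.2.1, isoEmb j i t.2.2))
    ?_ ?_ (Finset.finite_toSet _)
  · rintro ⟨a, b, c⟩ ⟨ha, hb, hc, hd, hne⟩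
    simp only at ha hb hc hd hne
    have hm := fun x (hx : x ∈ A) => Finset.mem_image_of_mem (isoEmb j i) hx
    have h0 : isoD (isoEmb j i b) (isoEmb j i c) ≠ 0 := by
      rw [isoD_isoEmb hi]
      refine (map_ne_zero j).2 fun h => hne ?_
      simp only [dot, dist2, Prod.fst_sub, Prod.snd_sub] at h ⊢
      linear_combination h
    rw [isoD, mul_ne_zero_iff, sub_ne_zero, sub_ne_zero] at h0
    rw [Finset.mem_coe, isoTri, Finset.mem_filter]
    simp only [Finset.mem_product]
    refine ⟨⟨hm _ ha, hm _ hb, hm _ hc⟩, ?_, h0.1, h0.2⟩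
    rw [isoD_isoEmb hi, isoD_isoEmb hi, hd]
  · rintro ⟨a, b, c⟩ - ⟨a', b', c'⟩ - h
    simp only [Prod.mk.injEq, hinj.eq_iff] at h
    obtain ⟨rfl, rfl, rfl⟩ := h
    rfl

lemma Tstar_le_card_pow {F : Type*} [CommRing F] (A : Finset (F × F)) : Tstar A ≤ A.card ^ 3 := by
  classical
  have h : Tstar A ≤ (A ×ˢ A ×ˢ A).card := by
    rw [Tstar, ← Set.ncard_coe_finset]
    refine Set.ncard_le_ncard ?_ (Finset.finite_toSet _)
    rintro ⟨a, b, c⟩ ⟨ha, hb, hc, -⟩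
    exact Finset.mem_coe.2 (Finset.mem_product.2 ⟨ha, Finset.mem_product.2 ⟨hb, hc⟩⟩)
  rw [Finset.card_product, Finset.card_product] at h
  exact h.trans_eq (by ring)

lemma isoEmb_injective_of_two_ne_zero {k F : Type*} [Field k] [Field F] {j : k →+* F} {i : F}
    (hi : i ^ 2 = -1) (h2 : (2 : k) ≠ 0) : Function.Injective (isoEmb j i) := by
  have h2' : (2 : F) ≠ 0 := by
    rw [← map_ofNat j 2]
    exact (map_ne_zero j).2 h2
  have hi0 : i ≠ 0 := by
    rintro rfl
    simp at hi
  intro x y h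
  have e1 := congrArg Prod.fst h
  have e2 := congrArg Prod.snd h
  simp only [isoEmb] at e1 e2
  refine Prod.ext (j.injective (mul_left_cancel₀ h2' ?_))
    (j.injective (mul_left_cancel₀ (mul_ne_zero h2' hi0) ?_))
  · linear_combination e1 + e2
  · linear_combination e1 - e2

open Classical in
/-- The triangle count in isotropic coordinates over an extension of a finite field. -/
lemma card_isoTri_isoEmb_le_of_finite {k F : Type*} [Field k] [Fintype k] [Field F] {j : k →+* F}
    {i : F} (hi : i ^ 2 = -1) (h2 : (2 : k) ≠ 0) (A : Finset (k × k)) (K L : ℕ) (hL : 0 < L)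
    (hK : 4 * A.card ≤ K ^ 2) :
    ((isoTri (A.image (isoEmb j i))).card : ℝ) ≤
      A.card ^ 3 / Fintype.card k + 14 * A.card ^ 2 + 4 * A.card ^ 3 / L +
        √(Fintype.card k * A.card * ((axisQuad (A.image (isoEmb j i)) K).card +
          20 * A.card ^ 2 + 4 * A.card ^ 4 / Fintype.card k ^ 2 +
          28 * (Fintype.card k * A.card * L) + 16 * A.card ^ 3 / Fintype.card k)) := by
  by_cases hij : i ∈ Set.range j
  · obtain ⟨r, rfl⟩ := hij
    have hr : r ^ 2 = -1 := j.injective (by rw [map_pow, hi, map_neg, map_one])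
    have hinj := isoEmb_injective_of_two_ne_zero (j := RingHom.id k) hr h2
    have himg : A.image (isoEmb j (j r)) =
        (A.image (isoEmb (RingHom.id k) r)).image (Prod.map j j) := by
      rw [Finset.image_image]
      congr 1
      funext x
      simp [isoEmb]
    have hc := Finset.card_image_of_injective A hinj
    have h := card_isoTri_map_le j (A.image (isoEmb (RingHom.id k) r)) K L hL (by rwa [hc])
    rwa [← himg, hc] at h
  · have h := card_isoTri_isoEmb_le hi hij h2 A K hK
    have h1 : √(Fintype.card k * A.card *
          ((axisQuad (A.image (isoEmb j i)) K).card + 4 * (A.card : ℝ) ^ 2)) ≤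
        √(Fintype.card k * A.card * ((axisQuad (A.image (isoEmb j i)) K).card +
          20 * A.card ^ 2 + 4 * A.card ^ 4 / Fintype.card k ^ 2 +
          28 * (Fintype.card k * A.card * L) + 16 * A.card ^ 3 / Fintype.card k)) := by
      apply Real.sqrt_le_sqrt
      refine mul_le_mul_of_nonneg_left ?_ (by positivity)
      have g1 : (0 : ℝ) ≤ 4 * A.card ^ 4 / Fintype.card k ^ 2 := by positivity
      have g2 : (0 : ℝ) ≤ 28 * (Fintype.card k * A.card * L) := by positivity
      have g3 : (0 : ℝ) ≤ 16 * A.card ^ 3 / Fintype.card k := by positivity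
      have g4 : (0 : ℝ) ≤ (A.card : ℝ) ^ 2 := by positivity
      linarith
    have h3 : (0 : ℝ) ≤ 4 * A.card ^ 3 / L := by positivity
    have h4 : (0 : ℝ) ≤ (A.card : ℝ) ^ 2 := by positivity
    linarith

lemma Tstar_sub_le_of_odd {p : ℕ} (hp : p.Prime) (hp2 : p ≠ 2) (A : Finset (ZMod p × ZMod p))
    {a b : ℝ} (ha : 1 ≤ a) (hb : 1 ≤ b) (hpa : (p : ℝ) = a ^ 12) (hAb : (A.card : ℝ) = b ^ 12)
    (hba : b ^ 3 ≤ a ^ 4) :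
    (Tstar A : ℝ) - b ^ 36 / a ^ 12 ≤ 10 ^ 7 * min (a ^ 8 * b ^ 20 + a ^ 3 * b ^ 24) (b ^ 28) := by
  classical
  have := Fact.mk hp
  let F := AlgebraicClosure (ZMod p)
  have : CharP F p := charP_of_injective_algebraMap (algebraMap (ZMod p) F).injective p
  have : Infinite F := IsAlgClosed.instInfinite
  let j : ZMod p →+* F := algebraMap (ZMod p) F
  obtain ⟨i, hi⟩ := IsAlgClosed.exists_pow_nat_eq (-1 : F) (n := 2) two_pos
  have h2 : (2 : ZMod p) ≠ 0 := by
    intro h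
    have := (ZMod.natCast_eq_zero_iff 2 p).1 (by exact_mod_cast h)
    exact hp2 ((Nat.prime_dvd_prime_iff_eq hp Nat.prime_two).1 this)
  have ha0 : 0 < a := by linarith
  have hb0 : 0 < b := by linarith
  have hinj := isoEmb_injective_of_two_ne_zero (j := j) hi h2
  have hc := Finset.card_image_of_injective A hinj
  have hT : (Tstar A : ℝ) ≤ (isoTri (A.image (isoEmb j i))).card := by
    exact_mod_cast Tstar_le_card_isoTri hi hinj A
  have hN : (A.image (isoEmb j i)).card ^ 3 ≤ p ^ 4 := by
    rw [hc]
    have : (A.card : ℝ) ^ 3 ≤ (p : ℝ) ^ 4 := by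
      rw [hpa, hAb]
      calc (b ^ 12) ^ 3 = (b ^ 3) ^ 12 := by ring
        _ ≤ (a ^ 4) ^ 12 := by gcongr
        _ = _ := by ring
    exact_mod_cast this
  have h7 := card_isoTri_le_seven_thirds p (A.image (isoEmb j i)) hN (x := b ^ 4)
    (one_le_pow₀ hb) (by rw [hc, hAb]; ring)
  have hpos : 0 ≤ b ^ 36 / a ^ 12 := by positivity
  have h7' : (Tstar A : ℝ) - b ^ 36 / a ^ 12 ≤ 10 ^ 7 * b ^ 28 := by
    calc _ ≤ 10 ^ 7 * (b ^ 4) ^ 7 := by linarith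
      _ = _ := by ring
  rw [mul_min_of_nonneg _ _ (by norm_num)]
  refine le_min ?_ h7'
  rcases le_total b a with hle | hab
  · refine h7'.trans ?_
    have : b ^ 28 ≤ a ^ 8 * b ^ 20 := by
      calc b ^ 28 = b ^ 8 * b ^ 20 := by ring
        _ ≤ _ := by gcongr
    have h0 : 0 ≤ a ^ 3 * b ^ 24 := by positivity
    linarith
  · obtain ⟨K, hK, hK'⟩ := exists_richness A.card (by
      have : (0 : ℝ) < A.card := by rw [hAb]; positivity
      exact_mod_cast this)
    have hs : √(A.card : ℝ) = b ^ 6 := by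
      rw [hAb, show b ^ 12 = (b ^ 6) ^ 2 by ring]
      exact Real.sqrt_sq (by positivity)
    rw [hs] at hK'
    have hl : 1 ≤ b ^ 16 / a ^ 8 := by
      rw [le_div_iff₀ (by positivity), one_mul]
      calc a ^ 8 ≤ b ^ 8 := by gcongr
        _ ≤ b ^ 16 := pow_le_pow_right₀ hb (by norm_num)
    have hL1 := Nat.le_ceil (b ^ 16 / a ^ 8)
    have hL2 := (Nat.ceil_lt_add_one (by positivity : 0 ≤ b ^ 16 / a ^ 8)).le
    have hLpos : 0 < ⌈b ^ 16 / a ^ 8⌉₊ := Nat.ceil_pos.2 (by linarith)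
    have h := card_isoTri_isoEmb_le_of_finite (j := j) hi h2 A K _ hLpos hK
    have hQ := card_axisQuad_le p (A.image (isoEmb j i)) K hN
    rw [hc] at hQ
    rw [ZMod.card] at h
    rw [hpa, hAb] at h
    rw [hAb] at hQ
    simp only [← pow_mul, Nat.reduceMul] at h hQ
    have := excess_le_of_self_bound ha hab hba (Nat.cast_nonneg _) hK' hL1 (by linarith) hQ h
    linarith

end Transfer

lemma exists_pow_twelve {x : ℝ} (hx : 1 ≤ x) : ∃ a : ℝ, 1 ≤ a ∧ x = a ^ 12 ∧
    ∀ (r : ℝ) (n : ℕ), r * 12 = n → x ^ r = a ^ n := by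
  have hx0 : 0 ≤ x := by linarith
  have ha : 0 ≤ x ^ ((1 : ℝ) / 12) := by positivity
  have h1 : x = (x ^ ((1 : ℝ) / 12)) ^ 12 := by
    rw [← Real.rpow_mul_natCast hx0]
    norm_num
  refine ⟨x ^ ((1 : ℝ) / 12), Real.one_le_rpow hx (by norm_num), h1, fun r n h => ?_⟩
  rw [← Real.rpow_mul_natCast hx0, ← h]
  congr 1
  ring

/-- Isosceles-triangle bound over `F_p`: there is an absolute constant `C > 0` such that for
every prime `p` and `A ⊆ F_p²` with `|A| ≤ p^(4/3)`,
`T*(A) - |A|³/p ≤ C·min(p^(2/3)|A|^(5/3) + p^(1/4)|A|², |A|^(7/3))`. -/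
theorem isosceles_triangle_bound :
    ∃ C : ℝ, 0 < C ∧
      ∀ p : ℕ, p.Prime →
        ∀ A : Finset (ZMod p × ZMod p),
          (A.card : ℝ) ≤ (p : ℝ) ^ ((4 : ℝ) / 3) →
          (Tstar A : ℝ) - (A.card : ℝ) ^ 3 / (p : ℝ) ≤
            C * min
              ((p : ℝ) ^ ((2 : ℝ) / 3) * (A.card : ℝ) ^ ((5 : ℝ) / 3) +
                (p : ℝ) ^ ((1 : ℝ) / 4) * (A.card : ℝ) ^ 2)
              ((A.card : ℝ) ^ ((7 : ℝ) / 3)) := by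
  refine ⟨10 ^ 7, by norm_num, fun p hp A hA => ?_⟩
  have hT : (Tstar A : ℝ) ≤ (A.card : ℝ) ^ 3 := by exact_mod_cast Tstar_le_card_pow A
  rcases A.card.eq_zero_or_pos with h0 | hpos
  · rw [h0] at hT ⊢
    have : (0 : ℝ) ≤ 10 ^ 7 * min ((p : ℝ) ^ ((2 : ℝ) / 3) * ((0 : ℕ) : ℝ) ^ ((5 : ℝ) / 3) +
        (p : ℝ) ^ ((1 : ℝ) / 4) * ((0 : ℕ) : ℝ) ^ 2) (((0 : ℕ) : ℝ) ^ ((7 : ℝ) / 3)) := by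
      positivity
    refine le_trans ?_ this
    simpa using hT
  obtain ⟨a, ha, hpa, hra⟩ := exists_pow_twelve (x := (p : ℝ)) (by exact_mod_cast hp.one_le)
  obtain ⟨b, hb, hAb, hrb⟩ := exists_pow_twelve (x := (A.card : ℝ)) (by exact_mod_cast hpos)
  rw [hra _ 8 (by norm_num), hrb _ 20 (by norm_num), hra _ 3 (by norm_num),
    hrb _ 28 (by norm_num)]
  rw [hra _ 16 (by norm_num), hAb] at hA
  have hba : b ^ 3 ≤ a ^ 4 := by
    refine le_of_pow_le_pow_left₀ (n := 4) (by norm_num) (by positivity) ?_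
    calc (b ^ 3) ^ 4 = b ^ 12 := by ring
      _ ≤ a ^ 16 := hA
      _ = _ := by ring
  have e1 : (A.card : ℝ) ^ 3 / p = b ^ 36 / a ^ 12 := by rw [hpa, hAb]; ring
  have e2 : (A.card : ℝ) ^ 2 = b ^ 24 := by rw [hAb]; ring
  rw [e1, e2]
  by_cases hp2 : p = 2
  · subst hp2
    have hcard : A.card ≤ 4 := by
      refine (Finset.card_le_univ A).trans ?_
      rw [Fintype.card_prod, ZMod.card]
    have h64 : (A.card : ℝ) ^ 3 ≤ 4 ^ 3 := by
      gcongr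
      exact_mod_cast hcard
    have hmin : 1 ≤ min (a ^ 8 * b ^ 20 + a ^ 3 * b ^ 24) (b ^ 28) := by
      refine le_min ?_ (one_le_pow₀ hb)
      have h1 : 1 ≤ a ^ 8 * b ^ 20 := one_le_mul_of_one_le_of_one_le (one_le_pow₀ ha)
        (one_le_pow₀ hb)
      have h2 : 0 ≤ a ^ 3 * b ^ 24 := by positivity
      linarith
    have h3 : 0 ≤ b ^ 36 / a ^ 12 := by positivity
    linarith
  · exact Tstar_sub_le_of_odd hp hp2 A ha hb hpa hAb hba

end Stmt4
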